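/- Let Z=(X,Y) ∈ Ω₀ be a piecewise smooth vector field. Then Z is locally Σ-structurally stable with respect to Ω₀ near the origin if and only if Z ∈ Ω₁; that is: there exist a closed ball B ⊆ U centered at the origin and ε > 0 such that every Z'=(X',Y') ∈ Ω₀ with sup_{p∈B}(‖X(p) − X'(p)‖ + ‖DX(p) − DX'(p)‖) < ε and sup_{p∈B}(‖Y(p) − Y'(p)‖ + ‖DY(p) − DY'(p)‖) < ε is locally Σ-equivalent to Z near the origin, if and only if λ₁⁺ ≠ λ₂⁺, λ₁⁻ ≠ λ₂⁻, and ℓ ≠ 0. -/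

import Mathlib

open Set Filter

noncomputable section

/-- Entry (1,1) of the Jacobian matrix of `X` at the origin. -/
noncomputable def jac11 (X : ℝ × ℝ → ℝ × ℝ) : ℝ := (fderiv ℝ X (0, 0) (1, 0)).1
/-- Entry (1,2) of the Jacobian matrix of `X` at the origin. -/
noncomputable def jac12 (X : ℝ × ℝ → ℝ × ℝ) : ℝ := (fderiv ℝ X (0, 0) (0, 1)).1
/-- Entry (2,1) of the Jacobian matrix of `X` at the origin, i.e. `∂ₓX₂(0,0)`. -/
noncomputable def jac21 (X : ℝ × ℝ → ℝ × ℝ) : ℝ := (fderiv ℝ X (0, 0) (1, 0)).2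
/-- Entry (2,2) of the Jacobian matrix of `X` at the origin. -/
noncomputable def jac22 (X : ℝ × ℝ → ℝ × ℝ) : ℝ := (fderiv ℝ X (0, 0) (0, 1)).2

/-- Determinant of the Jacobian matrix of `X` at the origin. -/
noncomputable def detJ (X : ℝ × ℝ → ℝ × ℝ) : ℝ := jac11 X * jac22 X - jac12 X * jac21 X
/-- Trace of the Jacobian matrix of `X` at the origin. -/
noncomputable def trJ (X : ℝ × ℝ → ℝ × ℝ) : ℝ := jac11 X + jac22 X

/-- The first (complex) eigenvalue of the Jacobian matrix of `X` at the origin. -/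
noncomputable def eig1 (X : ℝ × ℝ → ℝ × ℝ) : ℂ :=
  if 0 ≤ trJ X ^ 2 - 4 * detJ X then
    (((trJ X + Real.sqrt (trJ X ^ 2 - 4 * detJ X)) / 2 : ℝ) : ℂ)
  else
    (((trJ X / 2 : ℝ) : ℂ) + (Real.sqrt (4 * detJ X - trJ X ^ 2) / 2 : ℝ) * Complex.I)

/-- The second (complex) eigenvalue of the Jacobian matrix of `X` at the origin. -/
noncomputable def eig2 (X : ℝ × ℝ → ℝ × ℝ) : ℂ :=
  if 0 ≤ trJ X ^ 2 - 4 * detJ X then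
    (((trJ X - Real.sqrt (trJ X ^ 2 - 4 * detJ X)) / 2 : ℝ) : ℂ)
  else
    (((trJ X / 2 : ℝ) : ℂ) - (Real.sqrt (4 * detJ X - trJ X ^ 2) / 2 : ℝ) * Complex.I)

/-- The quantity ℓ : `Re λ₁⁺/|Im λ₁⁺| + Re λ₁⁻/|Im λ₁⁻|` when both imaginary parts are
nonzero, and `1` otherwise. -/
noncomputable def ellVal (X Y : ℝ × ℝ → ℝ × ℝ) : ℝ :=
  if (eig1 X).im * (eig1 Y).im ≠ 0 then
    (eig1 X).re / |(eig1 X).im| + (eig1 Y).re / |(eig1 Y).im|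
  else 1

/-- Membership in Ω₀ : `Z = (X, Y)` is a piecewise `C¹` vector field on the open set `U`
containing the origin, the origin is a zero of both `X` and `Y`, it is non-degenerate for
both, and `∂ₓX₂(0,0) ⬝ ∂ₓY₂(0,0) > 0`. -/
def InOmega0 (U : Set (ℝ × ℝ)) (X Y : ℝ × ℝ → ℝ × ℝ) : Prop :=
  IsOpen U ∧ (0, 0) ∈ U ∧ ContDiffOn ℝ 1 X U ∧ ContDiffOn ℝ 1 Y U ∧
    X (0, 0) = (0, 0) ∧ Y (0, 0) = (0, 0) ∧ detJ X * detJ Y ≠ 0 ∧ jac21 X * jac21 Y > 0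

/-- Membership in Ω₁ : member of Ω₀ with distinct eigenvalues of each Jacobian matrix
and `ℓ ≠ 0`. -/
def InOmega1 (U : Set (ℝ × ℝ)) (X Y : ℝ × ℝ → ℝ × ℝ) : Prop :=
  InOmega0 U X Y ∧ eig1 X ≠ eig2 X ∧ eig1 Y ≠ eig2 Y ∧ ellVal X Y ≠ 0

/-- `γ` is a solution of `ẋ = X(x)` on the time set `I`. -/
def IsSolutionOn (X : ℝ × ℝ → ℝ × ℝ) (γ : ℝ → ℝ × ℝ) (I : Set ℝ) : Prop :=
  ∀ t ∈ I, HasDerivAt γ (X (γ t)) t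

/-- `H` maps orbit arcs of `X` lying in `S` onto orbit arcs of `X'` lying in `S'`,
preserving the direction of time (via an increasing homeomorphism of time intervals). -/
def MapsOrbits (X X' : ℝ × ℝ → ℝ × ℝ) (H : ℝ × ℝ → ℝ × ℝ) (S S' : Set (ℝ × ℝ)) : Prop :=
  ∀ (γ : ℝ → ℝ × ℝ) (I : Set ℝ), I.OrdConnected → IsSolutionOn X γ I →
    (∀ t ∈ I, γ t ∈ S) →
    ∃ (δ : ℝ → ℝ × ℝ) (J : Set ℝ) (τ : ℝ → ℝ),
      J.OrdConnected ∧ IsSolutionOn X' δ J ∧ (∀ s ∈ J, δ s ∈ S') ∧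
      Set.BijOn τ I J ∧ StrictMonoOn τ I ∧ ContinuousOn τ I ∧
      ∀ t ∈ I, H (γ t) = δ (τ t)

/-- Local Σ-equivalence near the origin between the piecewise smooth vector fields
`Z = (X, Y)` and `Z' = (X', Y')`: a homeomorphism `H` between neighborhoods of the origin
fixing the origin, preserving the switching line `{y = 0}`, and mapping orbit arcs of `X`
(resp. `Y`) in `{y ≥ 0}` (resp. `{y ≤ 0}`) onto orbit arcs of `X'` (resp. `Y'`),
preserving the direction of time, and conversely. -/
def LocalSigmaEquiv (X Y X' Y' : ℝ × ℝ → ℝ × ℝ) : Prop :=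
  ∃ (U₀ V₀ : Set (ℝ × ℝ)) (H Hinv : ℝ × ℝ → ℝ × ℝ),
    U₀ ∈ nhds ((0, 0) : ℝ × ℝ) ∧ V₀ ∈ nhds ((0, 0) : ℝ × ℝ) ∧
    ContinuousOn H U₀ ∧ ContinuousOn Hinv V₀ ∧
    Set.BijOn H U₀ V₀ ∧
    (∀ p ∈ U₀, Hinv (H p) = p) ∧ (∀ q ∈ V₀, H (Hinv q) = q) ∧
    H (0, 0) = (0, 0) ∧
    H '' (U₀ ∩ {p : ℝ × ℝ | p.2 = 0}) = V₀ ∩ {p : ℝ × ℝ | p.2 = 0} ∧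
    MapsOrbits X X' H (U₀ ∩ {p : ℝ × ℝ | 0 ≤ p.2}) (V₀ ∩ {p : ℝ × ℝ | 0 ≤ p.2}) ∧
    MapsOrbits Y Y' H (U₀ ∩ {p : ℝ × ℝ | p.2 ≤ 0}) (V₀ ∩ {p : ℝ × ℝ | p.2 ≤ 0}) ∧
    MapsOrbits X' X Hinv (V₀ ∩ {p : ℝ × ℝ | 0 ≤ p.2}) (U₀ ∩ {p : ℝ × ℝ | 0 ≤ p.2}) ∧
    MapsOrbits Y' Y Hinv (V₀ ∩ {p : ℝ × ℝ | p.2 ≤ 0}) (U₀ ∩ {p : ℝ × ℝ | p.2 ≤ 0})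


/-! ### M1: scalar non-autonomous flows -/

structure GoodG (G : ℝ → ℝ → ℝ) (M K : ℝ) : Prop where
  cont : Continuous (fun p : ℝ × ℝ => G p.1 p.2)
  bdd : ∀ t x, |G t x| ≤ M
  lip : ∀ t x y, |G t x - G t y| ≤ K * |x - y|

structure IsFlow (G : ℝ → ℝ → ℝ) (F : ℝ → ℝ → ℝ → ℝ) : Prop where
  init : ∀ t x, F t t x = x
  deriv : ∀ t t₀ x, HasDerivAt (fun t => F t t₀ x) (G t (F t t₀ x)) t

theorem GoodG.M_nonneg {G M K} (h : GoodG G M K) : 0 ≤ M :=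
  (abs_nonneg _).trans (h.bdd 0 0)

theorem GoodG.K_nonneg {G M K} (h : GoodG G M K) : 0 ≤ K := by
  have := (abs_nonneg _).trans (h.lip 0 1 0)
  simpa using this

theorem GoodG.lipWith {G M K} (h : GoodG G M K) (t : ℝ) : LipschitzWith K.toNNReal (G t) := by
  apply LipschitzWith.of_dist_le_mul
  intro x y
  rw [Real.dist_eq, Real.dist_eq, Real.coe_toNNReal _ h.K_nonneg]
  exact h.lip t x y

theorem GoodG.exists_sol {G M K} (h : GoodG G M K) (t₀ x : ℝ) :
    ∃ f : ℝ → ℝ, f t₀ = x ∧ ∀ t, HasDerivAt f (G t (f t)) t := by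
  have key : ∀ n : ℕ, ∃ f : ℝ → ℝ, f t₀ = x ∧
      ∀ t ∈ Ioo (t₀ - (n+1)) (t₀ + (n+1)), HasDerivAt f (G t (f t)) t := by
    intro n
    have hn : (0:ℝ) ≤ n := n.cast_nonneg
    have hmem : t₀ ∈ Icc (t₀ - (n+1)) (t₀ + (n+1)) := ⟨by linarith, by linarith⟩
    have hPL : IsPicardLindelof G (⟨t₀, hmem⟩ : Icc (t₀ - (n+1)) (t₀ + (n+1))) x
        ((M * (n+1)).toNNReal) 0 M.toNNReal K.toNNReal := by
      constructor
      · intro t _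
        exact (h.lipWith t).lipschitzOnWith
      · intro y _
        exact (h.cont.comp (by fun_prop : Continuous fun t : ℝ => (t, y))).continuousOn
      · intro t _ y _
        rw [Real.coe_toNNReal _ h.M_nonneg]
        exact h.bdd t y
      · have h0 : 0 ≤ M * (n+1) := mul_nonneg h.M_nonneg (by positivity)
        simp only [NNReal.coe_zero, sub_zero]
        rw [Real.coe_toNNReal _ h.M_nonneg, Real.coe_toNNReal _ h0]
        have : max (t₀ + ((n:ℝ)+1) - t₀) (t₀ - (t₀ - ((n:ℝ)+1))) = n+1 := by
          rw [add_sub_cancel_left, sub_sub_cancel, max_self]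
        rw [this]
    obtain ⟨f, hf0, hf⟩ := hPL.exists_eq_forall_mem_Icc_hasDerivWithinAt₀
    refine ⟨f, hf0, fun t ht => ?_⟩
    exact (hf t (Ioo_subset_Icc_self ht)).hasDerivAt (Icc_mem_nhds ht.1 ht.2)
  choose f hf0 hf using key
  have hag : ∀ m n : ℕ, m ≤ n → EqOn (f m) (f n) (Ioo (t₀ - (m+1)) (t₀ + (m+1))) := by
    intro m n hmn
    have hmn' : (m:ℝ) ≤ n := by exact_mod_cast hmn
    have hm : (0:ℝ) ≤ m := m.cast_nonneg
    apply ODE_solution_unique_of_mem_Ioo (v := G) (s := fun _ => univ) (K := K.toNNReal) (t₀ := t₀)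
    · intro t _; exact (h.lipWith t).lipschitzOnWith
    · constructor <;> linarith
    · intro t ht; exact ⟨hf m t ht, trivial⟩
    · intro t ht; exact ⟨hf n t ⟨by linarith [ht.1], by linarith [ht.2]⟩, trivial⟩
    · rw [hf0, hf0]
  refine ⟨fun t => f ⌈|t - t₀|⌉₊ t, hf0 _, fun t => ?_⟩
  set N := ⌈|t - t₀|⌉₊ with hN
  have hNt : |t - t₀| ≤ N := Nat.le_ceil _
  have htm : t ∈ Ioo (t₀ - (N+1)) (t₀ + (N+1)) := by
    rw [abs_le] at hNt; constructor <;> linarith [hNt.1, hNt.2]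
  have hev : (fun t => f ⌈|t - t₀|⌉₊ t) =ᶠ[nhds t] f (N+1) := by
    filter_upwards [Ioo_mem_nhds htm.1 htm.2] with u hu
    have hle : ⌈|u - t₀|⌉₊ ≤ N + 1 := by
      apply Nat.ceil_le.mpr
      rw [abs_le]; push_cast; constructor <;> linarith [hu.1, hu.2]
    apply hag _ _ hle
    have := Nat.le_ceil |u - t₀|
    rw [abs_le] at this
    constructor <;> linarith [this.1, this.2]
  have h1 : HasDerivAt (f (N+1)) (G t (f (N+1) t)) t := by
    apply hf; push_cast; constructor <;> linarith [htm.1, htm.2]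
  have := h1.congr_of_eventuallyEq hev
  have e : f N t = f (N+1) t := hev.eq_of_nhds
  show HasDerivAt _ (G t (f N t)) t
  rw [e]; exact this

theorem GoodG.exists_flow {G M K} (h : GoodG G M K) : ∃ F, IsFlow G F := by
  choose F h0 h1 using h.exists_sol
  exact ⟨fun t t₀ x => F t₀ x t, fun t x => h0 t x, fun t t₀ x => h1 t₀ x t⟩

namespace IsFlow
variable {G : ℝ → ℝ → ℝ} {F : ℝ → ℝ → ℝ → ℝ} {M K : ℝ}

theorem unique (hF : IsFlow G F) (h : GoodG G M K) {f : ℝ → ℝ}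
    (hf : ∀ t, HasDerivAt f (G t (f t)) t) (t t₀ : ℝ) : F t t₀ (f t₀) = f t := by
  have := ODE_solution_unique_univ (v := G) (s := fun _ => univ) (K := K.toNNReal) (t₀ := t₀)
    (f := fun t => F t t₀ (f t₀)) (g := f)
    (fun t => (h.lipWith t).lipschitzOnWith) (fun t => ⟨hF.deriv t t₀ _, trivial⟩)
    (fun t => ⟨hf t, trivial⟩) (hF.init _ _)
  exact congrFun this t

theorem comp (hF : IsFlow G F) (h : GoodG G M K) (t₂ t₁ t₀ x : ℝ) :
    F t₂ t₁ (F t₁ t₀ x) = F t₂ t₀ x :=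
  hF.unique h (f := fun t => F t t₀ x) (fun t => hF.deriv t t₀ x) t₂ t₁

theorem inv (hF : IsFlow G F) (h : GoodG G M K) (t₁ t₀ x : ℝ) :
    F t₀ t₁ (F t₁ t₀ x) = x := by rw [hF.comp h, hF.init]

theorem cont_t (hF : IsFlow G F) (t₀ x : ℝ) : Continuous (fun t => F t t₀ x) :=
  continuous_iff_continuousAt.mpr fun t => (hF.deriv t t₀ x).continuousAt

theorem inj (hF : IsFlow G F) (h : GoodG G M K) (t₁ t₀ : ℝ) : Function.Injective (F t₁ t₀) := by
  intro x y hxy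
  rw [← hF.inv h t₁ t₀ x, ← hF.inv h t₁ t₀ y, hxy]

theorem speed (hF : IsFlow G F) (h : GoodG G M K) (t s t₀ x : ℝ) :
    |F t t₀ x - F s t₀ x| ≤ M * |t - s| := by
  have := convex_univ.norm_image_sub_le_of_norm_hasDerivWithin_le
    (f := fun t => F t t₀ x) (f' := fun t => G t (F t t₀ x)) (C := M)
    (fun u _ => (hF.deriv u t₀ x).hasDerivWithinAt) (fun u _ => h.bdd _ _)
    (mem_univ s) (mem_univ t)
  simpa using this

theorem mono (hF : IsFlow G F) (h : GoodG G M K) (t t₀ : ℝ) : StrictMono (F t t₀) := by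
  intro x y hxy
  by_contra hle
  push Not at hle
  have hc : Continuous (fun u => F u t₀ y - F u t₀ x) := (hF.cont_t t₀ y).sub (hF.cont_t t₀ x)
  have : (0:ℝ) ∈ (fun u => F u t₀ y - F u t₀ x) '' univ := by
    have hp : IsPreconnected ((fun u => F u t₀ y - F u t₀ x) '' univ) :=
      isPreconnected_univ.image _ hc.continuousOn
    apply hp.ordConnected.out (x := F t t₀ y - F t t₀ x) (y := F t₀ t₀ y - F t₀ t₀ x)
      ⟨t, trivial, rfl⟩ ⟨t₀, trivial, rfl⟩
    rw [hF.init, hF.init]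
    constructor <;> linarith
  obtain ⟨u, -, hu⟩ := this
  exact hxy.ne' (hF.inj h u t₀ (by simpa [sub_eq_zero] using hu))

theorem dist_le (hF : IsFlow G F) (h : GoodG G M K) (t t₀ x y : ℝ) :
    |F t t₀ x - F t t₀ y| ≤ |x - y| * Real.exp (K * |t - t₀|) := by
  rcases le_total t₀ t with htt | htt
  · have := dist_le_of_trajectories_ODE (v := G) (K := K.toNNReal) (a := t₀) (b := t)
      (f := fun t => F t t₀ x) (g := fun t => F t t₀ y) (δ := |x - y|) h.lipWith
      (hF.cont_t _ _).continuousOn (fun u _ => (hF.deriv u _ _).hasDerivWithinAt)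
      (hF.cont_t _ _).continuousOn (fun u _ => (hF.deriv u _ _).hasDerivWithinAt)
      (by simp [hF.init, Real.dist_eq]) t ⟨htt, le_rfl⟩
    rw [Real.dist_eq, Real.coe_toNNReal _ h.K_nonneg] at this
    rwa [abs_of_nonneg (sub_nonneg.mpr htt)]
  · have := dist_le_of_trajectories_ODE (v := fun t x => - G (-t) x) (K := K.toNNReal)
      (a := -t₀) (b := -t)
      (f := fun t => F (-t) t₀ x) (g := fun t => F (-t) t₀ y) (δ := |x - y|)
      (fun u => (h.lipWith (-u)).neg)
      ((hF.cont_t _ _).comp continuous_neg).continuousOn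
      (fun u _ => by
        have := ((hF.deriv (-u) t₀ x).comp u (hasDerivAt_neg u)).hasDerivWithinAt (s := Ici u)
        simpa [Function.comp_def] using this)
      ((hF.cont_t _ _).comp continuous_neg).continuousOn
      (fun u _ => by
        have := ((hF.deriv (-u) t₀ y).comp u (hasDerivAt_neg u)).hasDerivWithinAt (s := Ici u)
        simpa [Function.comp_def] using this)
      (by simp [hF.init, Real.dist_eq]) (-t) ⟨by linarith, le_rfl⟩
    rw [Real.dist_eq, Real.coe_toNNReal _ h.K_nonneg] at this
    rw [abs_of_nonpos (sub_nonpos.mpr htt)]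
    simp only [neg_neg] at this
    convert this using 3
    ring

theorem cont (hF : IsFlow G F) (h : GoodG G M K) :
    Continuous (fun q : ℝ × ℝ × ℝ => F q.1 q.2.1 q.2.2) := by
  rw [continuous_iff_continuousAt]
  rintro ⟨t, t₀, x⟩
  rw [ContinuousAt, tendsto_iff_dist_tendsto_zero]
  have hb : ∀ q : ℝ × ℝ × ℝ, dist (F q.1 q.2.1 q.2.2) (F t t₀ x) ≤
      (|q.2.2 - x| + M * |q.2.1 - t₀|) * Real.exp (K * |q.1 - t₀|) + M * |q.1 - t| := by
    rintro ⟨t', t₀', x'⟩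
    simp only [Real.dist_eq]
    have e1 := hF.dist_le h t' t₀ (F t₀ t₀' x') x
    rw [hF.comp h] at e1
    have e2 := hF.speed h t₀ t₀' t₀' x'
    rw [hF.init] at e2
    have e3 := hF.speed h t' t t₀ x
    have e4 : |F t₀ t₀' x' - x| ≤ |x' - x| + M * |t₀' - t₀| := by
      calc |F t₀ t₀' x' - x| ≤ |F t₀ t₀' x' - x'| + |x' - x| := abs_sub_le _ _ _
        _ ≤ _ := by rw [abs_sub_comm t₀ t₀'] at e2; linarith
    calc |F t' t₀' x' - F t t₀ x| ≤ |F t' t₀' x' - F t' t₀ x| + |F t' t₀ x - F t t₀ x| :=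
          abs_sub_le _ _ _
      _ ≤ _ := by
        gcongr
        exact e1.trans (by gcongr)
  refine squeeze_zero (fun _ => dist_nonneg) hb ?_
  have hc : Continuous (fun q : ℝ × ℝ × ℝ =>
      (|q.2.2 - x| + M * |q.2.1 - t₀|) * Real.exp (K * |q.1 - t₀|) + M * |q.1 - t|) := by fun_prop
  have := hc.tendsto (t, t₀, x)
  simpa using this

end IsFlow

/-- two-sided uniqueness for a linear differential inequality -/
theorem zero_of_deriv_le {E : Type*} [NormedAddCommGroup E] [NormedSpace ℝ E]
    {f f' : ℝ → E} {K : ℝ} {I : Set ℝ} (hI : I.OrdConnected)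
    (hf : ∀ t ∈ I, HasDerivAt f (f' t) t) (hb : ∀ t ∈ I, ‖f' t‖ ≤ K * ‖f t‖)
    {t₀ : ℝ} (ht₀ : t₀ ∈ I) (h0 : f t₀ = 0) : ∀ t ∈ I, f t = 0 := by
  intro t ht
  rcases le_total t₀ t with htt | htt
  · have hs : Icc t₀ t ⊆ I := hI.out ht₀ ht
    exact eq_zero_of_abs_deriv_le_mul_abs_self_of_eq_zero_right
      (f := f) (f' := f') (K := K) (a := t₀) (b := t)
      (fun u hu => (hf u (hs hu)).continuousAt.continuousWithinAt)
      (fun u hu => (hf u (hs (Ico_subset_Icc_self hu))).hasDerivWithinAt) h0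
      (fun u hu => hb u (hs (Ico_subset_Icc_self hu))) t ⟨htt, le_rfl⟩
  · have hs : Icc t t₀ ⊆ I := hI.out ht ht₀
    have hs' : ∀ u ∈ Icc (-t₀) (-t), -u ∈ I := fun u hu =>
      hs ⟨by linarith [hu.2], by linarith [hu.1]⟩
    have hd : ∀ u ∈ Icc (-t₀) (-t), HasDerivAt (fun u => f (-u)) (- f' (-u)) u := by
      intro u hu
      have := (hf (-u) (hs' u hu)).scomp u (hasDerivAt_neg u)
      simpa [Function.comp_def] using this
    have := eq_zero_of_abs_deriv_le_mul_abs_self_of_eq_zero_right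
      (f := fun u => f (-u)) (f' := fun u => - f' (-u)) (K := K) (a := -t₀) (b := -t)
      (fun u hu => (hd u hu).continuousAt.continuousWithinAt)
      (fun u hu => (hd u (Ico_subset_Icc_self hu)).hasDerivWithinAt) (by simpa using h0)
      (fun u hu => by rw [norm_neg]; exact hb _ (hs' u (Ico_subset_Icc_self hu)))
      (-t) ⟨by linarith, le_rfl⟩
    simpa using this


/-! ### M2: oriented reparametrised orbit arcs -/

section OC
variable {E : Type*} [NormedAddCommGroup E] [NormedSpace ℝ E]

/-- `c` restricted to `I` is an orientation-preserving reparametrisation of a solution. -/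
def OC (X : E → E) (c : ℝ → E) (I : Set ℝ) : Prop :=
  ∃ (δ : ℝ → E) (J : Set ℝ) (τ : ℝ → ℝ), J.OrdConnected ∧
    (∀ t ∈ J, HasDerivAt δ (X (δ t)) t) ∧ BijOn τ I J ∧ StrictMonoOn τ I ∧ ContinuousOn τ I ∧
    ∀ t ∈ I, c t = δ (τ t)

theorem OC.of_sol {X : E → E} {c : ℝ → E} {I : Set ℝ} (hI : I.OrdConnected)
    (h : ∀ t ∈ I, HasDerivAt c (X (c t)) t) : OC X c I :=
  ⟨c, I, id, hI, h, bijOn_id I, strictMonoOn_id, continuousOn_id, fun _ _ => rfl⟩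

theorem OC.congr {X : E → E} {c c' : ℝ → E} {I : Set ℝ} (h : OC X c I)
    (hc : ∀ t ∈ I, c' t = c t) : OC X c' I := by
  obtain ⟨δ, J, τ, h1, h2, h3, h4, h5, h6⟩ := h
  exact ⟨δ, J, τ, h1, h2, h3, h4, h5, fun t ht => (hc t ht).trans (h6 t ht)⟩

theorem OC.continuousOn {X : E → E} {c : ℝ → E} {I : Set ℝ} (h : OC X c I) :
    ContinuousOn c I := by
  obtain ⟨δ, J, τ, h1, h2, h3, h4, h5, h6⟩ := h
  have : ContinuousOn (δ ∘ τ) I :=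
    ContinuousOn.comp (t := J) (fun t ht => (h2 t ht).continuousAt.continuousWithinAt) h5 h3.mapsTo
  exact this.congr h6

theorem ordConnected_image {f : ℝ → ℝ} {I : Set ℝ} (hI : I.OrdConnected)
    (hf : ContinuousOn f I) : (f '' I).OrdConnected :=
  ((isPreconnected_iff_ordConnected.mpr hI).image f hf).ordConnected

theorem OC.mono {X : E → E} {c : ℝ → E} {I I' : Set ℝ} (h : OC X c I)
    (hI' : I'.OrdConnected) (hs : I' ⊆ I) : OC X c I' := by
  obtain ⟨δ, J, τ, h1, h2, h3, h4, h5, h6⟩ := h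
  refine ⟨δ, τ '' I', τ, ordConnected_image hI' (h5.mono hs), ?_, ?_, h4.mono hs, h5.mono hs,
    fun t ht => h6 t (hs ht)⟩
  · rintro _ ⟨t, ht, rfl⟩
    exact h2 _ (h3.mapsTo (hs ht))
  · exact (h4.mono hs).injOn.bijOn_image

theorem OC.neg {X : E → E} {c : ℝ → E} {I : Set ℝ} (h : OC X c I) :
    OC (fun p => - X p) (fun t => c (-t)) (-I) := by
  obtain ⟨δ, J, τ, h1, h2, h3, h4, h5, h6⟩ := h
  refine ⟨fun t => δ (-t), -J, fun t => - τ (-t), ?_, ?_, ?_, ?_, ?_, ?_⟩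
  · refine ⟨fun x hx y hy z hz => h1.out hy hx ⟨?_, ?_⟩⟩
    · simpa using hz.2
    · simpa using hz.1
  · intro t ht
    have := (h2 (-t) ht).scomp t (hasDerivAt_neg t)
    simpa [Function.comp_def] using this
  · refine ⟨fun t ht => ?_, fun x hx y hy hxy => ?_, fun s hs => ?_⟩
    · simpa using h3.mapsTo ht
    · have := h3.injOn hx hy (neg_injective hxy)
      exact neg_injective this
    · obtain ⟨t, ht, hts⟩ := h3.surjOn (show -s ∈ J from hs)
      exact ⟨-t, by simpa using ht, by simp [hts]⟩
  · intro x hx y hy hxy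
    exact neg_lt_neg (h4 hy hx (neg_lt_neg hxy))
  · have : ContinuousOn (fun t => τ (-t)) (-I) :=
      h5.comp continuous_neg.continuousOn (fun t ht => ht)
    exact this.neg
  · intro t ht
    simpa using h6 (-t) ht

theorem OC.neg_iff {X : E → E} {c : ℝ → E} {I : Set ℝ} :
    OC (fun p => - X p) (fun t => c (-t)) (-I) ↔ OC X c I :=
  ⟨fun h => by simpa using h.neg, OC.neg⟩

theorem ordConnected_shift {J : Set ℝ} (hJ : J.OrdConnected) (a : ℝ) :
    ({t | t + a ∈ J} : Set ℝ).OrdConnected :=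
  ⟨fun x hx y hy z hz => hJ.out hx hy ⟨by linarith [hz.1], by linarith [hz.2]⟩⟩

/-- normalise the time so that `τ t₀ = 0`. -/
theorem OC.normalize {X : E → E} {c : ℝ → E} {I : Set ℝ} (h : OC X c I) {t₀ : ℝ} (_ht₀ : t₀ ∈ I) :
    ∃ (δ : ℝ → E) (J : Set ℝ) (τ : ℝ → ℝ), τ t₀ = 0 ∧ J.OrdConnected ∧
    (∀ t ∈ J, HasDerivAt δ (X (δ t)) t) ∧ BijOn τ I J ∧ StrictMonoOn τ I ∧ ContinuousOn τ I ∧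
    ∀ t ∈ I, c t = δ (τ t) := by
  obtain ⟨δ, J, τ, h1, h2, h3, h4, h5, h6⟩ := h
  refine ⟨fun t => δ (t + τ t₀), {t | t + τ t₀ ∈ J}, fun t => τ t - τ t₀, by simp,
    ordConnected_shift h1 _, ?_, ?_, ?_, ?_, ?_⟩
  · intro t ht
    have := (h2 _ ht).comp_add_const t (τ t₀)
    exact this
  · refine ⟨fun t ht => ?_, fun x hx y hy hxy => ?_, fun s hs => ?_⟩
    · simpa using h3.mapsTo ht
    · exact h3.injOn hx hy (by simpa using hxy)
    · obtain ⟨t, ht, hts⟩ := h3.surjOn hs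
      exact ⟨t, ht, by simp [hts]⟩
  · intro x hx y hy hxy
    have := h4 hx hy hxy
    simpa using this
  · exact h5.sub continuousOn_const
  · intro t ht
    simpa using h6 t ht

theorem OC.glue {X : E → E} {c : ℝ → E} {I : Set ℝ} (hI : I.OrdConnected) {t₀ : ℝ} (ht₀ : t₀ ∈ I)
    (h : OC X c (I ∩ Iic t₀)) (h' : OC X c (I ∩ Ici t₀)) : OC X c I := by
  obtain ⟨δ, J, τ, h0, h1, h2, h3, h4, h5, h6⟩ := h.normalize (t₀ := t₀) ⟨ht₀, self_mem_Iic⟩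
  obtain ⟨δ', J', τ', h0', h1', h2', h3', h4', h5', h6'⟩ := h'.normalize (t₀ := t₀) ⟨ht₀, self_mem_Ici⟩
  have hneg : ∀ t ∈ I, t ≤ t₀ → τ t ≤ 0 := fun t ht htt => by
    have := h4.monotoneOn ⟨ht, htt⟩ ⟨ht₀, le_refl t₀⟩ htt
    rwa [h0] at this
  have hpos : ∀ t ∈ I, t₀ ≤ t → 0 ≤ τ' t := fun t ht htt => by
    have := h4'.monotoneOn ⟨ht₀, le_refl t₀⟩ ⟨ht, htt⟩ htt
    rwa [h0'] at this
  have hpos' : ∀ t ∈ I, t₀ < t → 0 < τ' t := fun t ht htt => by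
    have := h4' ⟨ht₀, le_refl t₀⟩ ⟨ht, htt.le⟩ htt
    rwa [h0'] at this
  have hδ0 : δ 0 = δ' 0 := by
    rw [← h0, ← h6 t₀ ⟨ht₀, le_refl t₀⟩, h6' t₀ ⟨ht₀, le_refl t₀⟩, h0', h0]
  have hJneg : ∀ s ∈ J, s ≤ 0 := fun s hs => by
    obtain ⟨t, ht, rfl⟩ := h3.surjOn hs; exact hneg t ht.1 ht.2
  have hJpos : ∀ s ∈ J', 0 ≤ s := fun s hs => by
    obtain ⟨t, ht, rfl⟩ := h3'.surjOn hs; exact hpos t ht.1 ht.2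
  have h0J : (0:ℝ) ∈ J := h0 ▸ h3.mapsTo ⟨ht₀, le_refl t₀⟩
  have h0J' : (0:ℝ) ∈ J' := h0' ▸ h3'.mapsTo ⟨ht₀, le_refl t₀⟩
  set D : ℝ → E := fun s => if s ≤ 0 then δ s else δ' s with hD
  set T : ℝ → ℝ := fun t => if t ≤ t₀ then τ t else τ' t with hT
  have hTle : ∀ t, t ≤ t₀ → T t = τ t := fun t ht => if_pos ht
  have hTge : ∀ t, t₀ ≤ t → T t = τ' t := fun t ht => by
    rcases ht.eq_or_lt with h | h
    · subst h; rw [hTle _ le_rfl, h0, h0']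
    · exact if_neg (not_le.mpr h)
  have hDge : ∀ s, 0 ≤ s → D s = δ' s := fun s hs => by
    rcases hs.eq_or_lt with h | h
    · subst h; rw [← hδ0]; exact if_pos le_rfl
    · exact if_neg (not_le.mpr h)
  have hTmono : StrictMonoOn T I := by
    intro x hx y hy hxy
    rcases le_total y t₀ with hy0 | hy0
    · rw [hTle _ hy0, hTle _ (hxy.le.trans hy0)]
      exact h4 ⟨hx, hxy.le.trans hy0⟩ ⟨hy, hy0⟩ hxy
    · rcases le_or_gt t₀ x with hx0 | hx0
      · rw [hTge _ hy0, hTge _ hx0]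
        exact h4' ⟨hx, hx0⟩ ⟨hy, hy0⟩ hxy
      · rw [hTge _ hy0, hTle _ hx0.le]
        have := h4 ⟨hx, hx0.le⟩ ⟨ht₀, le_refl t₀⟩ hx0
        rw [h0] at this
        exact this.trans_le (hpos y hy hy0)
  refine ⟨D, J ∪ J', T, ?_, ?_, ?_, hTmono, ?_, ?_⟩
  · refine ⟨fun x hx y hy z hz => ?_⟩
    rcases le_total z 0 with hz0 | hz0
    · left
      rcases hx with hx | hx
      · exact h1.out hx h0J ⟨hz.1, hz0⟩
      · have := hJpos x hx
        have : z = 0 := le_antisymm hz0 (this.trans hz.1)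
        exact this ▸ h0J
    · right
      rcases hy with hy | hy
      · have := hJneg y hy
        have : z = 0 := le_antisymm (hz.2.trans this) hz0
        exact this ▸ h0J'
      · exact h1'.out h0J' hy ⟨hz0, hz.2⟩
  · intro s hs
    have hd1 : ∀ s ≤ 0, s ∈ J → HasDerivWithinAt D (X (D s)) (Iic s) s := fun s hs0 hs => by
      have e : D s = δ s := if_pos hs0
      rw [e]
      refine (h2 s hs).hasDerivWithinAt.congr (fun u hu => if_pos (le_trans hu hs0)) e
    have hd2 : ∀ s ≥ 0, s ∈ J' → HasDerivWithinAt D (X (D s)) (Ici s) s := fun s hs0 hs => by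
      have e : D s = δ' s := hDge s hs0
      rw [e]
      exact (h2' s hs).hasDerivWithinAt.congr (fun u hu => hDge u (le_trans hs0 hu)) e
    rcases lt_trichotomy s 0 with h | h | h
    · have hsJ : s ∈ J := hs.resolve_right fun h' => absurd (hJpos s h') (not_le.mpr h)
      have hev : D =ᶠ[nhds s] δ := by
        filter_upwards [Iio_mem_nhds h] with u hu using if_pos (le_of_lt hu)
      rw [hev.eq_of_nhds]
      exact (h2 s hsJ).congr_of_eventuallyEq hev
    · subst h
      have := (hd1 0 le_rfl h0J).union (hd2 0 le_rfl h0J')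
      rwa [Iic_union_Ici, hasDerivWithinAt_univ] at this
    · have hsJ : s ∈ J' := hs.resolve_left fun h' => absurd (hJneg s h') (not_le.mpr h)
      have hev : D =ᶠ[nhds s] δ' := by
        filter_upwards [Ioi_mem_nhds h] with u hu using hDge u (le_of_lt hu)
      rw [hev.eq_of_nhds]
      exact (h2' s hsJ).congr_of_eventuallyEq hev
  · refine ⟨fun t ht => ?_, hTmono.injOn, fun s hs => ?_⟩
    · rcases le_total t t₀ with h | h
      · left; rw [hTle _ h]; exact h3.mapsTo ⟨ht, h⟩
      · right; rw [hTge _ h]; exact h3'.mapsTo ⟨ht, h⟩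
    · rcases hs with hs | hs
      · obtain ⟨t, ht, hts⟩ := h3.surjOn hs
        exact ⟨t, ht.1, (hTle t ht.2).trans hts⟩
      · obtain ⟨t, ht, hts⟩ := h3'.surjOn hs
        exact ⟨t, ht.1, (hTge t ht.2).trans hts⟩
  · have hA : ContinuousOn T (I ∩ Iic t₀) := h5.congr (fun t ht => hTle t ht.2)
    have hB : ContinuousOn T (I ∩ Ici t₀) := h5'.congr (fun t ht => hTge t ht.2)
    intro t ht
    have hu : I = (I ∩ Iic t₀) ∪ (I ∩ Ici t₀) := by
      rw [← inter_union_distrib_left, Iic_union_Ici, inter_univ]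
    rcases lt_trichotomy t t₀ with h | h | h
    · have := hA t ⟨ht, h.le⟩
      exact (continuousWithinAt_inter (Iic_mem_nhds h)).mp this
    · subst h
      rw [hu]
      exact (hA t ⟨ht, le_refl t⟩).union (hB t ⟨ht, le_refl t⟩)
    · have := hB t ⟨ht, h.le⟩
      exact (continuousWithinAt_inter (Ici_mem_nhds h)).mp this
  · intro t ht
    rcases le_total t t₀ with h | h
    · rw [hTle _ h, h6 t ⟨ht, h⟩]
      exact (if_pos (hneg t ht h)).symm
    · rw [hTge _ h, h6' t ⟨ht, h⟩, hDge _ (hpos t ht h)]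

/-- conjugation by a linear isomorphism -/
theorem OC.conj {E' : Type*} [NormedAddCommGroup E'] [NormedSpace ℝ E'] (T : E ≃L[ℝ] E')
    {X : E → E} {X' : E' → E'} (hX : ∀ p, X' (T p) = T (X p)) {c : ℝ → E} {I : Set ℝ}
    (h : OC X c I) : OC X' (fun t => T (c t)) I := by
  obtain ⟨δ, J, τ, h1, h2, h3, h4, h5, h6⟩ := h
  refine ⟨fun t => T (δ t), J, τ, h1, ?_, h3, h4, h5, fun t ht => by simp only [h6 t ht]⟩
  intro t ht
  rw [hX]
  exact T.hasFDerivAt.comp_hasDerivAt t (h2 t ht)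

theorem OC.conj_iff {E' : Type*} [NormedAddCommGroup E'] [NormedSpace ℝ E'] (T : E ≃L[ℝ] E')
    {X : E → E} {X' : E' → E'} (hX : ∀ p, X' (T p) = T (X p)) {c : ℝ → E} {I : Set ℝ} :
    OC X' (fun t => T (c t)) I ↔ OC X c I := by
  refine ⟨fun h => ?_, OC.conj T hX⟩
  have := h.conj T.symm (X' := X) (fun p => by
    have := hX (T.symm p)
    rw [T.apply_symm_apply] at this
    rw [this, T.symm_apply_apply])
  simpa using this

theorem OC.zero {X : E → E} (hX : X 0 = 0) {c : ℝ → E} {I : Set ℝ} (hI : I.OrdConnected)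
    (hc : ∀ t ∈ I, c t = 0) : OC X c I :=
  (OC.of_sol (c := fun _ => (0:E)) hI
    (fun t _ => by rw [hX]; exact hasDerivAt_const t 0)).congr hc

theorem OC.eq_zero {X : E → E} {W : Set E} {K : ℝ} (hK : ∀ p ∈ W, ‖X p‖ ≤ K * ‖p‖)
    {c : ℝ → E} {I : Set ℝ} (h : OC X c I) (hW : ∀ t ∈ I, c t ∈ W) {t₀ : ℝ} (ht₀ : t₀ ∈ I)
    (h0 : c t₀ = 0) : ∀ t ∈ I, c t = 0 := by
  obtain ⟨δ, J, τ, h1, h2, h3, h4, h5, h6⟩ := h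
  have := zero_of_deriv_le h1 h2 (K := K) (fun s hs => by
    obtain ⟨t, ht, rfl⟩ := h3.surjOn hs
    exact hK _ (by rw [← h6 t ht]; exact hW t ht)) (h3.mapsTo ht₀) (by rw [← h6 _ ht₀, h0])
  intro t ht
  rw [h6 t ht]; exact this _ (h3.mapsTo ht)

theorem OC.of_kappa {X : E → E} {κ : ℝ → E} {ρ : ℝ → ℝ} {c₀ : ℝ} (hc₀ : 0 < c₀)
    (hρ : Continuous ρ) (hρ0 : ∀ s, c₀ ≤ ρ s) {c : ℝ → E} {I : Set ℝ} (hI : I.OrdConnected)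
    {σ : ℝ → ℝ} (hσ : StrictMonoOn σ I) (hσc : ContinuousOn σ I)
    (hκ : ∀ t ∈ I, HasDerivAt κ (ρ (σ t) • X (κ (σ t))) (σ t))
    (hc : ∀ t ∈ I, c t = κ (σ t)) : OC X c I := by
  set R : ℝ → ℝ := fun s => ∫ u in (0:ℝ)..s, ρ u with hR
  have hRd : ∀ s, HasDerivAt R (ρ s) s := fun s =>
    (hρ.integral_hasStrictDerivAt 0 s).hasDerivAt
  have hRm : StrictMono R := strictMono_of_deriv_pos (fun s => by
    rw [(hRd s).deriv]; exact hc₀.trans_le (hρ0 s))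
  have hRc : Continuous R := continuous_iff_continuousAt.mpr fun s => (hRd s).continuousAt
  have hS : Monotone (fun s => R s - c₀ * s) := by
    have hd : ∀ s, HasDerivAt (fun s => R s - c₀ * s) (ρ s - c₀ * 1) s := fun s =>
      (hRd s).sub ((hasDerivAt_id s).const_mul c₀)
    apply monotone_of_deriv_nonneg (fun s => (hd s).differentiableAt)
    intro s
    rw [(hd s).deriv]; linarith [hρ0 s]
  have hR0 : R 0 = 0 := by simp [hR]
  have hsurj : Function.Surjective R := by
    apply hRc.surjective
    · refine tendsto_atTop_mono' _ ?_ (tendsto_id.const_mul_atTop hc₀)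
      filter_upwards [eventually_ge_atTop 0] with s hs
      have := hS hs
      simp [hR0] at this; simpa using this
    · refine tendsto_atBot_mono' _ ?_ (tendsto_id.const_mul_atBot hc₀)
      filter_upwards [eventually_le_atBot 0] with s hs
      have := hS hs
      simp [hR0] at this; simpa using this
  let e := StrictMono.orderIsoOfSurjective R hRm hsurj
  have he : ∀ s, e s = R s := fun s => rfl
  refine ⟨fun s => κ (e.symm s), (R ∘ σ) '' I, R ∘ σ, ordConnected_image hI
    (hRc.comp_continuousOn hσc), ?_, ?_, hRm.comp_strictMonoOn hσ, hRc.comp_continuousOn hσc, ?_⟩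
  · rintro _ ⟨t, ht, rfl⟩
    have hne : ρ (σ t) ≠ 0 := (hc₀.trans_le (hρ0 _)).ne'
    have h1 : HasDerivAt e.symm (ρ (σ t))⁻¹ (R (σ t)) := by
      apply HasDerivAt.of_local_left_inverse (f := R)
      · exact e.symm.continuous.continuousAt
      · rw [← he, e.symm_apply_apply]; exact hRd _
      · exact hne
      · exact Eventually.of_forall fun y => e.apply_symm_apply y
    have e1 : e.symm (R (σ t)) = σ t := e.symm_apply_apply _
    have h2 := hκ t ht
    rw [← e1] at h2
    have h3 := h2.scomp (R (σ t)) h1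
    simp only [Function.comp_apply, e1] at h3 ⊢
    rw [smul_smul, inv_mul_cancel₀ hne, one_smul] at h3
    exact h3
  · exact (hRm.comp_strictMonoOn hσ).injOn.bijOn_image
  · intro t ht
    have e1 : e.symm (R (σ t)) = σ t := e.symm_apply_apply _
    simp only [Function.comp_apply, e1, hc t ht]

/-- The chart lemma. -/
structure Chart (X : E → E) (D : Set E) (a b : E → ℝ) (P : ℝ × ℝ → E) (A G : ℝ → ℝ → ℝ)
    (c₀ C₁ M K : ℝ) : Prop where
  c_pos : 0 < c₀
  A_lo : ∀ s w, c₀ ≤ A s w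
  A_hi : ∀ s w, A s w ≤ C₁
  A_cont : Continuous (fun p : ℝ × ℝ => A p.1 p.2)
  good : GoodG G M K
  da : ∀ p ∈ D, ∃ a' : E →L[ℝ] ℝ, HasFDerivAt a a' p ∧ a' (X p) = A (a p) (b p)
  db : ∀ p ∈ D, ∃ b' : E →L[ℝ] ℝ, HasFDerivAt b b' p ∧
    b' (X p) = A (a p) (b p) * G (a p) (b p)
  P_eq : ∀ p ∈ D, P (a p, b p) = p
  dP : ∀ p ∈ D, ∃ P' : ℝ × ℝ →L[ℝ] E, HasFDerivAt P P' (a p, b p) ∧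
    A (a p) (b p) • P' (1, G (a p) (b p)) = X p

theorem Chart.iff {X : E → E} {D : Set E} {a b : E → ℝ} {P : ℝ × ℝ → E} {A G : ℝ → ℝ → ℝ}
    {c₀ C₁ M K : ℝ} (h : Chart X D a b P A G c₀ C₁ M K) {F : ℝ → ℝ → ℝ → ℝ} (hF : IsFlow G F)
    (base : ℝ) {c : ℝ → E} {I : Set ℝ} (hI : I.OrdConnected) (hc : ContinuousOn c I)
    (hD : ∀ t ∈ I, c t ∈ D) :
    OC X c I ↔ ((∀ t ∈ I, ∀ t' ∈ I, F base (a (c t)) (b (c t)) = F base (a (c t')) (b (c t'))) ∧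
      StrictMonoOn (fun t => a (c t)) I) := by
  constructor
  · rintro ⟨δ, J, τ, h1, h2, h3, h4, h5, h6⟩
    have hδD : ∀ s ∈ J, δ s ∈ D := fun s hs => by
      obtain ⟨t, ht, rfl⟩ := h3.surjOn hs
      rw [← h6 t ht]; exact hD t ht
    have hda : ∀ s ∈ J, HasDerivAt (fun s => a (δ s)) (A (a (δ s)) (b (δ s))) s := fun s hs => by
      obtain ⟨a', ha, ha'⟩ := h.da _ (hδD s hs)
      rw [← ha']
      exact ha.comp_hasDerivAt s (h2 s hs)
    have hdb : ∀ s ∈ J, HasDerivAt (fun s => b (δ s))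
        (A (a (δ s)) (b (δ s)) * G (a (δ s)) (b (δ s))) s := fun s hs => by
      obtain ⟨a', ha, ha'⟩ := h.db _ (hδD s hs)
      rw [← ha']
      exact ha.comp_hasDerivAt s (h2 s hs)
    have key : ∀ s₀ ∈ J, ∀ s ∈ J, b (δ s) = F (a (δ s)) (a (δ s₀)) (b (δ s₀)) := by
      intro s₀ hs₀ s hs
      have := zero_of_deriv_le (f := fun s => b (δ s) - F (a (δ s)) (a (δ s₀)) (b (δ s₀)))
        (f' := fun s => A (a (δ s)) (b (δ s)) * G (a (δ s)) (b (δ s)) -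
          G (a (δ s)) (F (a (δ s)) (a (δ s₀)) (b (δ s₀))) * A (a (δ s)) (b (δ s)))
        (K := C₁ * K) h1 (fun s hs => (hdb s hs).sub ((hF.deriv _ _ _).comp s (hda s hs)))
        (fun s hs => by
          have e : A (a (δ s)) (b (δ s)) * G (a (δ s)) (b (δ s)) -
            G (a (δ s)) (F (a (δ s)) (a (δ s₀)) (b (δ s₀))) * A (a (δ s)) (b (δ s)) =
            A (a (δ s)) (b (δ s)) * (G (a (δ s)) (b (δ s)) -
            G (a (δ s)) (F (a (δ s)) (a (δ s₀)) (b (δ s₀)))) := by ring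
          rw [e, norm_mul, mul_assoc, Real.norm_eq_abs, Real.norm_eq_abs, Real.norm_eq_abs,
            abs_of_pos (h.c_pos.trans_le (h.A_lo _ _))]
          have hA := h.A_hi (a (δ s)) (b (δ s))
          have hA0 := h.c_pos.trans_le (h.A_lo (a (δ s)) (b (δ s)))
          exact mul_le_mul hA (h.good.lip _ _ _) (abs_nonneg _) (hA0.le.trans hA))
        hs₀ (by simp [hF.init]) s hs
      exact sub_eq_zero.mp this
    constructor
    · intro t ht t' ht'
      rw [h6 t ht, h6 t' ht', key _ (h3.mapsTo ht') _ (h3.mapsTo ht), hF.comp h.good]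
    · have hm : StrictMonoOn (fun s => a (δ s)) J := by
        apply strictMonoOn_of_deriv_pos h1.convex
        · exact fun s hs => (hda s hs).continuousAt.continuousWithinAt
        · intro s hs
          rw [(hda s (interior_subset hs)).deriv]
          exact h.c_pos.trans_le (h.A_lo _ _)
      intro x hx y hy hxy
      simp only [h6 x hx, h6 y hy]
      exact hm (h3.mapsTo hx) (h3.mapsTo hy) (h4 hx hy hxy)
  · rintro ⟨hξ, hm⟩
    rcases I.eq_empty_or_nonempty with rfl | ⟨t₀, ht₀⟩
    · exact ⟨c, ∅, id, hI, by simp, bijOn_id _, strictMonoOn_id, continuousOn_id, by simp⟩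
    have hac : ContinuousOn (fun t => a (c t)) I := fun t ht => by
      obtain ⟨a', ha, -⟩ := h.da _ (hD t ht)
      exact ha.continuousAt.comp_continuousWithinAt (hc t ht)
    set ξ := F base (a (c t₀)) (b (c t₀)) with hξdef
    have hb : ∀ t ∈ I, F (a (c t)) base ξ = b (c t) := fun t ht => by
      rw [hξdef, hξ t₀ ht₀ t ht, hF.inv h.good]
    have hC₁ : 0 < C₁ := (h.c_pos.trans_le (h.A_lo 0 0)).trans_le (h.A_hi 0 0)
    refine OC.of_kappa (κ := fun s => P (s, F s base ξ))
      (ρ := fun s => (A s (F s base ξ))⁻¹) (c₀ := C₁⁻¹) (inv_pos.mpr hC₁) ?_ ?_ hI hm hac ?_ ?_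
    · refine Continuous.inv₀ ?_ (fun s => (h.c_pos.trans_le (h.A_lo _ _)).ne')
      exact h.A_cont.comp (continuous_id.prodMk (hF.cont_t _ _))
    · intro s
      exact inv_anti₀ (h.c_pos.trans_le (h.A_lo _ _)) (h.A_hi _ _)
    · intro t ht
      obtain ⟨P', hP, hP'⟩ := h.dP _ (hD t ht)
      have hbt := hb t ht
      have h1 := hF.deriv (a (c t)) base ξ
      have h2 := (hasDerivAt_id (a (c t))).prodMk h1
      rw [hbt] at h2
      have hP2 : HasFDerivAt P P' (id (a (c t)), F (a (c t)) base ξ) := by rw [hbt]; exact hP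
      have h3 := hP2.comp_hasDerivAt (a (c t)) h2
      have hne := (h.c_pos.trans_le (h.A_lo (a (c t)) (b (c t)))).ne'
      show HasDerivAt (fun s => P (s, F s base ξ)) _ (a (c t))
      refine h3.congr_deriv ?_
      symm
      show (A (a (c t)) (F (a (c t)) base ξ))⁻¹ • X (P (a (c t), F (a (c t)) base ξ)) = _
      rw [hbt, h.P_eq _ (hD t ht), ← hP', smul_smul, inv_mul_cancel₀ hne, one_smul]
    · intro t ht
      simp only [hb t ht, h.P_eq _ (hD t ht)]

end OC


/-! ### M4: the strip lemma -/

structure StripG (G : ℝ → ℝ → ℝ) (M K ν c : ℝ) : Prop where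
  good : GoodG G M K
  ν_pos : 0 < ν
  c_pos : 0 < c
  top : ∀ σ w, 1 ≤ w → G σ w ≤ -c
  bot : ∀ σ w, w ≤ -1 → c ≤ G σ w
  contr : ∀ σ w w', -1 ≤ w' → w' ≤ w → w ≤ 1 → G σ w - G σ w' ≤ -ν * (w - w')

theorem StripG.symm {G M K ν c} (h : StripG G M K ν c) :
    StripG (fun σ w => - G σ (-w)) M K ν c where
  good := {
    cont := (h.good.cont.comp (continuous_fst.prodMk continuous_snd.neg)).neg
    bdd := fun t x => by rw [abs_neg]; exact h.good.bdd _ _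
    lip := fun t x y => by
      have := h.good.lip t (-x) (-y)
      rw [← abs_neg] at this
      rw [← abs_neg (x - y)]
      convert this using 2
      · ring_nf
      · ring_nf }
  ν_pos := h.ν_pos
  c_pos := h.c_pos
  top := fun σ w hw => by have := h.bot σ (-w) (by linarith); linarith
  bot := fun σ w hw => by have := h.top σ (-w) (by linarith); linarith
  contr := fun σ w w' h1 h2 h3 => by
    have := h.contr σ (-w') (-w) (by linarith) (by linarith) (by linarith)
    linarith

theorem IsFlow.symm {G F} (hF : IsFlow G F) :
    IsFlow (fun σ w => - G σ (-w)) (fun t t₀ x => - F t t₀ (-x)) where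
  init := fun t x => by rw [hF.init]; ring
  deriv := fun t t₀ x => by
    have := (hF.deriv t t₀ (-x)).neg
    simp only [neg_neg]
    exact this

section strip
variable {G : ℝ → ℝ → ℝ} {F : ℝ → ℝ → ℝ → ℝ} {M K ν c : ℝ}

theorem StripG.back_top (h : StripG G M K ν c) (hF : IsFlow G F) {t₀ x t₁ t : ℝ}
    (h1 : 1 ≤ F t₁ t₀ x) (ht : t ≤ t₁) : 1 + c / 2 * (t₁ - t) ≤ F t t₀ x := by
  have hd : ∀ s, HasDerivAt (fun s => - F (t₁ - s) t₀ x) (G (t₁ - s) (F (t₁ - s) t₀ x)) s := by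
    intro s
    have := ((hF.deriv (t₁ - s) t₀ x).comp s ((hasDerivAt_id s).const_sub t₁)).neg
    refine (this.congr_deriv ?_ : HasDerivAt (fun s => - F (t₁ - s) t₀ x) _ s)
    simp
  have := image_le_of_deriv_right_lt_deriv_boundary (a := 0) (b := t₁ - t)
    (f := fun s => - F (t₁ - s) t₀ x) (f' := fun s => G (t₁ - s) (F (t₁ - s) t₀ x))
    (B := fun s => -1 - c / 2 * s) (B' := fun s => - (c / 2 * 1))
    (fun s _ => (hd s).continuousAt.continuousWithinAt) (fun s _ => (hd s).hasDerivWithinAt)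
    (by simp; linarith) (fun s => ((hasDerivAt_id s).const_mul (c/2)).const_sub (-1))
    (fun s hs he => by
      have hc := h.c_pos
      have hs0 : 0 ≤ c / 2 * s := mul_nonneg (by linarith) hs.1
      have := h.top (t₁ - s) (F (t₁ - s) t₀ x) (by linarith)
      linarith) (x := t₁ - t) ⟨by linarith, le_rfl⟩
  simp only [sub_sub_cancel] at this
  linarith

/-- the top entrance function -/
theorem StripG.top_mono (h : StripG G M K ν c) (hF : IsFlow G F) :
    StrictMono (fun ρ => F 0 ρ 1) := by
  intro ρ ρ' hρ
  have h1 : F ρ' ρ 1 < 1 := by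
    by_contra hcon
    push Not at hcon
    have := h.back_top hF hcon hρ.le
    rw [hF.init] at this
    have hc := h.c_pos
    have : 0 < c / 2 * (ρ' - ρ) := mul_pos (by linarith) (by linarith)
    linarith
  have := hF.mono h.good 0 ρ' h1
  rwa [hF.comp h.good] at this

theorem StripG.top_le (h : StripG G M K ν c) (hF : IsFlow G F) {ρ t : ℝ} (ht : ρ ≤ t) :
    F t ρ 1 ≤ 1 := by
  have := (h.top_mono hF).monotone ht
  rw [← hF.comp h.good 0 t ρ] at this
  exact (hF.mono h.good 0 t).le_iff_le.mp this

theorem StripG.top_growth (h : StripG G M K ν c) (hF : IsFlow G F) {ρ : ℝ} (hρ : 0 ≤ ρ) :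
    1 + c / 2 * ρ ≤ F 0 ρ 1 := by
  have := h.back_top hF (t₁ := ρ) (t₀ := ρ) (x := 1) (t := 0) (by rw [hF.init]) hρ
  simpa using this

theorem StripG.bot_anti (h : StripG G M K ν c) (hF : IsFlow G F) :
    StrictAnti (fun ρ => F 0 ρ (-1)) := by
  intro ρ ρ' hρ
  have := h.symm.top_mono hF.symm hρ
  simpa using this

theorem StripG.le_bot (h : StripG G M K ν c) (hF : IsFlow G F) {ρ t : ℝ} (ht : ρ ≤ t) :
    -1 ≤ F t ρ (-1) := by
  have := h.symm.top_le hF.symm ht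
  linarith

theorem StripG.bot_growth (h : StripG G M K ν c) (hF : IsFlow G F) {ρ : ℝ} (hρ : 0 ≤ ρ) :
    F 0 ρ (-1) ≤ - (1 + c / 2 * ρ) := by
  have := h.symm.top_growth hF.symm hρ
  linarith

theorem StripG.squeeze (h : StripG G M K ν c) (hF : IsFlow G F) {ρ : ℝ} (hρ : ρ ≤ 0) :
    F 0 ρ 1 - F 0 ρ (-1) ≤ 2 * Real.exp (ν * ρ) := by
  have hd : ∀ t, HasDerivAt (fun t => (F t ρ 1 - F t ρ (-1)) * Real.exp (ν * t))
      ((G t (F t ρ 1) - G t (F t ρ (-1))) * Real.exp (ν * t) +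
        (F t ρ 1 - F t ρ (-1)) * (Real.exp (ν * t) * (ν * 1))) t := fun t =>
    ((hF.deriv t ρ 1).sub (hF.deriv t ρ (-1))).mul (((hasDerivAt_id t).const_mul ν).exp)
  have : AntitoneOn (fun t => (F t ρ 1 - F t ρ (-1)) * Real.exp (ν * t)) (Icc ρ 0) := by
    apply antitoneOn_of_deriv_nonpos (convex_Icc _ _)
    · exact fun t _ => (hd t).continuousAt.continuousWithinAt
    · exact fun t _ => (hd t).differentiableAt.differentiableWithinAt
    · intro t ht
      rw [interior_Icc] at ht
      rw [(hd t).deriv]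
      have h1 := h.contr t (F t ρ 1) (F t ρ (-1)) (h.le_bot hF ht.1.le)
        ((hF.mono h.good t ρ).monotone (by norm_num)) (h.top_le hF ht.1.le)
      have h2 := Real.exp_pos (ν * t)
      nlinarith
  have := this ⟨le_rfl, hρ⟩ ⟨hρ, le_rfl⟩ hρ
  simp only [hF.init] at this
  norm_num at this ⊢
  linarith

theorem StripG.top_cont (h : StripG G M K ν c) (hF : IsFlow G F) (x : ℝ) :
    Continuous (fun ρ => F 0 ρ x) :=
  (hF.cont h.good).comp
    (continuous_const.prodMk (continuous_id.prodMk continuous_const) :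
      Continuous (fun ρ : ℝ => ((0:ℝ), ρ, x)))

theorem StripG.exists_star (h : StripG G M K ν c) (hF : IsFlow G F) :
    ∃ ξs : ℝ, (∀ ρ, ξs < F 0 ρ 1) ∧ (∀ ρ, F 0 ρ (-1) < ξs) ∧ (∀ ξ > ξs, ∃ ρ, F 0 ρ 1 = ξ) ∧
      (∀ ξ < ξs, ∃ ρ, F 0 ρ (-1) = ξ) := by
  have hlt : ∀ ρ ρ', F 0 ρ (-1) ≤ F 0 ρ' 1 := fun ρ ρ' => by
    calc F 0 ρ (-1) ≤ F 0 (min ρ ρ') (-1) := (h.bot_anti hF).antitone (min_le_left _ _)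
      _ ≤ F 0 (min ρ ρ') 1 := (hF.mono h.good _ _).monotone (by norm_num)
      _ ≤ F 0 ρ' 1 := (h.top_mono hF).monotone (min_le_right _ _)
  have hbd : BddBelow (range fun ρ => F 0 ρ 1) := ⟨F 0 0 (-1), by
    rintro _ ⟨ρ, rfl⟩; exact hlt _ _⟩
  have hc := h.c_pos
  refine ⟨⨅ ρ, F 0 ρ 1, fun ρ => ?_, fun ρ => ?_, fun ξ hξ => ?_, fun ξ hξ => ?_⟩
  · exact (ciInf_le hbd (ρ - 1)).trans_lt (h.top_mono hF (by linarith))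
  · exact (h.bot_anti hF (show ρ - 1 < ρ by linarith)).trans_le (le_ciInf fun ρ' => hlt _ _)
  · obtain ⟨ρ₁, h₁⟩ := exists_lt_of_ciInf_lt hξ
    apply mem_range_of_exists_le_of_exists_ge (h.top_cont hF 1) ⟨ρ₁, h₁.le⟩
    refine ⟨|ξ| * (2 / c), ?_⟩
    have := h.top_growth hF (ρ := |ξ| * (2 / c)) (by positivity)
    have e : c / 2 * (|ξ| * (2 / c)) = |ξ| := by field_simp
    rw [e] at this
    linarith [le_abs_self ξ]
  · apply mem_range_of_exists_le_of_exists_ge (h.top_cont hF (-1))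
    · refine ⟨|ξ| * (2 / c), ?_⟩
      have := h.bot_growth hF (ρ := |ξ| * (2 / c)) (by positivity)
      have e : c / 2 * (|ξ| * (2 / c)) = |ξ| := by field_simp
      rw [e] at this
      linarith [neg_abs_le ξ]
    · set η := (⨅ ρ, F 0 ρ 1) - ξ with hη
      have hη0 : 0 < η := by linarith
      have ht : Tendsto (fun ρ => 2 * Real.exp (ν * ρ)) atBot (nhds (2 * 0)) :=
        (Real.tendsto_exp_atBot.comp (tendsto_id.const_mul_atBot h.ν_pos)).const_mul 2
      rw [mul_zero] at ht
      obtain ⟨ρ, hρ1, hρ2⟩ := ((ht.eventually (gt_mem_nhds hη0)).and (eventually_le_atBot 0)).exists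
      refine ⟨ρ, ?_⟩
      have h1 := h.squeeze hF hρ2
      have h2 := ciInf_le hbd ρ
      linarith

end strip

/-- tent-type bump -/
theorem tent_strictMono {d C e : ℝ} (hC : 0 < C) (hd : |d| ≤ C) :
    StrictMono (fun σ => σ + d * max 0 (1 - |σ - e| / (2 * C))) := by
  intro x y hxy
  have hL : |max 0 (1 - |x - e| / (2 * C)) - max 0 (1 - |y - e| / (2 * C))| ≤
      (y - x) / (2 * C) := by
    refine (abs_max_sub_max_le_max _ _ _ _).trans ?_
    simp only [sub_self, abs_zero]
    apply max_le (div_nonneg (by linarith) (by linarith))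
    have e1 : 1 - |x - e| / (2 * C) - (1 - |y - e| / (2 * C)) =
      (|y - e| - |x - e|) / (2 * C) := by ring
    rw [e1, abs_div, abs_of_pos (show 0 < 2 * C by linarith)]
    gcongr
    refine (abs_abs_sub_abs_le_abs_sub _ _).trans ?_
    rw [show y - e - (x - e) = y - x by ring, abs_of_pos (by linarith)]
  have h2 : |d * (max 0 (1 - |x - e| / (2 * C)) - max 0 (1 - |y - e| / (2 * C)))| ≤ (y - x) / 2 := by
    rw [abs_mul]
    calc _ ≤ C * ((y - x) / (2 * C)) := mul_le_mul hd hL (abs_nonneg _) hC.le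
      _ = _ := by field_simp
  have := (abs_le.mp h2).2
  simp only
  nlinarith

theorem tent_bound {d C e σ : ℝ} (hC : 0 < C) (hd : |d| ≤ C) :
    |d * max 0 (1 - |σ - e| / (2 * C))| ≤ C := by
  rw [abs_mul]
  have h1 : |max 0 (1 - |σ - e| / (2 * C))| ≤ 1 := by
    rw [abs_of_nonneg (le_max_left _ _)]
    apply max_le (by norm_num)
    have : 0 ≤ |σ - e| / (2 * C) := by positivity
    linarith
  calc _ ≤ C * 1 := mul_le_mul hd h1 (abs_nonneg _) hC.le
    _ = C := mul_one C

theorem strip_lemma {G G' : ℝ → ℝ → ℝ} {F F' : ℝ → ℝ → ℝ → ℝ} {M K ν c M' K' ν' c' : ℝ}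
    (h : StripG G M K ν c) (hF : IsFlow G F) (h' : StripG G' M' K' ν' c') (hF' : IsFlow G' F')
    (g : ℝ ≃o ℝ) (C : ℝ) (hC : 0 < C) (hg : ∀ ρ, |g ρ - ρ| ≤ C) :
    ∃ Hs : ℝ × ℝ → ℝ × ℝ, Continuous Hs ∧ Function.Bijective Hs ∧
      (∀ σ, Hs (σ, 1) = (σ, 1)) ∧ (∀ σ, Hs (σ, -1) = (g σ, -1)) ∧
      (∀ p, |p.2| ≤ 1 ↔ |(Hs p).2| ≤ 1) ∧ (∀ p, |(Hs p).1 - p.1| ≤ C) ∧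
      (∀ p q, F 0 p.1 p.2 = F 0 q.1 q.2 ↔
        F' 0 (Hs p).1 (Hs p).2 = F' 0 (Hs q).1 (Hs q).2) ∧
      (∀ p q, F 0 p.1 p.2 = F 0 q.1 q.2 → (p.1 < q.1 ↔ (Hs p).1 < (Hs q).1)) := by
  obtain ⟨ξs, ht, hb, ht2, hb2⟩ := h.exists_star hF
  obtain ⟨ξs', ht', hb', ht2', hb2'⟩ := h'.exists_star hF'
  have mt := h.top_mono hF
  have mb := h.bot_anti hF
  have mt' := h'.top_mono hF'
  have mb' := h'.bot_anti hF'
  have hP : ∀ ξ, ∃ ρ, ξ > ξs → F 0 ρ 1 = ξ := fun ξ => by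
    by_cases hh : ξ > ξs
    · obtain ⟨ρ, hρ⟩ := ht2 ξ hh; exact ⟨ρ, fun _ => hρ⟩
    · exact ⟨0, fun h => absurd h hh⟩
  have hQ : ∀ ξ, ∃ ρ, ξ < ξs → F 0 ρ (-1) = ξ := fun ξ => by
    by_cases hh : ξ < ξs
    · obtain ⟨ρ, hρ⟩ := hb2 ξ hh; exact ⟨ρ, fun _ => hρ⟩
    · exact ⟨0, fun h => absurd h hh⟩
  choose r hr using hP
  choose e he using hQ
  have er : ∀ ρ, r (F 0 ρ 1) = ρ := fun ρ => mt.injective (hr _ (ht ρ))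
  have ee : ∀ ρ, e (F 0 ρ (-1)) = ρ := fun ρ => mb.injective (he _ (hb ρ))
  set η : ℝ → ℝ := fun ξ => if ξ < ξs then F' 0 (g (e ξ)) (-1) else
    if ξ = ξs then ξs' else F' 0 (r ξ) 1 with hη
  have η1 : ∀ ξ < ξs, η ξ = F' 0 (g (e ξ)) (-1) := fun ξ hξ => if_pos hξ
  have η2 : η ξs = ξs' := by simp [hη]
  have η3 : ∀ ξ > ξs, η ξ = F' 0 (r ξ) 1 := fun ξ hξ => by
    simp only [hη]; rw [if_neg (not_lt.mpr hξ.le), if_neg hξ.ne']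
  have ηlt : ∀ ξ < ξs, η ξ < ξs' := fun ξ hξ => by rw [η1 ξ hξ]; exact hb' _
  have ηgt : ∀ ξ > ξs, ξs' < η ξ := fun ξ hξ => by rw [η3 ξ hξ]; exact ht' _
  have ηm : StrictMono η := by
    intro x y hxy
    rcases lt_trichotomy x ξs with hx | hx | hx
    · rcases lt_trichotomy y ξs with hy | hy | hy
      · rw [η1 x hx, η1 y hy]
        apply mb'
        apply g.strictMono
        by_contra hcon
        push Not at hcon
        have := mb.antitone hcon
        simp only [he x hx, he y hy] at this
        linarith
      · rw [hy, η2]; exact ηlt x hx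
      · exact (ηlt x hx).trans (ηgt y hy)
    · rw [hx, η2]; exact ηgt y (hx ▸ hxy)
    · have hy := hx.trans hxy
      rw [η3 x hx, η3 y hy]
      apply mt'
      by_contra hcon
      push Not at hcon
      have := mt.monotone hcon
      simp only [hr x hx, hr y hy] at this
      linarith
  have ηE : ∀ ρ, η (F 0 ρ 1) = F' 0 ρ 1 := fun ρ => by rw [η3 _ (ht ρ), er]
  have ηE' : ∀ ρ, η (F 0 ρ (-1)) = F' 0 (g ρ) (-1) := fun ρ => by rw [η1 _ (hb ρ), ee]
  have ηs : Function.Surjective η := by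
    intro y
    rcases lt_trichotomy y ξs' with hy | hy | hy
    · obtain ⟨ρ, rfl⟩ := hb2' y hy
      exact ⟨F 0 (g.symm ρ) (-1), by rw [ηE', g.apply_symm_apply]⟩
    · exact ⟨ξs, by rw [η2, hy]⟩
    · obtain ⟨ρ, rfl⟩ := ht2' y hy
      exact ⟨F 0 ρ 1, ηE ρ⟩
  have ηc : Continuous η := (StrictMono.orderIsoOfSurjective η ηm ηs).continuous
  -- the displacement
  set D : ℝ → ℝ → ℝ := fun ξ σ => if ξ < ξs then
    (g (e ξ) - e ξ) * max 0 (1 - |σ - e ξ| / (2 * C)) else 0 with hD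
  have D1 : ∀ ξ < ξs, ∀ σ, D ξ σ = (g (e ξ) - e ξ) * max 0 (1 - |σ - e ξ| / (2 * C)) :=
    fun ξ hξ σ => if_pos hξ
  have D2 : ∀ ξ, ξs ≤ ξ → ∀ σ, D ξ σ = 0 := fun ξ hξ σ => if_neg (not_lt.mpr hξ)
  have Db : ∀ ξ σ, |D ξ σ| ≤ C := fun ξ σ => by
    rcases lt_or_ge ξ ξs with hξ | hξ
    · rw [D1 _ hξ]; exact tent_bound hC (hg _)
    · rw [D2 _ hξ]; simpa using hC.le
  have ec : ∀ ξ < ξs, ContinuousAt e ξ := by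
    intro ξ hξ
    have : ContinuousAt (fun ξ => - e ξ) ξ := by
      apply continuousAt_of_monotoneOn_of_image_mem_nhds (s := Iio ξs) _ (Iio_mem_nhds hξ)
      · have : (fun ξ => - e ξ) '' Iio ξs = univ := by
          apply eq_univ_of_forall
          intro y
          exact ⟨F 0 (-y) (-1), hb _, by simp [ee]⟩
        rw [this]; exact univ_mem
      · intro x hx y hy hxy
        simp only [neg_le_neg_iff]
        by_contra hcon
        push Not at hcon
        have := mb hcon
        simp only [he x hx, he y hy] at this
        linarith
    have h2 := continuous_neg.continuousAt.comp this
    have e2 : Neg.neg ∘ (fun ξ => - e ξ) = e := by funext x; simp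
    rwa [e2] at h2
  have Dc : Continuous (fun q : ℝ × ℝ => D q.2 q.1) := by
    rw [continuous_iff_continuousAt]
    rintro ⟨σ, ξ⟩
    rcases lt_trichotomy ξ ξs with hξ | hξ | hξ
    · have hev : (fun q : ℝ × ℝ => D q.2 q.1) =ᶠ[nhds (σ, ξ)] (fun q : ℝ × ℝ =>
        (g (e q.2) - e q.2) * max 0 (1 - |q.1 - e q.2| / (2 * C))) := by
        have : {q : ℝ × ℝ | q.2 < ξs} ∈ nhds (σ, ξ) :=
          (isOpen_lt continuous_snd continuous_const).mem_nhds hξ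
        filter_upwards [this] with q hq using D1 _ hq _
      apply ContinuousAt.congr _ hev.symm
      have h1 : ContinuousAt (fun q : ℝ × ℝ => e q.2) (σ, ξ) :=
        ContinuousAt.comp (f := fun q : ℝ × ℝ => q.2) (ec ξ hξ) continuousAt_snd
      have h2 : ContinuousAt (fun q : ℝ × ℝ => g (e q.2)) (σ, ξ) :=
        g.continuous.continuousAt.comp h1
      exact (h2.sub h1).mul (continuousAt_const.max (continuousAt_const.sub
        ((continuousAt_fst.sub h1).abs.div_const _)))
    · subst hξ
      have hev : (fun q : ℝ × ℝ => D q.2 q.1) =ᶠ[nhds (σ, ξ)] (fun _ => 0) := by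
        have : {q : ℝ × ℝ | F 0 (σ - 1 - 2 * C) (-1) < q.2 ∧ σ - 1 < q.1} ∈ nhds (σ, ξ) :=
          ((isOpen_lt continuous_const continuous_snd).inter
            (isOpen_lt continuous_const continuous_fst)).mem_nhds ⟨hb _, by
              show σ - 1 < σ; linarith⟩
        filter_upwards [this] with q hq
        rcases lt_or_ge q.2 ξ with hq2 | hq2
        · rw [D1 _ hq2]
          have : e q.2 < σ - 1 - 2 * C := by
            by_contra hcon
            push Not at hcon
            have := mb.antitone hcon
            simp only [he _ hq2] at this
            linarith [hq.1]
          have h3 : 2 * C < |q.1 - e q.2| := by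
            rw [abs_of_pos] <;> linarith [hq.2]
          have h4 : 1 < |q.1 - e q.2| / (2 * C) := by
            rw [lt_div_iff₀ (by linarith)]; linarith
          rw [max_eq_left (by linarith), mul_zero]
        · exact D2 _ hq2 _
      exact continuousAt_const.congr hev.symm
    · have hev : (fun q : ℝ × ℝ => D q.2 q.1) =ᶠ[nhds (σ, ξ)] (fun _ => 0) := by
        have : {q : ℝ × ℝ | ξs < q.2} ∈ nhds (σ, ξ) :=
          (isOpen_lt continuous_const continuous_snd).mem_nhds hξ
        filter_upwards [this] with q hq using D2 _ (le_of_lt hq) _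
      exact continuousAt_const.congr hev.symm
  have φm : ∀ ξ, StrictMono (fun σ => σ + D ξ σ) := fun ξ => by
    rcases lt_or_ge ξ ξs with hξ | hξ
    · simp only [D1 _ hξ]; exact tent_strictMono hC (hg _)
    · simp only [D2 _ hξ, add_zero]; exact strictMono_id
  have φs : ∀ ξ, Function.Surjective (fun σ => σ + D ξ σ) := fun ξ y => by
    have hc : Continuous (fun σ => σ + D ξ σ) :=
      continuous_id.add (Dc.comp (continuous_id.prodMk continuous_const))
    apply mem_range_of_exists_le_of_exists_ge hc
    · exact ⟨y - C, by have := (abs_le.mp (Db ξ (y - C))).2; linarith⟩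
    · exact ⟨y + C, by have := (abs_le.mp (Db ξ (y + C))).1; linarith⟩
  set Hs : ℝ × ℝ → ℝ × ℝ := fun p =>
    (p.1 + D (F 0 p.1 p.2) p.1, F' (p.1 + D (F 0 p.1 p.2) p.1) 0 (η (F 0 p.1 p.2))) with hHs
  have hξ' : ∀ p, F' 0 (Hs p).1 (Hs p).2 = η (F 0 p.1 p.2) := fun p => hF'.inv h'.good _ _ _
  have Fc : Continuous (fun p : ℝ × ℝ => F 0 p.1 p.2) :=
    (hF.cont h.good).comp (continuous_const.prodMk (continuous_fst.prodMk continuous_snd) :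
      Continuous (fun p : ℝ × ℝ => ((0:ℝ), p.1, p.2)))
  have H1c : Continuous (fun p : ℝ × ℝ => p.1 + D (F 0 p.1 p.2) p.1) :=
    continuous_fst.add (Dc.comp (continuous_fst.prodMk Fc))
  refine ⟨Hs, ?_, ⟨?_, ?_⟩, ?_, ?_, ?_, ?_, ?_, ?_⟩
  · exact H1c.prodMk ((hF'.cont h'.good).comp (H1c.prodMk (continuous_const.prodMk (ηc.comp Fc))))
  · intro p q hpq
    have h1 : F 0 p.1 p.2 = F 0 q.1 q.2 := by
      apply ηm.injective; rw [← hξ', ← hξ', hpq]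
    have h2 : (Hs p).1 = (Hs q).1 := by rw [hpq]
    simp only [hHs, h1] at h2
    have h3 : p.1 = q.1 := (φm _).injective h2
    rw [h3] at h1
    exact Prod.ext h3 (hF.inj h.good _ _ h1)
  · rintro ⟨σ', w'⟩
    obtain ⟨ξ, hξ⟩ := ηs (F' 0 σ' w')
    obtain ⟨σ, hσ⟩ := φs ξ σ'
    refine ⟨(σ, F σ 0 ξ), ?_⟩
    simp only at hσ
    simp only [hHs, hF.inv h.good, hσ, hξ, hF'.inv h'.good]
  · intro σ
    simp only [hHs, D2 _ (ht σ).le, add_zero, ηE, hF'.inv h'.good]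
  · intro σ
    have : D (F 0 σ (-1)) σ = g σ - σ := by
      rw [D1 _ (hb σ), ee]; simp
    simp only [hHs, this, add_sub_cancel, ηE', hF'.inv h'.good]
  · intro p
    have a1 : p.2 ≤ 1 ↔ F 0 p.1 p.2 ≤ F 0 p.1 1 := (hF.mono h.good _ _).le_iff_le.symm
    have a2 : -1 ≤ p.2 ↔ F 0 p.1 (-1) ≤ F 0 p.1 p.2 := (hF.mono h.good _ _).le_iff_le.symm
    have b1 : (Hs p).2 ≤ 1 ↔ F' 0 (Hs p).1 (Hs p).2 ≤ F' 0 (Hs p).1 1 :=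
      (hF'.mono h'.good _ _).le_iff_le.symm
    have b2 : -1 ≤ (Hs p).2 ↔ F' 0 (Hs p).1 (-1) ≤ F' 0 (Hs p).1 (Hs p).2 :=
      (hF'.mono h'.good _ _).le_iff_le.symm
    rw [hξ'] at b1 b2
    rw [abs_le, abs_le, a1, a2, b1, b2]
    rcases lt_or_ge (F 0 p.1 p.2) ξs with hlt | hge
    · refine and_congr ?_ (iff_of_true (hlt.trans (ht _)).le ((ηlt _ hlt).trans (ht' _)).le)
      have h1 := he _ hlt
      rw [η1 _ hlt, mb'.le_iff_ge]
      conv_lhs => rw [← h1]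
      rw [mb.le_iff_ge]
      have h2 : (fun σ => σ + D (F 0 p.1 p.2) σ) (e (F 0 p.1 p.2)) = g (e (F 0 p.1 p.2)) := by
        simp only [D1 _ hlt]; simp
      rw [← h2]
      exact (φm (F 0 p.1 p.2)).le_iff_le.symm
    · have h1 : (Hs p).1 = p.1 := by simp only [hHs, D2 _ hge, add_zero]
      have h2 : ξs' ≤ η (F 0 p.1 p.2) := η2 ▸ ηm.monotone hge
      refine and_congr (iff_of_true ((hb _).le.trans hge) ((hb' _).le.trans h2)) ?_
      rw [h1, ← ηE, ηm.le_iff_le]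
  · intro p
    simp only [hHs, add_sub_cancel_left]
    exact Db _ _
  · intro p q
    rw [hξ', hξ', ηm.injective.eq_iff]
  · intro p q hpq
    simp only [hHs, hpq]
    exact (φm (F 0 q.1 q.2)).lt_iff_lt.symm


/-! ### M5: cones -/

def clp (w : ℝ) : ℝ := max (-1) (min w 1)

theorem clp_cont : Continuous clp := by unfold clp; fun_prop
theorem clp_lip (w w' : ℝ) : |clp w - clp w'| ≤ |w - w'| := by
  unfold clp
  refine (abs_max_sub_max_le_max _ _ _ _).trans ?_
  simp only [sub_self, abs_zero]
  refine max_le (abs_nonneg _) ((abs_min_sub_min_le_max _ _ _ _).trans ?_)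
  simp
theorem clp_abs (w : ℝ) : |clp w| ≤ 1 := by
  unfold clp
  rw [abs_le]; exact ⟨le_max_left _ _, max_le (by norm_num) (min_le_right _ _)⟩
theorem clp_of (w : ℝ) (h : |w| ≤ 1) : clp w = w := by
  rw [abs_le] at h
  unfold clp
  rw [min_eq_left h.2, max_eq_right h.1]
theorem clp_top (w : ℝ) (h : 1 ≤ w) : clp w = 1 := by
  unfold clp
  rw [min_eq_right h]; norm_num
theorem clp_bot (w : ℝ) (h : w ≤ -1) : clp w = -1 := by
  unfold clp
  rw [min_eq_left (by linarith), max_eq_left h]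

/-- a quantitative remainder -/
theorem remainder_exists {E : Type*} [NormedAddCommGroup E] [NormedSpace ℝ E]
    {X : E → E} {L : E →L[ℝ] E} (hX : HasStrictFDerivAt X L 0)
    (h0 : X 0 = 0) {η : ℝ} (hη : 0 < η) : ∃ r > 0,
      (∀ p q, ‖p‖ ≤ r → ‖q‖ ≤ r → ‖(X p - L p) - (X q - L q)‖ ≤ η * ‖p - q‖) ∧
      (∀ p, ‖p‖ ≤ r → ‖X p - L p‖ ≤ η * ‖p‖) := by
  obtain ⟨s, hs, hs2⟩ := hX.approximates_deriv_on_nhds (c := ⟨η, hη.le⟩) (Or.inr hη)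
  obtain ⟨r, hr, hrs⟩ := Metric.nhds_basis_closedBall.mem_iff.mp hs
  have h1 : ∀ p q, ‖p‖ ≤ r → ‖q‖ ≤ r → ‖(X p - L p) - (X q - L q)‖ ≤ η * ‖p - q‖ := by
    intro p q hp hq
    have := hs2 p (hrs (by simpa using hp)) q (hrs (by simpa using hq))
    rw [map_sub] at this
    have e : (X p - L p) - (X q - L q) = X p - X q - (L p - L q) := by abel
    rw [e]; exact this
  refine ⟨r, hr, h1, fun p hp => ?_⟩
  have := h1 p 0 hp (by simpa using hr.le)
  simpa [h0] using this

def dg (l m : ℝ) : ℝ × ℝ →L[ℝ] ℝ × ℝ :=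
  (l • ContinuousLinearMap.fst ℝ ℝ ℝ).prod (m • ContinuousLinearMap.snd ℝ ℝ ℝ)

theorem dg_apply (l m : ℝ) (p : ℝ × ℝ) : dg l m p = (l * p.1, m * p.2) := rfl

/-- parametrisation of the cone -/
def cP (ε : ℝ) (q : ℝ × ℝ) : ℝ × ℝ := (Real.exp (ε * q.1), q.2 * Real.exp (ε * q.1))
def ca (ε : ℝ) (p : ℝ × ℝ) : ℝ := ε * Real.log p.1
def cb (p : ℝ × ℝ) : ℝ := p.2 / p.1

theorem div_est {A A' B B' κ Λ η Δ : ℝ} (hκ : 0 < κ) (hΛ : 0 < Λ) (hη0 : 0 < η)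
    (h1 : η ≤ κ / 12) (h2 : η ≤ Λ / 16) (hA : |A - Λ| ≤ η) (hA' : |A' - Λ| ≤ η)
    (hAA : |A - A'| ≤ η * |Δ|) (hB' : |B'| ≤ κ + 2 * η) (hBB : |B - B' + κ * Δ| ≤ 3 * η * |Δ|) :
    |A * (B / A - B' / A') + κ * Δ| ≤ κ / 2 * |Δ| := by
  have a1 := abs_le.mp hA
  have a2 := abs_le.mp hA'
  have hA0 : Λ / 2 ≤ A := by linarith
  have hA0' : Λ / 2 ≤ A' := by linarith
  have hp : 0 < A := by linarith
  have hp' : 0 < A' := by linarith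
  have e : A * (B / A - B' / A') + κ * Δ = (B - B' + κ * Δ) + B' / A' * (A' - A) := by
    field_simp; ring
  rw [e]
  have h3 : |B' / A'| ≤ 2 * κ / (Λ / 2) := by
    rw [abs_div, abs_of_pos hp']
    gcongr
    linarith
  have h4 : |B' / A' * (A' - A)| ≤ 2 * κ / (Λ / 2) * (η * |Δ|) := by
    rw [abs_mul, abs_sub_comm A' A]
    exact mul_le_mul h3 hAA (abs_nonneg _) (by positivity)
  have h5 : 2 * κ / (Λ / 2) * (η * |Δ|) ≤ κ / 4 * |Δ| := by
    rw [← mul_assoc]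
    gcongr
    have : 2 * κ / (Λ / 2) * η = 4 * κ * η / Λ := by field_simp; ring
    rw [this, div_le_iff₀ hΛ]
    nlinarith
  calc _ ≤ |B - B' + κ * Δ| + |B' / A' * (A' - A)| := abs_add_le _ _
    _ ≤ 3 * η * |Δ| + κ / 4 * |Δ| := by linarith
    _ ≤ _ := by nlinarith [abs_nonneg Δ]

theorem cone_chart {X : ℝ × ℝ → ℝ × ℝ} {l m ε : ℝ} (hX : HasStrictFDerivAt X (dg l m) 0)
    (h0 : X 0 = 0) (hlm : m < l) (hε : ε = 1 ∨ ε = -1) (hεl : 0 < ε * l) :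
    ∃ r > 0, ∃ (A G : ℝ → ℝ → ℝ) (c₀ C₁ M K ν c : ℝ), StripG G M K ν c ∧
      ∀ r' ≤ r, Chart X {p | 0 < p.1 ∧ |p.2| ≤ p.1 ∧ p.1 ≤ r'} (ca ε) cb (cP ε) A G c₀ C₁ M K := by
  set κ := l - m with hκd
  set Λ := ε * l with hΛd
  have hεε : ε * ε = 1 := by rcases hε with rfl | rfl <;> norm_num
  have hεa : |ε| = 1 := by rcases hε with rfl | rfl <;> norm_num
  have hκ : 0 < κ := by linarith
  set η := min (κ / 12) (Λ / 16) with hηd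
  have hη : 0 < η := lt_min (by linarith) (by linarith)
  have hη1 : η ≤ κ / 12 := min_le_left _ _
  have hη2 : η ≤ Λ / 16 := min_le_right _ _
  obtain ⟨r, hr, hlip, hbd⟩ := remainder_exists hX h0 hη
  set Rm : ℝ × ℝ → ℝ × ℝ := fun p => X p - dg l m p with hRm
  set S : ℝ → ℝ := fun σ => Real.exp (min (ε * σ) (Real.log r)) with hS
  have hSpos : ∀ σ, 0 < S σ := fun σ => Real.exp_pos _
  have hSr : ∀ σ, S σ ≤ r := fun σ => by
    calc S σ ≤ Real.exp (Real.log r) := Real.exp_le_exp.mpr (min_le_right _ _)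
      _ = r := Real.exp_log hr
  set pt : ℝ → ℝ → ℝ × ℝ := fun σ w => (S σ, clp w * S σ) with hpt
  have hSc : Continuous S := by simp only [hS]; fun_prop
  have hptc : Continuous (fun q : ℝ × ℝ => pt q.1 q.2) := by
    simp only [hpt]
    exact (hSc.comp continuous_fst).prodMk
      ((clp_cont.comp continuous_snd).mul (hSc.comp continuous_fst))
  have hptn : ∀ σ w, ‖pt σ w‖ ≤ S σ := fun σ w => by
    simp only [hpt, Prod.norm_def]
    apply max_le
    · rw [Real.norm_eq_abs, abs_of_pos (hSpos σ)]
    · rw [norm_mul, Real.norm_eq_abs, Real.norm_eq_abs, abs_of_pos (hSpos σ)]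
      exact mul_le_of_le_one_left (hSpos σ).le (clp_abs w)
  have hptr : ∀ σ w, ‖pt σ w‖ ≤ r := fun σ w => (hptn σ w).trans (hSr σ)
  have hptd : ∀ σ w w', ‖pt σ w - pt σ w'‖ ≤ |clp w - clp w'| * S σ := fun σ w w' => by
    simp only [hpt, Prod.norm_def, Prod.fst_sub, Prod.snd_sub, sub_self, norm_zero]
    apply max_le (mul_nonneg (abs_nonneg _) (hSpos σ).le)
    rw [← sub_mul, norm_mul, Real.norm_eq_abs, Real.norm_eq_abs, abs_of_pos (hSpos σ)]
  have hRmc : Continuous (fun q : ℝ × ℝ => Rm (pt q.1 q.2)) := by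
    have : LipschitzOnWith ⟨η, hη.le⟩ Rm (Metric.closedBall 0 r) := by
      apply LipschitzOnWith.of_dist_le_mul
      intro p hp q hq
      rw [dist_eq_norm, dist_eq_norm]
      exact hlip p q (by simpa using hp) (by simpa using hq)
    exact this.continuousOn.comp_continuous hptc (fun q => by simpa using hptr _ _)
  set q1 : ℝ → ℝ → ℝ := fun σ w => (S σ)⁻¹ * (Rm (pt σ w)).1 with hq1
  set q2 : ℝ → ℝ → ℝ := fun σ w => (S σ)⁻¹ * (Rm (pt σ w)).2 with hq2
  have hq1c : Continuous (fun q : ℝ × ℝ => q1 q.1 q.2) :=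
    ((hSc.comp continuous_fst).inv₀ (fun q => (hSpos _).ne')).mul hRmc.fst
  have hq2c : Continuous (fun q : ℝ × ℝ => q2 q.1 q.2) :=
    ((hSc.comp continuous_fst).inv₀ (fun q => (hSpos _).ne')).mul hRmc.snd
  have hRb : ∀ σ w, ‖Rm (pt σ w)‖ ≤ η * S σ := fun σ w =>
    (hbd _ (hptr σ w)).trans (mul_le_mul_of_nonneg_left (hptn σ w) hη.le)
  have hRl : ∀ σ w w', ‖Rm (pt σ w) - Rm (pt σ w')‖ ≤ η * (|clp w - clp w'| * S σ) :=
    fun σ w w' => (hlip _ _ (hptr σ w) (hptr σ w')).trans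
      (mul_le_mul_of_nonneg_left (hptd σ w w') hη.le)
  have hq1b : ∀ σ w, |q1 σ w| ≤ η := fun σ w => by
    simp only [hq1]
    rw [abs_mul, abs_inv, abs_of_pos (hSpos σ), inv_mul_le_iff₀ (hSpos σ), mul_comm]
    exact (norm_fst_le _).trans (hRb σ w)
  have hq2b : ∀ σ w, |q2 σ w| ≤ η := fun σ w => by
    simp only [hq2]
    rw [abs_mul, abs_inv, abs_of_pos (hSpos σ), inv_mul_le_iff₀ (hSpos σ), mul_comm]
    exact (norm_snd_le _).trans (hRb σ w)
  have hq1l : ∀ σ w w', |q1 σ w - q1 σ w'| ≤ η * |clp w - clp w'| := fun σ w w' => by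
    simp only [hq1]
    rw [← mul_sub, abs_mul, abs_inv, abs_of_pos (hSpos σ), inv_mul_le_iff₀ (hSpos σ)]
    have := (norm_fst_le _).trans (hRl σ w w')
    rw [Prod.fst_sub, Real.norm_eq_abs] at this
    linarith
  have hq2l : ∀ σ w w', |q2 σ w - q2 σ w'| ≤ η * |clp w - clp w'| := fun σ w w' => by
    simp only [hq2]
    rw [← mul_sub, abs_mul, abs_inv, abs_of_pos (hSpos σ), inv_mul_le_iff₀ (hSpos σ)]
    have := (norm_snd_le _).trans (hRl σ w w')
    rw [Prod.snd_sub, Real.norm_eq_abs] at this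
    linarith
  set A : ℝ → ℝ → ℝ := fun σ w => ε * (l + q1 σ w) with hA
  set B : ℝ → ℝ → ℝ := fun σ w => -κ * clp w + q2 σ w - clp w * q1 σ w with hB
  have hAΛ : ∀ σ w, |A σ w - Λ| ≤ η := fun σ w => by
    have : A σ w - Λ = ε * q1 σ w := by simp only [hA, hΛd]; ring
    rw [this, abs_mul, hεa, one_mul]; exact hq1b σ w
  have hAlo : ∀ σ w, Λ / 2 ≤ A σ w := fun σ w => by
    have := (abs_le.mp (hAΛ σ w)).1; linarith
  have hAhi : ∀ σ w, A σ w ≤ 2 * Λ := fun σ w => by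
    have := (abs_le.mp (hAΛ σ w)).2; linarith
  have hApos : ∀ σ w, 0 < A σ w := fun σ w => by have := hAlo σ w; linarith
  have hcq : ∀ σ w, |clp w * q1 σ w| ≤ η := fun σ w => by
    rw [abs_mul]
    calc _ ≤ 1 * η := mul_le_mul (clp_abs w) (hq1b σ w) (abs_nonneg _) (by norm_num)
      _ = η := one_mul η
  have hBb : ∀ σ w, |B σ w| ≤ κ + 2 * η := fun σ w => by
    have h1 := clp_abs w
    have h2 : |κ * clp w| ≤ κ := by
      rw [abs_mul, abs_of_pos hκ]; exact mul_le_of_le_one_right hκ.le h1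
    have h3 := abs_le.mp h2
    have h4 := abs_le.mp (hq2b σ w)
    have h5 := abs_le.mp (hcq σ w)
    simp only [hB]
    rw [abs_le]; constructor <;> linarith
  have hest : ∀ σ w w', |A σ w * (B σ w / A σ w - B σ w' / A σ w') + κ * (clp w - clp w')| ≤
      κ / 2 * |clp w - clp w'| := fun σ w w' => by
    apply div_est hκ hεl hη hη1 hη2 (hAΛ σ w) (hAΛ σ w') _ (hBb σ w')
    · have e : B σ w - B σ w' + κ * (clp w - clp w') = (q2 σ w - q2 σ w') -
        (clp w - clp w') * q1 σ w - clp w' * (q1 σ w - q1 σ w') := by simp only [hB]; ring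
      rw [e]
      have h1 := abs_le.mp (hq2l σ w w')
      have h2 : |(clp w - clp w') * q1 σ w| ≤ η * |clp w - clp w'| := by
        rw [abs_mul, mul_comm]
        exact mul_le_mul_of_nonneg_right (hq1b σ w) (abs_nonneg _)
      have h3 : |clp w' * (q1 σ w - q1 σ w')| ≤ 1 * (η * |clp w - clp w'|) := by
        rw [abs_mul]
        exact mul_le_mul (clp_abs w') (hq1l σ w w') (abs_nonneg _) (by norm_num)
      have h2' := abs_le.mp h2
      have h3' := abs_le.mp h3
      rw [abs_le]; constructor <;> linarith
    · have e : A σ w - A σ w' = ε * (q1 σ w - q1 σ w') := by simp only [hA]; ring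
      rw [e, abs_mul, hεa, one_mul]; exact hq1l σ w w'
  have hAc : Continuous (fun q : ℝ × ℝ => A q.1 q.2) :=
    continuous_const.mul (continuous_const.add hq1c)
  have hBc : Continuous (fun q : ℝ × ℝ => B q.1 q.2) :=
    (((clp_cont.comp continuous_snd).const_mul (-κ)).add hq2c).sub
      ((clp_cont.comp continuous_snd).mul hq1c)
  set G : ℝ → ℝ → ℝ := fun σ w => B σ w / A σ w with hG
  have hgood : GoodG G (4 * κ / Λ) (4 * κ / Λ) := by
    refine ⟨hBc.div hAc (fun q => (hApos _ _).ne'), fun σ w => ?_, fun σ w w' => ?_⟩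
    · simp only [hG]
      rw [abs_div, abs_of_pos (hApos σ w)]
      have h1 := hBb σ w
      have h2 := hAlo σ w
      calc |B σ w| / A σ w ≤ (2 * κ) / (Λ / 2) := by gcongr; linarith
        _ = 4 * κ / Λ := by field_simp; ring
    · have h1 := hest σ w w'
      have h2 : |A σ w * (G σ w - G σ w')| ≤ 2 * κ * |clp w - clp w'| := by
        have h3 : |κ * (clp w - clp w')| = κ * |clp w - clp w'| := by rw [abs_mul, abs_of_pos hκ]
        have h4 := abs_sub (A σ w * (B σ w / A σ w - B σ w' / A σ w') + κ * (clp w - clp w'))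
          (κ * (clp w - clp w'))
        rw [add_sub_cancel_right] at h4
        simp only [hG]
        nlinarith [abs_nonneg (clp w - clp w')]
      rw [abs_mul, abs_of_pos (hApos σ w)] at h2
      have h3 := hAlo σ w
      have h4 := clp_lip w w'
      have h5 : Λ / 2 * |G σ w - G σ w'| ≤ 2 * κ * |w - w'| := by
        calc _ ≤ A σ w * |G σ w - G σ w'| := by gcongr
          _ ≤ _ := h2
          _ ≤ _ := by gcongr
      rw [div_mul_eq_mul_div, le_div_iff₀ hεl]
      linarith
  refine ⟨r, hr, A, G, Λ / 2, 2 * Λ, 4 * κ / Λ, 4 * κ / Λ, κ / (4 * Λ), κ / (4 * Λ), ?_, ?_⟩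
  · have hpos : 0 < κ / (4 * Λ) := by positivity
    refine ⟨hgood, hpos, hpos, fun σ w hw => ?_, fun σ w hw => ?_, fun σ w w' h1 h2 h3 => ?_⟩
    · simp only [hG]
      have hb : B σ w ≤ -(κ / 2) := by
        have h4 := abs_le.mp (hq2b σ w)
        have h5 := abs_le.mp (hcq σ w)
        simp only [hB]
        rw [clp_top w hw] at h5 ⊢
        linarith
      rw [div_le_iff₀ (hApos σ w)]
      have : κ / (4 * Λ) * A σ w ≤ κ / (4 * Λ) * (2 * Λ) :=
        mul_le_mul_of_nonneg_left (hAhi σ w) hpos.le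
      have e : κ / (4 * Λ) * (2 * Λ) = κ / 2 := by field_simp; ring
      linarith
    · simp only [hG]
      have hb : κ / 2 ≤ B σ w := by
        have h4 := abs_le.mp (hq2b σ w)
        have h5 := abs_le.mp (hcq σ w)
        simp only [hB]
        rw [clp_bot w hw] at h5 ⊢
        linarith
      rw [le_div_iff₀ (hApos σ w)]
      have : κ / (4 * Λ) * A σ w ≤ κ / (4 * Λ) * (2 * Λ) :=
        mul_le_mul_of_nonneg_left (hAhi σ w) hpos.le
      have e : κ / (4 * Λ) * (2 * Λ) = κ / 2 := by field_simp; ring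
      linarith
    · have h4 := hest σ w w'
      rw [clp_of w (abs_le.mpr ⟨by linarith, h3⟩), clp_of w' (abs_le.mpr ⟨h1, by linarith⟩),
        abs_of_nonneg (sub_nonneg.mpr h2)] at h4
      have h5 := (abs_le.mp h4).2
      have h6 : A σ w * (G σ w - G σ w') ≤ - (κ / 2 * (w - w')) := by
        simp only [hG]; linarith
      have h7 : 0 ≤ w - w' := by linarith
      by_contra hcon
      push Not at hcon
      have h8 : A σ w * (-(κ / (4 * Λ)) * (w - w')) < A σ w * (G σ w - G σ w') :=
        mul_lt_mul_of_pos_left hcon (hApos σ w)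
      have h9 : A σ w * (κ / (4 * Λ) * (w - w')) ≤ 2 * Λ * (κ / (4 * Λ) * (w - w')) :=
        mul_le_mul_of_nonneg_right (hAhi σ w) (by positivity)
      have e : 2 * Λ * (κ / (4 * Λ) * (w - w')) = κ / 2 * (w - w') := by field_simp; ring
      linarith
  · intro r' hr'
    have hfact : ∀ p ∈ {p : ℝ × ℝ | 0 < p.1 ∧ |p.2| ≤ p.1 ∧ p.1 ≤ r'},
        ε * (ca ε p) = Real.log p.1 ∧ |cb p| ≤ 1 ∧ p.2 = cb p * p.1 ∧
        (X p).1 = p.1 * (l + q1 (ca ε p) (cb p)) ∧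
        (X p).2 = p.1 * (m * cb p + q2 (ca ε p) (cb p)) := by
      rintro p ⟨hp1, hp2, hp3⟩
      have e1 : ε * (ca ε p) = Real.log p.1 := by simp only [ca]; rw [← mul_assoc, hεε, one_mul]
      have e2 : |cb p| ≤ 1 := by
        simp only [cb]; rw [abs_div, abs_of_pos hp1, div_le_one hp1]; exact hp2
      have e3 : p.2 = cb p * p.1 := by simp only [cb]; field_simp
      have e4 : S (ca ε p) = p.1 := by
        simp only [hS]
        rw [e1, min_eq_left (Real.log_le_log hp1 (hp3.trans hr')), Real.exp_log hp1]
      have e5 : pt (ca ε p) (cb p) = p := by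
        simp only [hpt]; rw [e4, clp_of _ e2, ← e3]
      refine ⟨e1, e2, e3, ?_, ?_⟩
      · simp only [hq1, e4, e5, hRm, dg_apply, Prod.fst_sub]
        field_simp; ring
      · simp only [hq2, e4, e5, hRm, dg_apply, Prod.snd_sub]
        field_simp; linear_combination m * e3
    have hAG : ∀ p ∈ {p : ℝ × ℝ | 0 < p.1 ∧ |p.2| ≤ p.1 ∧ p.1 ≤ r'},
        A (ca ε p) (cb p) * G (ca ε p) (cb p) = m * cb p + q2 (ca ε p) (cb p)
          - cb p * (l + q1 (ca ε p) (cb p)) := by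
      intro p hp
      obtain ⟨-, e2, -⟩ := hfact p hp
      simp only [hG]
      rw [mul_div_cancel₀ _ (hApos _ _).ne']
      simp only [hB, clp_of _ e2]; ring
    refine ⟨by linarith, hAlo, hAhi, hAc, hgood, ?_, ?_, ?_, ?_⟩
    · intro p hp
      obtain ⟨e1, e2, e3, e4, e5⟩ := hfact p hp
      have hp1 : 0 < p.1 := hp.1
      refine ⟨ε • (p.1)⁻¹ • ContinuousLinearMap.fst ℝ ℝ ℝ,
        ((hasFDerivAt_fst (𝕜 := ℝ) (p := p)).log hp1.ne').const_mul ε, ?_⟩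
      simp only [smul_apply, ContinuousLinearMap.coe_fst', smul_eq_mul, e4, hA]
      field_simp
    · intro p hp
      obtain ⟨e1, e2, e3, e4, e5⟩ := hfact p hp
      have hp1 : 0 < p.1 := hp.1
      have hd := (hasFDerivAt_snd (𝕜 := ℝ) (p := p)).mul
        ((hasDerivAt_inv hp1.ne').comp_hasFDerivAt p (hasFDerivAt_fst (𝕜 := ℝ) (p := p)))
      refine ⟨_, hd, ?_⟩
      rw [hAG p hp]
      simp only [add_apply, smul_apply,
        ContinuousLinearMap.coe_fst', ContinuousLinearMap.coe_snd', smul_eq_mul, e4, e5,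
        Function.comp_apply]
      have : p.2 * (-(p.1 ^ 2)⁻¹ * (p.1 * (l + q1 (ca ε p) (cb p)))) =
        - cb p * (l + q1 (ca ε p) (cb p)) := by
        conv_lhs => rw [e3]
        field_simp
      rw [this]; field_simp; ring
    · intro p hp
      obtain ⟨e1, e2, e3, e4, e5⟩ := hfact p hp
      have hp1 : 0 < p.1 := hp.1
      simp only [cP]
      rw [e1, Real.exp_log hp1, ← e3]
    · intro p hp
      obtain ⟨e1, e2, e3, e4, e5⟩ := hfact p hp
      have hp1 : 0 < p.1 := hp.1
      have hd1 : HasFDerivAt (fun q : ℝ × ℝ => Real.exp (ε * q.1))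
        (Real.exp (ε * ca ε p) • (ε • ContinuousLinearMap.fst ℝ ℝ ℝ)) (ca ε p, cb p) :=
        ((hasFDerivAt_fst (𝕜 := ℝ) (p := (ca ε p, cb p))).const_mul ε).exp
      have hd2 := (hasFDerivAt_snd (𝕜 := ℝ) (p := (ca ε p, cb p))).mul hd1
      refine ⟨_, hd1.prodMk hd2, ?_⟩
      have h1 := hAG p hp
      have h2 : ε * A (ca ε p) (cb p) = l + q1 (ca ε p) (cb p) := by
        simp only [hA]; rw [← mul_assoc, hεε, one_mul]
      apply Prod.ext
      · simp only [ContinuousLinearMap.prod_apply, smul_apply,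
          ContinuousLinearMap.coe_fst', smul_eq_mul, e4, Prod.smul_fst]
        rw [e1, Real.exp_log hp1, ← h2]; ring
      · simp only [ContinuousLinearMap.prod_apply, smul_apply,
          ContinuousLinearMap.coe_fst', ContinuousLinearMap.coe_snd', smul_eq_mul, e5,
          Prod.smul_snd, add_apply]
        rw [e1, Real.exp_log hp1]
        calc _ = p.1 * (cb p * (ε * A (ca ε p) (cb p)) +
              A (ca ε p) (cb p) * G (ca ε p) (cb p)) := by ring
          _ = _ := by rw [h1, h2]; ring


/-! ### M6: the cone lemma -/

def cone : Set (ℝ × ℝ) := {p | |p.2| ≤ p.1}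

theorem cone_norm {p : ℝ × ℝ} (hp : p ∈ cone) : ‖p‖ = p.1 := by
  have h : |p.2| ≤ p.1 := hp
  have h0 : 0 ≤ p.1 := (abs_nonneg _).trans h
  rw [Prod.norm_def, Real.norm_eq_abs, Real.norm_eq_abs, abs_of_nonneg h0, max_eq_left h]

theorem cone_pos {p : ℝ × ℝ} (hp : p ∈ cone) (h0 : p ≠ 0) : 0 < p.1 := by
  rw [← cone_norm hp]; exact norm_pos_iff.mpr h0

theorem exists_conj_sign (g : ℝ ≃o ℝ) {ε : ℝ} (hε : ε = 1 ∨ ε = -1) :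
    ∃ g' : ℝ ≃o ℝ, ∀ ρ, g' ρ = ε * g (ε * ρ) := by
  have hm : StrictMono (fun ρ => ε * g (ε * ρ)) := by
    intro x y hxy
    rcases hε with rfl | rfl
    · simpa using hxy
    · simpa using hxy
  have hs : Function.Surjective (fun ρ => ε * g (ε * ρ)) := by
    intro y
    refine ⟨ε * g.symm (ε * y), ?_⟩
    rcases hε with rfl | rfl <;> simp
  exact ⟨StrictMono.orderIsoOfSurjective _ hm hs, fun ρ => rfl⟩

theorem ca_cP {ε : ℝ} (hε : ε = 1 ∨ ε = -1) (q : ℝ × ℝ) : (ca ε (cP ε q), cb (cP ε q)) = q := by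
  have : Real.exp (ε * q.1) ≠ 0 := (Real.exp_pos _).ne'
  apply Prod.ext
  · simp only [ca, cP, Real.log_exp]
    rcases hε with rfl | rfl <;> ring
  · simp only [cb, cP]; field_simp

theorem cP_ca {ε : ℝ} (hε : ε = 1 ∨ ε = -1) {p : ℝ × ℝ} (hp : 0 < p.1) :
    cP ε (ca ε p, cb p) = p := by
  have hεε : ε * ε = 1 := by rcases hε with rfl | rfl <;> norm_num
  have : ε * (ε * Real.log p.1) = Real.log p.1 := by rw [← mul_assoc, hεε, one_mul]
  simp only [cP, ca, cb, this, Real.exp_log hp]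
  apply Prod.ext
  · rfl
  · simp only; field_simp

theorem cone_lemma {X X' : ℝ × ℝ → ℝ × ℝ} {l m l' m' : ℝ} (hX : HasStrictFDerivAt X (dg l m) 0)
    (h0 : X 0 = 0) (hX' : HasStrictFDerivAt X' (dg l' m') 0) (h0' : X' 0 = 0) (hlm : m < l)
    (hlm' : m' < l') (hll : 0 < l * l') (g : ℝ ≃o ℝ) {C : ℝ} (hC : 0 < C)
    (hg : ∀ ρ, |g ρ - ρ| ≤ C) :
    ∃ r > 0, ∃ H : ℝ × ℝ → ℝ × ℝ, ContinuousOn H cone ∧ BijOn H cone cone ∧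
      (∀ u, 0 ≤ u → H (u, u) = (u, u)) ∧
      (∀ u, 0 < u → H (u, -u) = (Real.exp (g (Real.log u)), -Real.exp (g (Real.log u)))) ∧
      (∀ p ∈ cone, Real.exp (-C) * ‖p‖ ≤ ‖H p‖ ∧ ‖H p‖ ≤ Real.exp C * ‖p‖) ∧
      ∀ (γ : ℝ → ℝ × ℝ) (I : Set ℝ), I.OrdConnected → ContinuousOn γ I →
        (∀ t ∈ I, γ t ∈ cone ∧ γ t ≠ 0 ∧ ‖γ t‖ ≤ r ∧ ‖H (γ t)‖ ≤ r) →
        (OC X γ I ↔ OC X' (fun t => H (γ t)) I) := by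
  obtain ⟨ε, hε, hεl, hεl'⟩ : ∃ ε : ℝ, (ε = 1 ∨ ε = -1) ∧ 0 < ε * l ∧ 0 < ε * l' := by
    rcases lt_or_ge 0 l with h | h
    · exact ⟨1, Or.inl rfl, by linarith, by
        have := (pos_iff_pos_of_mul_pos hll).mp h; linarith⟩
    · have hl : l < 0 := lt_of_le_of_ne h (fun h => by simp [h] at hll)
      exact ⟨-1, Or.inr rfl, by linarith, by
        have := (neg_iff_neg_of_mul_pos hll).mp hl; linarith⟩
  have hεε : ε * ε = 1 := by rcases hε with rfl | rfl <;> norm_num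
  have hεa : |ε| = 1 := by rcases hε with rfl | rfl <;> norm_num
  obtain ⟨r₁, hr₁, A, G, c₀, C₁, M, K, ν, c, hS, hch⟩ := cone_chart hX h0 hlm hε hεl
  obtain ⟨r₂, hr₂, A', G', c₀', C₁', M', K', ν', c', hS', hch'⟩ := cone_chart hX' h0' hlm' hε hεl'
  obtain ⟨F, hF⟩ := hS.good.exists_flow
  obtain ⟨F', hF'⟩ := hS'.good.exists_flow
  obtain ⟨g', hg'⟩ := exists_conj_sign g hε
  have hg'C : ∀ ρ, |g' ρ - ρ| ≤ C := fun ρ => by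
    have : g' ρ - ρ = ε * (g (ε * ρ) - ε * ρ) := by
      rw [hg', mul_sub, ← mul_assoc, hεε, one_mul]
    rw [this, abs_mul, hεa, one_mul]; exact hg _
  obtain ⟨Hs, Hsc, Hsb, Hs1, Hs2, HsS, HsC, Hsξ, Hsσ⟩ := strip_lemma hS hF hS' hF' g' C hC hg'C
  set H : ℝ × ℝ → ℝ × ℝ := fun p => if 0 < p.1 then cP ε (Hs (ca ε p, cb p)) else 0 with hH
  have Hpos : ∀ p : ℝ × ℝ, 0 < p.1 → H p = cP ε (Hs (ca ε p, cb p)) := fun p hp => if_pos hp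
  have Hz : H 0 = 0 := if_neg (by simp)
  have hcz : ∀ p ∈ cone, ¬ 0 < p.1 → p = 0 := fun p hp h => by
    by_contra hne; exact h (cone_pos hp hne)
  have hcb : ∀ p ∈ cone, 0 < p.1 → |cb p| ≤ 1 := fun p hp h => by
    simp only [cb]; rw [abs_div, abs_of_pos h, div_le_one h]; exact hp
  have hcP : ∀ q : ℝ × ℝ, |q.2| ≤ 1 → cP ε q ∈ cone := fun q hq => by
    show |q.2 * Real.exp (ε * q.1)| ≤ Real.exp (ε * q.1)
    rw [abs_mul, abs_of_pos (Real.exp_pos _)]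
    exact mul_le_of_le_one_left (Real.exp_pos _).le hq
  have hcPpos : ∀ q : ℝ × ℝ, 0 < (cP ε q).1 := fun q => Real.exp_pos _
  have hmaps : MapsTo H cone cone := fun p hp => by
    by_cases h : 0 < p.1
    · rw [Hpos p h]
      exact hcP _ ((HsS _).mp (hcb p hp h))
    · rw [hcz p hp h, Hz]; simp [cone]
  have hca : ∀ p : ℝ × ℝ, 0 < p.1 → ε * ca ε p = Real.log p.1 := fun p hp => by
    simp only [ca]; rw [← mul_assoc, hεε, one_mul]
  have hbound : ∀ p ∈ cone, Real.exp (-C) * ‖p‖ ≤ ‖H p‖ ∧ ‖H p‖ ≤ Real.exp C * ‖p‖ := by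
    intro p hp
    rw [cone_norm hp, cone_norm (hmaps hp)]
    by_cases h : 0 < p.1
    · rw [Hpos p h]
      have h1 := HsC (ca ε p, cb p)
      have h2 : |ε * (Hs (ca ε p, cb p)).1 - Real.log p.1| ≤ C := by
        rw [← hca p h, ← mul_sub, abs_mul, hεa, one_mul]; exact h1
      have h3 := abs_le.mp h2
      have e : p.1 = Real.exp (Real.log p.1) := (Real.exp_log h).symm
      constructor
      · conv_lhs => rw [e]
        rw [← Real.exp_add]
        exact Real.exp_le_exp.mpr (by linarith)
      · conv_rhs => rw [e]
        rw [← Real.exp_add]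
        exact Real.exp_le_exp.mpr (by linarith)
    · rw [hcz p hp h, Hz]; simp
  refine ⟨min r₁ r₂, lt_min hr₁ hr₂, H, ?_, ⟨hmaps, ?_, ?_⟩, ?_, ?_, hbound, ?_⟩
  · intro p hp
    by_cases h : 0 < p.1
    · have hev : H =ᶠ[nhds p] fun p => cP ε (Hs (ca ε p, cb p)) := by
        filter_upwards [(isOpen_lt continuous_const continuous_fst).mem_nhds h] with q hq
          using Hpos q hq
      apply ContinuousAt.continuousWithinAt
      apply ContinuousAt.congr _ hev.symm
      have h1 : ContinuousAt (ca ε) p :=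
        continuousAt_const.mul (continuousAt_fst.log h.ne')
      have h2 : ContinuousAt cb p := continuousAt_snd.div continuousAt_fst h.ne'
      have h3 : Continuous (cP ε) := by unfold cP; fun_prop
      exact (h3.comp Hsc).continuousAt.comp (h1.prodMk h2)
    · have hp0 := hcz p hp h
      subst hp0
      rw [ContinuousWithinAt, Hz]
      apply squeeze_zero_norm' (a := fun p => Real.exp C * ‖p‖)
      · filter_upwards [self_mem_nhdsWithin] with q hq using (hbound q hq).2
      · have : Continuous (fun p : ℝ × ℝ => Real.exp C * ‖p‖) := by fun_prop
        have := (this.tendsto 0).mono_left (nhdsWithin_le_nhds (s := cone))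
        simpa using this
  · intro p hp q hq hpq
    by_cases h : 0 < p.1
    · by_cases h' : 0 < q.1
      · rw [Hpos p h, Hpos q h'] at hpq
        have h1 : Hs (ca ε p, cb p) = Hs (ca ε q, cb q) := by
          rw [← ca_cP hε (Hs (ca ε p, cb p)), ← ca_cP hε (Hs (ca ε q, cb q)), hpq]
        have h2 := Hsb.1 h1
        rw [← cP_ca hε h, ← cP_ca hε h', h2]
      · rw [hcz q hq h', Hz, Hpos p h] at hpq
        have := hcPpos (Hs (ca ε p, cb p))
        rw [hpq] at this; simp at this
    · by_cases h' : 0 < q.1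
      · rw [hcz p hp h, Hz, Hpos q h'] at hpq
        have := hcPpos (Hs (ca ε q, cb q))
        rw [← hpq] at this; simp at this
      · rw [hcz p hp h, hcz q hq h']
  · intro p hp
    by_cases h : 0 < p.1
    · obtain ⟨q, hq⟩ := Hsb.2 (ca ε p, cb p)
      refine ⟨cP ε q, hcP q ((HsS q).mpr ?_), ?_⟩
      · rw [hq]; exact hcb p hp h
      · rw [Hpos _ (hcPpos q), ca_cP hε, hq, cP_ca hε h]
    · exact ⟨0, by simp [cone], by rw [Hz, hcz p hp h]⟩
  · intro u hu
    rcases hu.eq_or_lt with h | h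
    · rw [← h]; exact Hz
    · rw [Hpos (u, u) h]
      have e : cb (u, u) = 1 := by simp only [cb]; field_simp
      rw [e, Hs1, ← e]; exact cP_ca hε (p := (u, u)) h
  · intro u hu
    rw [Hpos (u, -u) hu]
    have e : cb (u, -u) = -1 := by simp only [cb]; field_simp
    have e2 : ε * g' (ca ε (u, -u)) = g (Real.log u) := by
      rw [hg', ← mul_assoc, hεε, one_mul, hca (u, -u) hu]
    rw [e, Hs2]
    simp only [cP, e2]; simp
  · intro γ I hI hγ hW
    have hHc : ContinuousOn (fun t => H (γ t)) I := by
      intro t ht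
      have h := cone_pos (hW t ht).1 (hW t ht).2.1
      have hev : H =ᶠ[nhds (γ t)] fun p => cP ε (Hs (ca ε p, cb p)) := by
        filter_upwards [(isOpen_lt continuous_const continuous_fst).mem_nhds h] with q hq
          using Hpos q hq
      have h1 : ContinuousAt (ca ε) (γ t) :=
        continuousAt_const.mul (continuousAt_fst.log h.ne')
      have h2 : ContinuousAt cb (γ t) := continuousAt_snd.div continuousAt_fst h.ne'
      have h3 : Continuous (cP ε) := by unfold cP; fun_prop
      have hHat : ContinuousAt H (γ t) := by
        apply ContinuousAt.congr _ hev.symm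
        exact (h3.comp Hsc).continuousAt.comp (h1.prodMk h2)
      exact hHat.comp_continuousWithinAt (hγ t ht)
    have hp : ∀ t ∈ I, 0 < (γ t).1 := fun t ht => cone_pos (hW t ht).1 (hW t ht).2.1
    rw [(hch _ (min_le_left r₁ r₂)).iff hF 0 hI hγ (fun t ht => ⟨hp t ht, (hW t ht).1, by
        rw [← cone_norm (hW t ht).1]; exact (hW t ht).2.2.1⟩),
      (hch' _ (min_le_right r₁ r₂)).iff hF' 0 hI hHc (fun t ht => ⟨by
        rw [Hpos _ (hp t ht)]; exact hcPpos _, hmaps (hW t ht).1, by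
        rw [← cone_norm (hmaps (hW t ht).1)]; exact (hW t ht).2.2.2⟩)]
    have hcoord : ∀ t ∈ I, (ca ε (H (γ t)), cb (H (γ t))) = Hs (ca ε (γ t), cb (γ t)) :=
      fun t ht => by rw [Hpos _ (hp t ht), ca_cP hε]
    have hc1 : ∀ t ∈ I, ca ε (H (γ t)) = (Hs (ca ε (γ t), cb (γ t))).1 := fun t ht => by
      rw [← hcoord t ht]
    have hc2 : ∀ t ∈ I, cb (H (γ t)) = (Hs (ca ε (γ t), cb (γ t))).2 := fun t ht => by
      rw [← hcoord t ht]
    constructor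
    · rintro ⟨h1, h2⟩
      refine ⟨fun t ht t' ht' => ?_, fun t ht t' ht' htt => ?_⟩
      · rw [hc1 t ht, hc2 t ht, hc1 t' ht', hc2 t' ht']
        exact (Hsξ _ _).mp (h1 t ht t' ht')
      · simp only [hc1 t ht, hc1 t' ht']
        exact (Hsσ _ _ (h1 t ht t' ht')).mp (h2 ht ht' htt)
    · rintro ⟨h1, h2⟩
      have h1' : ∀ t ∈ I, ∀ t' ∈ I, F 0 (ca ε (γ t)) (cb (γ t)) = F 0 (ca ε (γ t')) (cb (γ t')) := by
        intro t ht t' ht'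
        have := h1 t ht t' ht'
        rw [hc1 t ht, hc2 t ht, hc1 t' ht', hc2 t' ht'] at this
        exact (Hsξ (ca ε (γ t), cb (γ t)) (ca ε (γ t'), cb (γ t'))).mpr this
      refine ⟨h1', fun t ht t' ht' htt => ?_⟩
      have := h2 ht ht' htt
      simp only [hc1 t ht, hc1 t' ht'] at this
      exact (Hsσ (ca ε (γ t), cb (γ t)) (ca ε (γ t'), cb (γ t')) (h1' t ht t' ht')).mpr this


/-! ### M7: focus chart -/

def rot (w : ℂ) : ℂ →L[ℝ] ℂ := ContinuousLinearMap.mul ℝ ℂ w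
theorem rot_apply (w z : ℂ) : rot w z = w * z := rfl

def fa (z : ℂ) : ℝ := (Complex.log (-Complex.I * z)).im
def fb (z : ℂ) : ℝ := (Complex.log (-Complex.I * z)).re
def fP (q : ℝ × ℝ) : ℂ := Complex.I * Complex.exp ((q.2 : ℂ) + (q.1 : ℂ) * Complex.I)
def fD (r : ℝ) : Set ℂ := {z | z ≠ 0 ∧ 0 ≤ z.im ∧ ‖z‖ ≤ r}

theorem fP_ne (q : ℝ × ℝ) : fP q ≠ 0 := mul_ne_zero Complex.I_ne_zero (Complex.exp_ne_zero _)

theorem fP_norm (q : ℝ × ℝ) : ‖fP q‖ = Real.exp q.2 := by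
  simp [fP, Complex.norm_exp]

theorem fP_fa {z : ℂ} (hz : z ≠ 0) : fP (fa z, fb z) = z := by
  have e : ((fb z : ℝ) : ℂ) + ((fa z : ℝ) : ℂ) * Complex.I = Complex.log (-Complex.I * z) :=
    Complex.re_add_im _
  simp only [fP]
  rw [e, Complex.exp_log (by simp [hz]), ← mul_assoc]
  simp

theorem fb_eq {z : ℂ} : fb z = Real.log ‖z‖ := by
  simp [fb, Complex.log_re]

theorem fa_fP (q : ℝ × ℝ) (h1 : -Real.pi < q.1) (h2 : q.1 ≤ Real.pi) : fa (fP q) = q.1 := by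
  have e : -Complex.I * fP q = Complex.exp ((q.2 : ℂ) + (q.1 : ℂ) * Complex.I) := by
    simp only [fP]; rw [← mul_assoc]; simp
  simp only [fa]
  rw [e, Complex.log_exp (by simpa using h1) (by simpa using h2)]
  simp

theorem fb_fP (q : ℝ × ℝ) : fb (fP q) = q.2 := by
  rw [fb_eq, fP_norm, Real.log_exp]

theorem slit_of {z : ℂ} (hz : z ≠ 0) (hi : 0 ≤ z.im) : -Complex.I * z ∈ Complex.slitPlane := by
  rw [Complex.mem_slitPlane_iff]
  simp only [neg_mul, Complex.neg_re, Complex.mul_re, Complex.I_re, Complex.I_im, Complex.neg_im,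
    Complex.mul_im]
  rcases hi.eq_or_lt with h | h
  · right
    intro h'
    apply hz
    apply Complex.ext
    · simp at h'; simpa using h'
    · exact h.symm
  · left; simpa using h

theorem fa_mem {z : ℂ} (hi : 0 ≤ z.im) : fa z ∈ Icc (-(Real.pi / 2)) (Real.pi / 2) := by
  have h : |Complex.arg (-Complex.I * z)| ≤ Real.pi / 2 := by
    rw [Complex.abs_arg_le_pi_div_two_iff]
    simpa using hi
  simp only [fa, Complex.log_im]
  exact abs_le.mp h

theorem fP_im (q : ℝ × ℝ) : (fP q).im = Real.exp q.2 * Real.cos q.1 := by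
  simp [fP, Complex.exp_re, Complex.exp_im]

theorem fP_re (q : ℝ × ℝ) : (fP q).re = -(Real.exp q.2 * Real.sin q.1) := by
  simp [fP, Complex.exp_re, Complex.exp_im]

theorem fP_cont : Continuous fP := by unfold fP; fun_prop

theorem log_fderiv {z : ℂ} (hz : z ≠ 0) (hi : 0 ≤ z.im) :
    HasFDerivAt (fun z => Complex.log (-Complex.I * z)) (rot z⁻¹) z := by
  have h1 : HasDerivAt (fun z : ℂ => -Complex.I * z) (-Complex.I) z := by
    simpa using (hasDerivAt_id z).const_mul (-Complex.I)
  have h2 := (h1.clog (slit_of hz hi)).complexToReal_fderiv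
  apply h2.congr_fderiv
  ext x
  simp [rot]
  field_simp
  simp

theorem fa_fderiv {z : ℂ} (hz : z ≠ 0) (hi : 0 ≤ z.im) :
    HasFDerivAt fa (Complex.imCLM.comp (rot z⁻¹)) z :=
  Complex.imCLM.hasFDerivAt.comp z (log_fderiv hz hi)

theorem fb_fderiv {z : ℂ} (hz : z ≠ 0) (hi : 0 ≤ z.im) :
    HasFDerivAt fb (Complex.reCLM.comp (rot z⁻¹)) z :=
  Complex.reCLM.hasFDerivAt.comp z (log_fderiv hz hi)

theorem fP_fderiv (q : ℝ × ℝ) : HasFDerivAt fP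
    ((rot (fP q)).comp (Complex.ofRealCLM.comp (ContinuousLinearMap.snd ℝ ℝ ℝ) +
      (rot Complex.I).comp (Complex.ofRealCLM.comp (ContinuousLinearMap.fst ℝ ℝ ℝ)))) q := by
  have h1 : HasFDerivAt (fun q : ℝ × ℝ => (q.2 : ℂ) + (q.1 : ℂ) * Complex.I)
      (Complex.ofRealCLM.comp (ContinuousLinearMap.snd ℝ ℝ ℝ) +
      (rot Complex.I).comp (Complex.ofRealCLM.comp (ContinuousLinearMap.fst ℝ ℝ ℝ))) q := by
    have := (Complex.ofRealCLM.comp (ContinuousLinearMap.snd ℝ ℝ ℝ) +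
      (rot Complex.I).comp (Complex.ofRealCLM.comp (ContinuousLinearMap.fst ℝ ℝ ℝ))).hasFDerivAt
        (x := q)
    refine this.congr_of_eventuallyEq (Eventually.of_forall fun q => ?_)
    simp [rot_apply, mul_comm]
  have h2 := (h1.cexp).const_mul Complex.I
  apply h2.congr_fderiv
  ext <;> simp [rot_apply, fP, mul_assoc]

theorem quot_est {β' a a' b b' B1 κ : ℝ} (hβ : 0 < β') (ha : β' ≤ a) (ha' : β' ≤ a')
    (hb' : |b'| ≤ B1) (h1 : |a - a'| ≤ κ) (h2 : |b - b'| ≤ κ) :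
    |b / a - b' / a'| ≤ (1 / β' + B1 / β' ^ 2) * κ := by
  have hp : 0 < a := by linarith
  have hp' : 0 < a' := by linarith
  have hκ : 0 ≤ κ := (abs_nonneg _).trans h1
  have hB : 0 ≤ B1 := (abs_nonneg _).trans hb'
  have e : b / a - b' / a' = (b - b') / a + b' * (a' - a) / (a * a') := by
    field_simp; ring
  rw [e]
  refine (abs_add_le _ _).trans ?_
  rw [abs_div, abs_div, abs_mul, abs_of_pos hp, abs_of_pos (mul_pos hp hp'), abs_sub_comm a' a]
  have h3 : |b - b'| / a ≤ κ / β' := by gcongr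
  have h4 : |b'| * |a - a'| / (a * a') ≤ B1 * κ / (β' * β') := by gcongr
  have e2 : (1 / β' + B1 / β' ^ 2) * κ = κ / β' + B1 * κ / (β' * β') := by field_simp
  rw [e2]; linarith

theorem focus_chart {X : ℂ → ℂ} {α β ε : ℝ} (hX : HasStrictFDerivAt X (rot ⟨α, β⟩) 0)
    (h0 : X 0 = 0) (hβ : 0 < β) (hε : 0 < ε) :
    ∃ r > 0, ∃ (A G : ℝ → ℝ → ℝ) (c₀ C₁ M K : ℝ), (∀ t x, |G t x - α / β| ≤ ε) ∧
      Chart X (fD r) fa fb fP A G c₀ C₁ M K := by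
  set w : ℂ := ⟨α, β⟩ with hw
  set κ := 1 / (β / 2) + (|α|) / (β / 2) ^ 2 with hκ
  have hκ0 : 0 < κ := by positivity
  set η := min (β / 2) (ε / κ) with hηd
  have hη : 0 < η := lt_min (by linarith) (by positivity)
  have hη1 : η ≤ β / 2 := min_le_left _ _
  have hη2 : η ≤ ε / κ := min_le_right _ _
  obtain ⟨r, hr, hlip, hbd⟩ := remainder_exists hX h0 hη
  set Rm : ℂ → ℂ := fun p => X p - rot w p with hRm
  set pt : ℝ → ℝ → ℂ := fun θ s => fP (θ, min s (Real.log r)) with hpt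
  have hptn : ∀ θ s, ‖pt θ s‖ = Real.exp (min s (Real.log r)) := fun θ s => fP_norm _
  have hptr : ∀ θ s, ‖pt θ s‖ ≤ r := fun θ s => by
    rw [hptn]
    calc _ ≤ Real.exp (Real.log r) := Real.exp_le_exp.mpr (min_le_right _ _)
      _ = r := Real.exp_log hr
  have hpt0 : ∀ θ s, pt θ s ≠ 0 := fun θ s => fP_ne _
  have hptc : Continuous (fun q : ℝ × ℝ => pt q.1 q.2) := by
    simp only [hpt]
    exact fP_cont.comp (continuous_fst.prodMk (continuous_snd.min continuous_const))
  have hRmc : Continuous (fun q : ℝ × ℝ => Rm (pt q.1 q.2)) := by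
    have : LipschitzOnWith ⟨η, hη.le⟩ Rm (Metric.closedBall 0 r) := by
      apply LipschitzOnWith.of_dist_le_mul
      intro p hp q hq
      rw [dist_eq_norm, dist_eq_norm]
      exact hlip p q (by simpa using hp) (by simpa using hq)
    exact this.continuousOn.comp_continuous hptc (fun q => by simpa using hptr _ _)
  set q : ℝ → ℝ → ℂ := fun θ s => Rm (pt θ s) / pt θ s with hq
  have hqc : Continuous (fun p : ℝ × ℝ => q p.1 p.2) := hRmc.div hptc (fun p => hpt0 _ _)
  have hqb : ∀ θ s, ‖q θ s‖ ≤ η := fun θ s => by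
    simp only [hq]
    rw [norm_div, div_le_iff₀ (norm_pos_iff.mpr (hpt0 θ s))]
    exact hbd _ (hptr θ s)
  have hql' : ∀ θ s s', s' ≤ s → ‖q θ s - q θ s'‖ ≤ 2 * η * |s - s'| := by
    intro θ s s' hss
    set p := pt θ s with hp
    set p' := pt θ s' with hp'
    have hp0 : p ≠ 0 := hpt0 _ _
    have hp0' : p' ≠ 0 := hpt0 _ _
    have e : q θ s - q θ s' = (Rm p - Rm p') / p + q θ s' * ((p' - p) / p) := by
      simp only [hq]
      rw [← hp, ← hp']
      field_simp; ring
    have h1 : ‖p - p'‖ ≤ |s - s'| * ‖p‖ := by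
      set u := min s (Real.log r) with hu
      set u' := min s' (Real.log r) with hu'
      have huu : u' ≤ u := min_le_min_right _ hss
      have hd : |u - u'| ≤ |s - s'| := by
        have := abs_min_sub_min_le_max s (Real.log r) s' (Real.log r)
        simpa using this
      have e1 : p' = (Real.exp (u' - u) : ℂ) * p := by
        simp only [hp', hp, hpt, fP]
        rw [← hu, ← hu', Complex.ofReal_exp, mul_left_comm, ← Complex.exp_add]
        push_cast
        ring_nf
      have e2 : p - p' = ((1 - Real.exp (u' - u) : ℝ) : ℂ) * p := by
        rw [e1]; push_cast; ring
      rw [e2, norm_mul, Complex.norm_real]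
      gcongr
      refine le_trans ?_ hd
      have h3 := Real.add_one_le_exp (u' - u)
      have h4 : Real.exp (u' - u) ≤ 1 := Real.exp_le_one_iff.mpr (by linarith)
      rw [Real.norm_eq_abs, abs_of_nonneg (by linarith), abs_of_nonneg (by linarith)]
      linarith
    have h2 : ‖(p' - p) / p‖ ≤ |s - s'| := by
      rw [norm_div, div_le_iff₀ (norm_pos_iff.mpr hp0), norm_sub_rev]; exact h1
    have h3 : ‖(Rm p - Rm p') / p‖ ≤ η * |s - s'| := by
      rw [norm_div, div_le_iff₀ (norm_pos_iff.mpr hp0), mul_assoc]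
      exact (hlip p p' (hptr _ _) (hptr _ _)).trans (mul_le_mul_of_nonneg_left h1 hη.le)
    rw [e]
    refine (norm_add_le _ _).trans ?_
    have h4 : ‖q θ s' * ((p' - p) / p)‖ ≤ η * |s - s'| := by
      rw [norm_mul]
      exact mul_le_mul (hqb _ _) h2 (norm_nonneg _) hη.le
    linarith
  have hql : ∀ θ s s', ‖q θ s - q θ s'‖ ≤ 2 * η * |s - s'| := by
    intro θ s s'
    rcases le_total s' s with h | h
    · exact hql' θ s s' h
    · rw [norm_sub_rev, abs_sub_comm]; exact hql' θ s' s h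
  set A : ℝ → ℝ → ℝ := fun θ s => β + (q θ s).im with hA
  set B : ℝ → ℝ → ℝ := fun θ s => α + (q θ s).re with hB
  have hAb : ∀ θ s, |A θ s - β| ≤ η := fun θ s => by
    simp only [hA, add_sub_cancel_left]
    exact (Complex.abs_im_le_norm _).trans (hqb θ s)
  have hBb : ∀ θ s, |B θ s - α| ≤ η := fun θ s => by
    simp only [hB, add_sub_cancel_left]
    exact (Complex.abs_re_le_norm _).trans (hqb θ s)
  have hAl : ∀ θ s s', |A θ s - A θ s'| ≤ 2 * η * |s - s'| := fun θ s s' => by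
    simp only [hA, add_sub_add_left_eq_sub]
    rw [← Complex.sub_im]
    exact (Complex.abs_im_le_norm _).trans (hql θ s s')
  have hBl : ∀ θ s s', |B θ s - B θ s'| ≤ 2 * η * |s - s'| := fun θ s s' => by
    simp only [hB, add_sub_add_left_eq_sub]
    rw [← Complex.sub_re]
    exact (Complex.abs_re_le_norm _).trans (hql θ s s')
  have hAlo : ∀ θ s, β / 2 ≤ A θ s := fun θ s => by
    have := (abs_le.mp (hAb θ s)).1; linarith
  have hAhi : ∀ θ s, A θ s ≤ 2 * β := fun θ s => by
    have := (abs_le.mp (hAb θ s)).2; linarith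
  have hApos : ∀ θ s, 0 < A θ s := fun θ s => by have := hAlo θ s; linarith
  have hAc : Continuous (fun p : ℝ × ℝ => A p.1 p.2) :=
    continuous_const.add (Complex.continuous_im.comp hqc)
  have hBc : Continuous (fun p : ℝ × ℝ => B p.1 p.2) :=
    continuous_const.add (Complex.continuous_re.comp hqc)
  set G : ℝ → ℝ → ℝ := fun θ s => B θ s / A θ s with hG
  have hGε : ∀ θ s, |G θ s - α / β| ≤ ε := fun θ s => by
    have := quot_est (β' := β / 2) (by linarith) (hAlo θ s) (by linarith : β / 2 ≤ β)
      (le_refl |α|) (hAb θ s) (hBb θ s)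
    refine this.trans ?_
    rw [le_div_iff₀ hκ0] at hη2
    rw [← hκ]; linarith
  refine ⟨r, hr, A, G, β / 2, 2 * β, |α / β| + ε,
    (1 / (β / 2) + (|α| + η) / (β / 2) ^ 2) * (2 * η), hGε, ?_⟩
  have hgood : GoodG G (|α / β| + ε) ((1 / (β / 2) + (|α| + η) / (β / 2) ^ 2) * (2 * η)) := by
    refine ⟨hBc.div hAc (fun p => (hApos _ _).ne'), fun θ s => ?_, fun θ s s' => ?_⟩
    · have := hGε θ s
      have h2 := abs_sub_abs_le_abs_sub (G θ s) (α / β)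
      linarith
    · rw [mul_assoc]
      apply quot_est (by linarith) (hAlo θ s) (hAlo θ s') _ (hAl θ s s') (hBl θ s s')
      have := hBb θ s'
      have h2 := abs_sub_abs_le_abs_sub (B θ s') α
      linarith
  have hfact : ∀ z ∈ fD r, X z = z * ((B (fa z) (fb z) : ℂ) + (A (fa z) (fb z) : ℂ) * Complex.I) := by
    rintro z ⟨hz0, hzi, hzr⟩
    have e1 : pt (fa z) (fb z) = z := by
      simp only [hpt]
      rw [min_eq_left, fP_fa hz0]
      rw [fb_eq]
      exact Real.log_le_log (norm_pos_iff.mpr hz0) hzr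
    have e2 : ((B (fa z) (fb z) : ℂ) + (A (fa z) (fb z) : ℂ) * Complex.I) = w + q (fa z) (fb z) := by
      apply Complex.ext <;> simp [hA, hB, hw]
    rw [e2]
    simp only [hq, e1, hRm, rot_apply]
    field_simp; ring
  have hAG : ∀ θ s, A θ s * G θ s = B θ s := fun θ s => by
    simp only [hG]; rw [mul_div_cancel₀ _ (hApos _ _).ne']
  refine ⟨by linarith, hAlo, hAhi, hAc, hgood, ?_, ?_, ?_, ?_⟩
  · rintro z hz
    refine ⟨_, fa_fderiv hz.1 hz.2.1, ?_⟩
    rw [hfact z hz]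
    simp only [ContinuousLinearMap.comp_apply, rot_apply, Complex.imCLM_apply]
    rw [inv_mul_cancel_left₀ hz.1]; simp
  · rintro z hz
    refine ⟨_, fb_fderiv hz.1 hz.2.1, ?_⟩
    rw [hAG, hfact z hz]
    simp only [ContinuousLinearMap.comp_apply, rot_apply, Complex.reCLM_apply]
    rw [inv_mul_cancel_left₀ hz.1]; simp
  · rintro z hz; exact fP_fa hz.1
  · rintro z hz
    refine ⟨_, fP_fderiv _, ?_⟩
    rw [hfact z hz, fP_fa hz.1]
    simp only [ContinuousLinearMap.comp_apply, rot_apply, add_apply,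
      ContinuousLinearMap.coe_fst', ContinuousLinearMap.coe_snd', Complex.ofRealCLM_apply]
    rw [← hAG]
    simp only [Complex.real_smul]
    push_cast; ring


/-! ### M8: half-plane equivalences and the focus case -/

structure UE {E : Type*} [NormedAddCommGroup E] [NormedSpace ℝ E] (X X' : E → E) (S : Set E)
    (H : E → E) : Prop where
  zero : H 0 = 0
  cont : ContinuousOn H S
  bij : BijOn H S S
  proper : ∀ R, ∃ R', ∀ p ∈ S, ‖H p‖ ≤ R → ‖p‖ ≤ R'
  oc : ∃ r > 0, ∀ (γ : ℝ → E) (I : Set ℝ), I.OrdConnected → ContinuousOn γ I →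
    (∀ t ∈ I, γ t ∈ S ∧ ‖γ t‖ ≤ r ∧ ‖H (γ t)‖ ≤ r) → (OC X γ I ↔ OC X' (fun t => H (γ t)) I)

theorem UE.conj {E E' : Type*} [NormedAddCommGroup E] [NormedSpace ℝ E] [NormedAddCommGroup E']
    [NormedSpace ℝ E'] {X X' : E → E} {Z Z' : E' → E'} {S : Set E} {S₁ : Set E'} (T T' : E ≃L[ℝ] E')
    (hT : ∀ p, Z (T p) = T (X p)) (hT' : ∀ p, Z' (T' p) = T' (X' p))
    (hS : ∀ p, p ∈ S ↔ T p ∈ S₁) (hS' : ∀ p, p ∈ S ↔ T' p ∈ S₁) {H : E' → E'}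
    (h : UE Z Z' S₁ H) : UE X X' S (fun p => T'.symm (H (T p))) := by
  have hb : ∃ C > 0, (∀ p, ‖T p‖ ≤ C * ‖p‖) ∧ (∀ p, ‖T' p‖ ≤ C * ‖p‖) ∧
      (∀ p, ‖T.symm p‖ ≤ C * ‖p‖) := by
    refine ⟨‖(T : E →L[ℝ] E')‖ + ‖(T' : E →L[ℝ] E')‖ + ‖(T.symm : E' →L[ℝ] E)‖ + 1, by positivity,
      fun p => ?_, fun p => ?_, fun p => ?_⟩
    · refine ((T : E →L[ℝ] E').le_opNorm p).trans ?_
      gcongr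
      linarith [norm_nonneg (T' : E →L[ℝ] E'), norm_nonneg (T.symm : E' →L[ℝ] E)]
    · refine ((T' : E →L[ℝ] E').le_opNorm p).trans ?_
      gcongr
      linarith [norm_nonneg (T : E →L[ℝ] E'), norm_nonneg (T.symm : E' →L[ℝ] E)]
    · refine ((T.symm : E' →L[ℝ] E).le_opNorm p).trans ?_
      gcongr
      linarith [norm_nonneg (T : E →L[ℝ] E'), norm_nonneg (T' : E →L[ℝ] E')]
  obtain ⟨C, hC, hC1, hC2, hC3⟩ := hb
  refine ⟨by simp [h.zero], ?_, ⟨?_, ?_, ?_⟩, ?_, ?_⟩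
  · exact T'.symm.continuous.comp_continuousOn
      (h.cont.comp T.continuous.continuousOn (fun p hp => (hS p).mp hp))
  · intro p hp
    rw [hS', T'.apply_symm_apply]
    exact h.bij.mapsTo ((hS p).mp hp)
  · intro p hp q hq hpq
    exact T.injective (h.bij.injOn ((hS p).mp hp) ((hS q).mp hq) (T'.symm.injective hpq))
  · intro p hp
    obtain ⟨q, hq, hqp⟩ := h.bij.surjOn ((hS' p).mp hp)
    refine ⟨T.symm q, ?_, ?_⟩
    · rw [hS, T.apply_symm_apply]; exact hq
    · simp only [T.apply_symm_apply, hqp, T'.symm_apply_apply]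
  · intro R
    obtain ⟨R', hR'⟩ := h.proper (C * R)
    refine ⟨C * R', fun p hp hpR => ?_⟩
    have h1 : ‖H (T p)‖ ≤ C * R := by
      have := hC2 (T'.symm (H (T p)))
      rw [T'.apply_symm_apply] at this
      exact this.trans (mul_le_mul_of_nonneg_left hpR hC.le)
    have h2 := hR' _ ((hS p).mp hp) h1
    have := hC3 (T p)
    rw [T.symm_apply_apply] at this
    exact this.trans (mul_le_mul_of_nonneg_left h2 hC.le)
  · obtain ⟨r, hr, hoc⟩ := h.oc
    refine ⟨r / C, by positivity, fun γ I hI hγ hW => ?_⟩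
    have h1 := hoc (fun t => T (γ t)) I hI (T.continuous.comp_continuousOn hγ) (fun t ht => by
      obtain ⟨w1, w2, w3⟩ := hW t ht
      refine ⟨(hS _).mp w1, ?_, ?_⟩
      · refine (hC1 _).trans ?_
        rw [le_div_iff₀ hC] at w2; linarith
      · have := hC2 (T'.symm (H (T (γ t))))
        rw [T'.apply_symm_apply] at this
        refine this.trans ?_
        rw [le_div_iff₀ hC] at w3; linarith)
    rw [OC.conj_iff T hT] at h1
    rw [h1]
    rw [← OC.conj_iff T' hT']
    simp only [T'.apply_symm_apply]

/-- boundary map -/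
def hS (gp gm : ℝ ≃o ℝ) (x : ℝ) : ℝ :=
  if 0 < x then Real.exp (gp (Real.log x)) else if x < 0 then -Real.exp (gm (Real.log (-x))) else 0

theorem hS_pos {gp gm : ℝ ≃o ℝ} {x : ℝ} (h : 0 < x) : hS gp gm x = Real.exp (gp (Real.log x)) :=
  if_pos h
theorem hS_neg {gp gm : ℝ ≃o ℝ} {x : ℝ} (h : x < 0) :
    hS gp gm x = -Real.exp (gm (Real.log (-x))) := by
  rw [hS, if_neg (by linarith), if_pos h]
theorem hS_zero {gp gm : ℝ ≃o ℝ} : hS gp gm 0 = 0 := by simp [hS]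

theorem hS_swap (gp gm : ℝ ≃o ℝ) (x : ℝ) : hS gm gp (-x) = - hS gp gm x := by
  rcases lt_trichotomy x 0 with h | h | h
  · rw [hS_neg h, hS_pos (by linarith), neg_neg]
  · subst h; simp [hS_zero]
  · rw [hS_pos h, hS_neg (by linarith), neg_neg]

theorem hS_inv (gp gm : ℝ ≃o ℝ) (x : ℝ) : hS gp gm (hS gp.symm gm.symm x) = x := by
  rcases lt_trichotomy x 0 with h | h | h
  · rw [hS_neg h, hS_neg (by simpa using Real.exp_pos _), neg_neg, Real.log_exp,
      OrderIso.apply_symm_apply, Real.exp_log (by linarith), neg_neg]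
  · subst h; simp [hS_zero]
  · rw [hS_pos h, hS_pos (Real.exp_pos _), Real.log_exp, OrderIso.apply_symm_apply, Real.exp_log h]

/-- The focus homeomorphism. -/
def FH (F F' : ℝ → ℝ → ℝ → ℝ) (g : ℝ ≃o ℝ) (z : ℂ) : ℂ :=
  if z = 0 then 0 else
    fP (fa z, F' (fa z) (-(Real.pi / 2)) (g (F (-(Real.pi / 2)) (fa z) (fb z))))

theorem FH_zero (F F' : ℝ → ℝ → ℝ → ℝ) (g : ℝ ≃o ℝ) : FH F F' g 0 = 0 := if_pos rfl
theorem FH_ne {F F' : ℝ → ℝ → ℝ → ℝ} {g : ℝ ≃o ℝ} {z : ℂ} (hz : z ≠ 0) : FH F F' g z =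
    fP (fa z, F' (fa z) (-(Real.pi / 2)) (g (F (-(Real.pi / 2)) (fa z) (fb z)))) := if_neg hz

theorem FH_ne_zero {F F' : ℝ → ℝ → ℝ → ℝ} {g : ℝ ≃o ℝ} {z : ℂ} (hz : z ≠ 0) : FH F F' g z ≠ 0 := by
  rw [FH_ne hz]; exact fP_ne _

def UH : Set ℂ := {z | 0 ≤ z.im}

theorem FH_fa {F F' : ℝ → ℝ → ℝ → ℝ} {g : ℝ ≃o ℝ} {z : ℂ} (hz : z ≠ 0) (hi : z ∈ UH) :
    fa (FH F F' g z) = fa z := by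
  rw [FH_ne hz]
  have := fa_mem hi
  apply fa_fP _ <;> simp only <;> linarith [this.1, this.2, Real.pi_pos]

theorem FH_fb {F F' : ℝ → ℝ → ℝ → ℝ} {g : ℝ ≃o ℝ} {z : ℂ} (hz : z ≠ 0) :
    fb (FH F F' g z) = F' (fa z) (-(Real.pi / 2)) (g (F (-(Real.pi / 2)) (fa z) (fb z))) := by
  rw [FH_ne hz, fb_fP]

theorem FH_maps {F F' : ℝ → ℝ → ℝ → ℝ} {g : ℝ ≃o ℝ} {z : ℂ} (hi : z ∈ UH) : FH F F' g z ∈ UH := by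
  by_cases hz : z = 0
  · subst hz; rw [FH_zero]; simp [UH]
  · rw [FH_ne hz]
    show 0 ≤ (fP _).im
    rw [fP_im]
    exact mul_nonneg (Real.exp_pos _).le (Real.cos_nonneg_of_mem_Icc (fa_mem hi))

section
variable {G G' : ℝ → ℝ → ℝ} {F F' : ℝ → ℝ → ℝ → ℝ} {M M' K K' : ℝ}

theorem FH_inv (hF : IsFlow G F) (h : GoodG G M K) (hF' : IsFlow G' F') (h' : GoodG G' M' K')
    (g : ℝ ≃o ℝ) {z : ℂ} (hi : z ∈ UH) : FH F' F g.symm (FH F F' g z) = z := by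
  by_cases hz : z = 0
  · subst hz; rw [FH_zero, FH_zero]
  · rw [FH_ne (FH_ne_zero hz), FH_fa hz hi, FH_fb hz, hF'.inv h', OrderIso.symm_apply_apply,
      hF.inv h, fP_fa hz]

theorem FH_bound (hF : IsFlow G F) (h : GoodG G M K) (hF' : IsFlow G' F') (h' : GoodG G' M' K')
    (g : ℝ ≃o ℝ) {z : ℂ} (hz : z ≠ 0) (hi : z ∈ UH) :
    ‖FH F F' g z‖ ≤ Real.exp (g (Real.log ‖z‖ + M * Real.pi) + M' * Real.pi) := by
  rw [FH_ne hz, fP_norm]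
  apply Real.exp_le_exp.mpr
  simp only
  have hm := fa_mem hi
  have hab : |fa z - -(Real.pi / 2)| ≤ Real.pi := by
    rw [abs_le]; constructor <;> linarith [hm.1, hm.2, Real.pi_pos]
  have h1 := hF.speed h (-(Real.pi / 2)) (fa z) (fa z) (fb z)
  rw [hF.init, abs_sub_comm (-(Real.pi / 2))] at h1
  have h1' := h1.trans (mul_le_mul_of_nonneg_left hab h.M_nonneg)
  have h2 := hF'.speed h' (fa z) (-(Real.pi / 2)) (-(Real.pi / 2))
    (g (F (-(Real.pi / 2)) (fa z) (fb z)))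
  rw [hF'.init] at h2
  have h2' := h2.trans (mul_le_mul_of_nonneg_left hab h'.M_nonneg)
  have h3 := (abs_le.mp h1').2
  have h4 := (abs_le.mp h2').2
  rw [fb_eq] at h3
  have h5 : g (F (-(Real.pi / 2)) (fa z) (fb z)) ≤ g (Real.log ‖z‖ + M * Real.pi) :=
    g.monotone (by rw [fb_eq]; linarith)
  linarith

theorem focus_UE {X X' : ℂ → ℂ} {r r' c₀ C₁ c₀' C₁' : ℝ} {A A' : ℝ → ℝ → ℝ} (hr : 0 < r)
    (hr' : 0 < r')
    (hc : Chart X (fD r) fa fb fP A G c₀ C₁ M K) (hc' : Chart X' (fD r') fa fb fP A' G' c₀' C₁' M' K')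
    (hF : IsFlow G F) (hF' : IsFlow G' F') {B B' : ℝ} (hB : ∀ z, ‖z‖ ≤ r → ‖X z‖ ≤ B * ‖z‖)
    (hB' : ∀ z, ‖z‖ ≤ r' → ‖X' z‖ ≤ B' * ‖z‖) (g : ℝ ≃o ℝ) : UE X X' UH (FH F F' g) := by
  have h := hc.good
  have h' := hc'.good
  have hX0 : X 0 = 0 := by simpa using hB 0 (by simpa using hr.le)
  have hX0' : X' 0 = 0 := by simpa using hB' 0 (by simpa using hr'.le)
  have hcont : ContinuousOn (FH F F' g) UH := by
    intro z hz
    by_cases hz0 : z = 0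
    · subst hz0
      rw [ContinuousWithinAt, FH_zero, Metric.tendsto_nhdsWithin_nhds]
      intro ε hε
      refine ⟨Real.exp (g.symm (Real.log ε - M' * Real.pi) - M * Real.pi), Real.exp_pos _,
        fun z hz hzd => ?_⟩
      rw [dist_zero_right] at hzd ⊢
      by_cases hz0 : z = 0
      · subst hz0; rw [FH_zero]; simpa using hε
      · refine (FH_bound hF h hF' h' g hz0 hz).trans_lt ?_
        rw [← Real.exp_log hε]
        apply Real.exp_lt_exp.mpr
        have h1 : Real.log ‖z‖ < g.symm (Real.log ε - M' * Real.pi) - M * Real.pi := by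
          rw [Real.log_lt_iff_lt_exp (norm_pos_iff.mpr hz0)]; exact hzd
        have h2 : g (Real.log ‖z‖ + M * Real.pi) < Real.log ε - M' * Real.pi := by
          rw [← g.lt_symm_apply]; linarith
        linarith
    · have hev : FH F F' g =ᶠ[nhds z] fun z =>
          fP (fa z, F' (fa z) (-(Real.pi / 2)) (g (F (-(Real.pi / 2)) (fa z) (fb z)))) := by
        filter_upwards [isOpen_ne.mem_nhds hz0] with q hq using FH_ne hq
      apply ContinuousAt.continuousWithinAt
      apply ContinuousAt.congr _ hev.symm
      have h1 : ContinuousAt fa z := (fa_fderiv hz0 hz).continuousAt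
      have h2 : ContinuousAt fb z := (fb_fderiv hz0 hz).continuousAt
      have h3 : ContinuousAt (fun z => F (-(Real.pi / 2)) (fa z) (fb z)) z :=
        ContinuousAt.comp (f := fun z => (-(Real.pi / 2), fa z, fb z))
          (hF.cont h).continuousAt (continuousAt_const.prodMk (h1.prodMk h2))
      have h4 : ContinuousAt (fun z => g (F (-(Real.pi / 2)) (fa z) (fb z))) z :=
        ContinuousAt.comp (g := g) g.continuous.continuousAt h3
      have h5 : ContinuousAt (fun z => F' (fa z) (-(Real.pi / 2))
          (g (F (-(Real.pi / 2)) (fa z) (fb z)))) z :=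
        ContinuousAt.comp
          (f := fun z => (fa z, -(Real.pi / 2), g (F (-(Real.pi / 2)) (fa z) (fb z))))
          (hF'.cont h').continuousAt (h1.prodMk (continuousAt_const.prodMk h4))
      exact ContinuousAt.comp (g := fP) fP_cont.continuousAt (h1.prodMk h5)
  refine ⟨FH_zero _ _ _, hcont, ⟨fun z hz => FH_maps hz, ?_, ?_⟩, ?_, ?_⟩
  · intro z hz w hw hzw
    rw [← FH_inv hF h hF' h' g hz, hzw, FH_inv hF h hF' h' g hw]
  · intro z hz
    exact ⟨FH F' F g.symm z, FH_maps hz, by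
      have := FH_inv hF' h' hF h g.symm hz; simpa using this⟩
  · intro R
    refine ⟨Real.exp (g.symm (Real.log (max R 1) + M' * Real.pi) + M * Real.pi), fun z hz hzR => ?_⟩
    by_cases hz0 : z = 0
    · subst hz0; simpa using (Real.exp_pos _).le
    · have := FH_bound hF' h' hF h g.symm (FH_ne_zero (F := F) (F' := F') (g := g) hz0) (FH_maps hz)
      rw [FH_inv hF h hF' h' g hz] at this
      refine this.trans (Real.exp_le_exp.mpr ?_)
      have h1 : Real.log ‖FH F F' g z‖ ≤ Real.log (max R 1) :=
        Real.log_le_log (norm_pos_iff.mpr (FH_ne_zero hz0)) (hzR.trans (le_max_left _ _))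
      have h2 := g.symm.monotone (add_le_add_left h1 (M' * Real.pi))
      linarith
  · refine ⟨min r r', lt_min hr hr', fun γ I hI hγ hW => ?_⟩
    have hγr : ∀ t ∈ I, ‖γ t‖ ≤ r := fun t ht => (hW t ht).2.1.trans (min_le_left _ _)
    have hγr' : ∀ t ∈ I, ‖FH F F' g (γ t)‖ ≤ r' := fun t ht => (hW t ht).2.2.trans (min_le_right _ _)
    by_cases hz : ∃ t₀ ∈ I, γ t₀ = 0
    · obtain ⟨t₀, ht₀, h0⟩ := hz
      constructor
      · intro hoc
        have := OC.eq_zero (W := Metric.closedBall 0 r) (K := B)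
          (fun p hp => hB p (by simpa using hp)) hoc (fun t ht => by simpa using hγr t ht) ht₀ h0
        exact OC.zero hX0' hI (fun t ht => by rw [this t ht, FH_zero])
      · intro hoc
        have := OC.eq_zero (W := Metric.closedBall 0 r') (K := B')
          (fun p hp => hB' p (by simpa using hp)) hoc (fun t ht => by simpa using hγr' t ht) ht₀
          (by simp only [h0, FH_zero])
        exact OC.zero hX0 hI (fun t ht => by
          by_contra hne; exact FH_ne_zero hne (this t ht))
    · push Not at hz
      rw [hc.iff hF (-(Real.pi / 2)) hI hγ (fun t ht => ⟨hz t ht, (hW t ht).1, hγr t ht⟩),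
        hc'.iff hF' (c := fun t => FH F F' g (γ t)) (-(Real.pi / 2)) hI (hcont.comp hγ (fun t ht => (hW t ht).1))
        (fun t ht => ⟨FH_ne_zero (hz t ht), FH_maps (hW t ht).1, hγr' t ht⟩)]
      have e1 : ∀ t ∈ I, fa (FH F F' g (γ t)) = fa (γ t) := fun t ht =>
        FH_fa (hz t ht) (hW t ht).1
      have e2 : ∀ t ∈ I, F' (-(Real.pi / 2)) (fa (FH F F' g (γ t))) (fb (FH F F' g (γ t))) =
          g (F (-(Real.pi / 2)) (fa (γ t)) (fb (γ t))) := fun t ht => by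
        rw [e1 t ht, FH_fb (hz t ht), hF'.inv h']
      apply and_congr
      · refine forall₂_congr fun t ht => forall₂_congr fun t' ht' => ?_
        rw [e2 t ht, e2 t' ht', g.injective.eq_iff]
      · constructor
        · intro hm t ht t' ht' htt
          simp only [e1 t ht, e1 t' ht']; exact hm ht ht' htt
        · intro hm t ht t' ht' htt
          have := hm ht ht' htt
          simp only [e1 t ht, e1 t' ht'] at this; exact this

theorem fa_pos {x : ℝ} (hx : 0 < x) : fa (x : ℂ) = -(Real.pi / 2) := by
  have : (x : ℂ) = fP (-(Real.pi / 2), Real.log x) := by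
    apply Complex.ext
    · rw [fP_re]; simp [Real.exp_log hx]
    · rw [fP_im]; simp
  rw [this, fa_fP] <;> simp only <;> linarith [Real.pi_pos]

theorem fa_neg {x : ℝ} (hx : x < 0) : fa (x : ℂ) = Real.pi / 2 := by
  have : (x : ℂ) = fP (Real.pi / 2, Real.log (-x)) := by
    apply Complex.ext
    · rw [fP_re]; simp [Real.exp_log_eq_abs hx.ne, abs_of_neg hx]
    · rw [fP_im]; simp
  rw [this, fa_fP] <;> simp only <;> linarith [Real.pi_pos]

theorem halfMap (hF : IsFlow G F) (h : GoodG G M K) :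
    ∃ P : ℝ ≃o ℝ, (∀ s, P s = F (Real.pi / 2) (-(Real.pi / 2)) s) ∧
      ∀ s, P.symm s = F (-(Real.pi / 2)) (Real.pi / 2) s := by
  have hs : Function.Surjective (F (Real.pi / 2) (-(Real.pi / 2))) := fun y =>
    ⟨F (-(Real.pi / 2)) (Real.pi / 2) y, hF.inv h _ _ _⟩
  refine ⟨StrictMono.orderIsoOfSurjective _ (hF.mono h _ _) hs, fun s => rfl, fun s => ?_⟩
  rw [OrderIso.symm_apply_eq]
  exact (hF.inv h (-(Real.pi / 2)) (Real.pi / 2) s).symm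

theorem halfMap_disp (hF : IsFlow G F) {ρ ε : ℝ} (hG : ∀ t x, |G t x - ρ| ≤ ε) (s : ℝ) :
    |F (Real.pi / 2) (-(Real.pi / 2)) s - s - Real.pi * ρ| ≤ ε * Real.pi := by
  have := convex_univ.norm_image_sub_le_of_norm_hasDerivWithin_le
    (f := fun t => F t (-(Real.pi / 2)) s - t * ρ)
    (f' := fun t => G t (F t (-(Real.pi / 2)) s) - 1 * ρ) (C := ε)
    (fun u _ => ((hF.deriv u (-(Real.pi / 2)) s).sub
      ((hasDerivAt_id u).mul_const ρ)).hasDerivWithinAt)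
    (fun u _ => by rw [one_mul]; exact hG _ _)
    (mem_univ (-(Real.pi / 2))) (mem_univ (Real.pi / 2))
  rw [hF.init, Real.norm_eq_abs, Real.norm_eq_abs] at this
  have e : Real.pi / 2 - -(Real.pi / 2) = Real.pi := by ring
  rw [e, abs_of_pos Real.pi_pos] at this
  have e2 : F (Real.pi / 2) (-(Real.pi / 2)) s - s - Real.pi * ρ =
    F (Real.pi / 2) (-(Real.pi / 2)) s - Real.pi / 2 * ρ - (s - -(Real.pi / 2) * ρ) := by ring
  rw [e2]; exact this

theorem FH_bdry (hF : IsFlow G F) (hF' : IsFlow G' F') (P P' g : ℝ ≃o ℝ)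
    (hP : ∀ s, P.symm s = F (-(Real.pi / 2)) (Real.pi / 2) s)
    (hP' : ∀ s, P' s = F' (Real.pi / 2) (-(Real.pi / 2)) s) (x : ℝ) :
    FH F F' g (x : ℂ) = (hS g ((P.symm.trans g).trans P') x : ℝ) := by
  rcases lt_trichotomy x 0 with hx | hx | hx
  · rw [FH_ne (by exact_mod_cast hx.ne), fa_neg hx, fb_eq, hS_neg hx, ← hP, ← hP']
    rw [Complex.norm_real, Real.norm_eq_abs, abs_of_neg hx]
    apply Complex.ext
    · rw [fP_re, Complex.ofReal_re]; simp
    · rw [fP_im]; simp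
  · subst hx; simp [hS_zero, FH_zero]
  · rw [FH_ne (by exact_mod_cast hx.ne'), fa_pos hx, fb_eq, hS_pos hx, hF.init, hF'.init]
    rw [Complex.norm_real, Real.norm_eq_abs, abs_of_pos hx]
    apply Complex.ext
    · rw [fP_re, Complex.ofReal_re]; simp
    · rw [fP_im]; simp
end


/-! ### M9: the non-focus half-plane equivalence -/

theorem deriv_pos_left {φ : ℝ → ℝ} {c s : ℝ} (h : HasDerivAt φ c s) (hc : 0 < c) (h0 : φ s = 0)
    {a : ℝ} (ha : a < s) : ∃ x, a < x ∧ x < s ∧ φ x < 0 := by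
  have h1 : Tendsto (slope φ s) (nhdsWithin s (Iio s)) (nhds c) :=
    (hasDerivAt_iff_tendsto_slope.mp h).mono_left
      (nhdsWithin_mono _ (fun x hx => ne_of_lt hx))
  have h2 : ∀ᶠ x in nhdsWithin s (Iio s), 0 < slope φ s x := h1.eventually (lt_mem_nhds hc)
  have h3 : ∀ᶠ x in nhdsWithin s (Iio s), a < x :=
    nhdsWithin_le_nhds (lt_mem_nhds ha)
  obtain ⟨x, hx1, hx2, hx3⟩ := (h2.and (h3.and self_mem_nhdsWithin)).exists
  refine ⟨x, hx2, hx3, ?_⟩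
  rw [slope_def_field, h0, sub_zero] at hx1
  have : x - s < 0 := sub_neg.mpr hx3
  by_contra hcon
  push Not at hcon
  have := div_nonpos_of_nonneg_of_nonpos hcon this.le
  linarith

theorem pos_after {φ φ' : ℝ → ℝ} {J : Set ℝ} (hJ : J.OrdConnected)
    (hd : ∀ s ∈ J, HasDerivAt φ (φ' s) s) (hz : ∀ s ∈ J, φ s = 0 → 0 < φ' s) {s₀ s : ℝ}
    (hs₀ : s₀ ∈ J) (hs : s ∈ J) (hlt : s₀ < s) (h0 : 0 ≤ φ s₀) : 0 < φ s := by
  have hsub : Icc s₀ s ⊆ J := hJ.out hs₀ hs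
  have hnn : ∀ x ∈ Icc s₀ s, 0 ≤ φ x := by
    intro x hx
    have := image_le_of_deriv_right_lt_deriv_boundary (f := fun x => - φ x) (f' := fun x => - φ' x)
      (a := s₀) (b := s) (B := fun _ => 0) (B' := fun _ => 0)
      (fun x hx => (hd x (hsub hx)).neg.continuousAt.continuousWithinAt)
      (fun x hx => (hd x (hsub ⟨hx.1, hx.2.le⟩)).neg.hasDerivWithinAt) (by simpa using h0)
      (fun x => hasDerivAt_const x 0)
      (fun x hx hfx => by
        have := hz x (hsub ⟨hx.1, hx.2.le⟩) (by simpa using hfx)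
        linarith) hx
    simpa using this
  rcases (hnn s ⟨hlt.le, le_refl s⟩).eq_or_lt with h | h
  · obtain ⟨x, hx1, hx2, hx3⟩ := deriv_pos_left (hd s hs) (hz s hs h.symm) h.symm hlt
    have := hnn x ⟨hx1.le, hx2.le⟩
    linarith
  · exact h

/-- the diagonal is crossed upwards -/
theorem cross_radius {X : ℝ × ℝ → ℝ × ℝ} {l m : ℝ} (hX : HasStrictFDerivAt X (dg l m) 0)
    (h0 : X 0 = 0) (hlm : m < l) : ∃ r > 0, ∀ p : ℝ × ℝ, ‖p‖ ≤ r → p ≠ 0 → 0 ≤ p.1 + p.2 →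
      p.1 - p.2 = 0 → 0 < (X p).1 - (X p).2 := by
  have hη : 0 < (l - m) / 4 := by linarith
  obtain ⟨r, hr, -, hb⟩ := remainder_exists hX h0 hη
  refine ⟨r, hr, fun p hp hp0 hS hf => ?_⟩
  have h1 := hb p hp
  have e : p.2 = p.1 := by linarith
  have hpc : p ∈ cone := by
    show |p.2| ≤ p.1
    rw [e, abs_of_nonneg (by linarith)]
  have hpos := cone_pos hpc hp0
  rw [cone_norm hpc] at h1
  have h2 := (norm_fst_le _).trans h1
  have h3 := (norm_snd_le _).trans h1
  rw [dg_apply, Real.norm_eq_abs] at h2 h3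
  simp only [Prod.fst_sub, Prod.snd_sub, e] at h2 h3
  have h2' := (abs_le.mp h2).1
  have h3' := (abs_le.mp h3).2
  nlinarith

theorem OC.pos_after {X : ℝ × ℝ → ℝ × ℝ} {W : Set (ℝ × ℝ)} {f : ℝ × ℝ →L[ℝ] ℝ}
    (hz : ∀ p ∈ W, f p = 0 → 0 < f (X p)) {γ : ℝ → ℝ × ℝ} {I : Set ℝ}
    (h : OC X γ I) (hW : ∀ t ∈ I, γ t ∈ W) {t₀ t : ℝ} (ht₀ : t₀ ∈ I) (ht : t ∈ I) (hlt : t₀ < t)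
    (h0 : 0 ≤ f (γ t₀)) : 0 < f (γ t) := by
  obtain ⟨δ, J, τ, h1, h2, h3, h4, h5, h6⟩ := h
  have hδ : ∀ s ∈ J, δ s ∈ W := fun s hs => by
    obtain ⟨t, ht, rfl⟩ := h3.surjOn hs
    rw [← h6 t ht]; exact hW t ht
  have := _root_.pos_after (φ := fun s => f (δ s)) (φ' := fun s => f (X (δ s))) h1
    (fun s hs => f.hasFDerivAt.comp_hasDerivAt s (h2 s hs))
    (fun s hs h => hz _ (hδ s hs) h) (h3.mapsTo ht₀) (h3.mapsTo ht) (h4 ht₀ ht hlt)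
    (by rw [← h6 _ ht₀]; exact h0)
  rw [h6 t ht]; exact this

def Split (φ : ℝ → ℝ) (I : Set ℝ) : Prop :=
  (∃ t₀ ∈ I, ∀ t ∈ I, (t ≤ t₀ → φ t ≤ 0) ∧ (t₀ ≤ t → 0 ≤ φ t)) ∨ (∀ t ∈ I, 0 ≤ φ t) ∨
    (∀ t ∈ I, φ t ≤ 0)

theorem split_of {φ : ℝ → ℝ} {I : Set ℝ} (hI : I.OrdConnected) (hc : ContinuousOn φ I)
    (h : ∀ t₀ ∈ I, ∀ t ∈ I, t₀ < t → 0 ≤ φ t₀ → 0 < φ t) : Split φ I := by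
  by_cases hz : ∃ t₀ ∈ I, φ t₀ = 0
  · obtain ⟨t₀, ht₀, h0⟩ := hz
    refine Or.inl ⟨t₀, ht₀, fun t ht => ⟨fun htt => ?_, fun htt => ?_⟩⟩
    · rcases htt.eq_or_lt with e | e
      · rw [e, h0]
      · by_contra hcon
        push Not at hcon
        have := h t ht t₀ ht₀ e hcon.le
        linarith
    · rcases htt.eq_or_lt with e | e
      · rw [← e, h0]
      · exact (h t₀ ht₀ t ht e h0.ge).le
  · push Not at hz
    right
    by_contra hcon
    push Not at hcon
    obtain ⟨⟨t, ht, h1⟩, t', ht', h2⟩ := hcon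
    have : (φ '' I).OrdConnected := ordConnected_image hI hc
    obtain ⟨t₀, ht₀, h0⟩ := this.out ⟨t, ht, rfl⟩ ⟨t', ht', rfl⟩ ⟨h1.le, h2.le⟩
    exact hz t₀ ht₀ h0

abbrev sw : (ℝ × ℝ) ≃L[ℝ] (ℝ × ℝ) := ContinuousLinearEquiv.prodComm ℝ ℝ ℝ

theorem sw_apply (p : ℝ × ℝ) : sw p = (p.2, p.1) := rfl
theorem sw_sw (p : ℝ × ℝ) : sw (sw p) = p := rfl
theorem sw_norm (p : ℝ × ℝ) : ‖sw p‖ = ‖p‖ := by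
  rw [Prod.norm_def, Prod.norm_def, max_comm]; rfl

def Xsw (X : ℝ × ℝ → ℝ × ℝ) (p : ℝ × ℝ) : ℝ × ℝ := - sw (X (sw p))

theorem OC.sw_iff {X : ℝ × ℝ → ℝ × ℝ} {γ : ℝ → ℝ × ℝ} {I : Set ℝ} :
    OC (Xsw X) (fun t => sw (γ (-t))) (-I) ↔ OC X γ I := by
  have h1 := OC.neg_iff (X := fun p => sw (X (sw p))) (c := fun t => sw (γ t)) (I := I)
  have h2 := OC.conj_iff sw (X := X) (X' := fun p => sw (X (sw p))) (c := γ) (I := I)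
    (fun p => by simp only [sw_sw])
  exact h1.trans h2

theorem Xsw_deriv {X : ℝ × ℝ → ℝ × ℝ} {l m : ℝ} (hX : HasStrictFDerivAt X (dg l m) 0) :
    HasStrictFDerivAt (Xsw X) (dg (-m) (-l)) 0 := by
  have h1 : HasStrictFDerivAt (fun p => sw p) (sw : ℝ × ℝ →L[ℝ] ℝ × ℝ) (0 : ℝ × ℝ) :=
    sw.hasStrictFDerivAt
  have hX' : HasStrictFDerivAt X (dg l m) (sw (0 : ℝ × ℝ)) := hX
  have h2 : HasStrictFDerivAt (fun p => sw p) (sw : ℝ × ℝ →L[ℝ] ℝ × ℝ) (X (sw (0 : ℝ × ℝ))) :=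
    sw.hasStrictFDerivAt
  have h4 := hX'.comp (0 : ℝ × ℝ) h1
  have h3 := (HasStrictFDerivAt.comp (f := fun x => X (sw x)) (g := fun p => sw p)
    (0 : ℝ × ℝ) h2 h4).neg
  refine h3.congr_fderiv ?_
  ext p <;> simp [dg_apply]

def cone2 : Set (ℝ × ℝ) := {p | |p.1| ≤ p.2}
def HP : Set (ℝ × ℝ) := {p | 0 ≤ p.1 + p.2}

theorem mem_cone_iff {p : ℝ × ℝ} : p ∈ cone ↔ p ∈ HP ∧ 0 ≤ p.1 - p.2 := by
  simp only [cone, HP, mem_setOf_eq, abs_le]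
  constructor
  · rintro ⟨h1, h2⟩; constructor <;> linarith
  · rintro ⟨h1, h2⟩; constructor <;> linarith

theorem mem_cone2_iff {p : ℝ × ℝ} : p ∈ cone2 ↔ p ∈ HP ∧ p.1 - p.2 ≤ 0 := by
  simp only [cone2, HP, mem_setOf_eq, abs_le]
  constructor
  · rintro ⟨h1, h2⟩; constructor <;> linarith
  · rintro ⟨h1, h2⟩; constructor <;> linarith

theorem HP_eq : HP = cone ∪ cone2 := by
  ext p
  rw [mem_union, mem_cone_iff, mem_cone2_iff]
  constructor
  · intro h
    rcases le_total 0 (p.1 - p.2) with h' | h'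
    · exact Or.inl ⟨h, h'⟩
    · exact Or.inr ⟨h, h'⟩
  · rintro (h | h) <;> exact h.1

theorem cone_closed : IsClosed cone :=
  isClosed_le (continuous_snd.abs) continuous_fst
theorem cone2_closed : IsClosed cone2 :=
  isClosed_le (continuous_fst.abs) continuous_snd

theorem saddle_UE {X X' : ℝ × ℝ → ℝ × ℝ} {l m l' m' : ℝ} (hX : HasStrictFDerivAt X (dg l m) 0)
    (h0 : X 0 = 0) (hX' : HasStrictFDerivAt X' (dg l' m') 0) (h0' : X' 0 = 0) (hlm : m < l)
    (hlm' : m' < l') (hll : 0 < l * l') (hmm : 0 < m * m') (gp gm : ℝ ≃o ℝ) {C : ℝ} (hC : 0 < C)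
    (hgp : ∀ ρ, |gp ρ - ρ| ≤ C) (hgm : ∀ ρ, |gm ρ - ρ| ≤ C) :
    ∃ H, UE X X' HP H ∧ ∀ u, H (u, -u) = (hS gp gm u, - hS gp gm u) := by
  obtain ⟨r₁, hr₁, H₁, c1, b1, d1, e1, n1, o1⟩ :=
    cone_lemma hX h0 hX' h0' hlm hlm' hll gp hC hgp
  obtain ⟨r₂, hr₂, H₂, c2, b2, d2, e2, n2, o2⟩ :=
    cone_lemma (Xsw_deriv hX) (by simp [Xsw, h0]) (Xsw_deriv hX') (by simp [Xsw, h0'])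
      (by linarith) (by linarith) (by linarith : 0 < -m * -m') gm hC hgm
  obtain ⟨r₃, hr₃, k3⟩ := cross_radius hX h0 hlm
  obtain ⟨r₄, hr₄, k4⟩ := cross_radius hX' h0' hlm'
  obtain ⟨r₅, hr₅, -, k5⟩ := remainder_exists hX h0 one_pos
  obtain ⟨r₆, hr₆, -, k6⟩ := remainder_exists hX' h0' one_pos
  set H : ℝ × ℝ → ℝ × ℝ := fun p => if p.2 ≤ p.1 then H₁ p else sw (H₂ (sw p)) with hH
  have hsw : ∀ p, p ∈ cone2 ↔ sw p ∈ cone := fun p => Iff.rfl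
  have hA : ∀ p ∈ cone, H p = H₁ p := fun p hp =>
    if_pos (by have := (mem_cone_iff.mp hp).2; linarith)
  have hB : ∀ p ∈ cone2, H p = sw (H₂ (sw p)) := fun p hp => by
    have h1 := (mem_cone2_iff.mp hp)
    rcases h1.2.eq_or_lt with h | h
    · have h2 : p.2 = p.1 := by linarith
      have h3 : p = (p.1, p.1) := Prod.ext rfl h2
      have h4 : 0 ≤ p.1 := by have := h1.1; simp only [HP, mem_setOf_eq] at this; linarith
      have : H p = H₁ p := if_pos h2.le
      have h5 : sw ((p.1, p.1) : ℝ × ℝ) = (p.1, p.1) := rfl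
      rw [this, h3, d1 _ h4, h5, d2 _ h4]; rfl
    · exact if_neg (by linarith)
  have hz : H 0 = 0 := by
    rw [hA 0 (by simp [cone])]; exact d1 0 le_rfl
  have bA : BijOn H cone cone := b1.congr (fun p hp => (hA p hp).symm)
  have bB : BijOn H cone2 cone2 := by
    have hs : BijOn (fun p => sw p) cone2 cone := ⟨fun p hp => hp, sw.injective.injOn,
      fun p hp => ⟨sw p, hp, sw_sw p⟩⟩
    have hs' : BijOn (fun p => sw p) cone cone2 := ⟨fun p hp => hp, sw.injective.injOn,
      fun p hp => ⟨sw p, hp, sw_sw p⟩⟩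
    exact (hs'.comp (b2.comp hs)).congr (fun p hp => (hB p hp).symm)
  have hdiag : ∀ p ∈ HP, H p ∈ cone → H p ∈ cone2 → H p = p := by
    intro p hp h1 h2
    have h3 : (H p).2 = (H p).1 := by
      have := (mem_cone_iff.mp h1).2
      have := (mem_cone2_iff.mp h2).2
      linarith
    have h4 : 0 ≤ (H p).1 := (abs_nonneg _).trans h1
    have h5 : H p = ((H p).1, (H p).1) := Prod.ext rfl h3
    have hm : H p ∈ cone ∧ H p ∈ cone2 := ⟨h1, h2⟩
    have h6 : H (H p) = H p := by
      rw [hA _ h1]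
      conv_lhs => rw [h5, d1 _ h4]
      exact h5.symm
    rw [HP_eq] at hp
    rcases hp with hp | hp
    · exact bA.injOn h1 hp h6
    · exact bB.injOn h2 hp h6
  have bH : BijOn H HP HP := by
    rw [HP_eq]
    refine bA.union bB ?_
    rintro p (hp | hp) q (hq | hq) hpq
    · exact bA.injOn hp hq hpq
    · have h1 := bA.mapsTo hp
      have h2 := bB.mapsTo hq
      have h3 := hdiag p (by rw [HP_eq]; exact Or.inl hp) h1 (hpq ▸ h2)
      have h4 := hdiag q (by rw [HP_eq]; exact Or.inr hq) (hpq ▸ h1) h2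
      rw [← h3, ← h4, hpq]
    · have h1 := bB.mapsTo hp
      have h2 := bA.mapsTo hq
      have h3 := hdiag p (by rw [HP_eq]; exact Or.inr hp) (hpq ▸ h2) h1
      have h4 := hdiag q (by rw [HP_eq]; exact Or.inl hq) h2 (hpq ▸ h1)
      rw [← h3, ← h4, hpq]
    · exact bB.injOn hp hq hpq
  have cH : ContinuousOn H HP := by
    rw [HP_eq]
    apply ContinuousOn.union_of_isClosed _ _ cone_closed cone2_closed
    · exact c1.congr hA
    · have : ContinuousOn (fun p => sw (H₂ (sw p))) cone2 :=
        sw.continuous.comp_continuousOn (c2.comp sw.continuous.continuousOn (fun p hp => hp))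
      exact this.congr hB
  have nH : ∀ p ∈ HP, Real.exp (-C) * ‖p‖ ≤ ‖H p‖ := by
    intro p hp
    rw [HP_eq] at hp
    rcases hp with hp | hp
    · rw [hA p hp]; exact (n1 p hp).1
    · rw [hB p hp, sw_norm, ← sw_norm p]; exact (n2 (sw p) hp).1
  have hne : ∀ p ∈ HP, p ≠ 0 → H p ≠ 0 := fun p hp hp0 h => by
    have := nH p hp
    rw [h, norm_zero] at this
    have h2 : 0 < Real.exp (-C) * ‖p‖ := mul_pos (Real.exp_pos _) (norm_pos_iff.mpr hp0)
    linarith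
  set f : ℝ × ℝ →L[ℝ] ℝ := ContinuousLinearMap.fst ℝ ℝ ℝ - ContinuousLinearMap.snd ℝ ℝ ℝ with hf
  have hfa : ∀ p, f p = p.1 - p.2 := fun p => rfl
  refine ⟨H, ⟨hz, cH, bH, ?_, ?_⟩, ?_⟩
  · intro R
    refine ⟨Real.exp C * R, fun p hp hpR => ?_⟩
    have h1 := (nH p hp).trans hpR
    rw [Real.exp_neg, inv_mul_le_iff₀ (Real.exp_pos _)] at h1
    exact h1
  · set r := min (min r₁ r₂) (min (min r₃ r₄) (min r₅ r₆)) with hr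
    have hrpos : 0 < r := lt_min (lt_min hr₁ hr₂) (lt_min (lt_min hr₃ hr₄) (lt_min hr₅ hr₆))
    have q1 : r ≤ r₁ := (min_le_left _ _).trans (min_le_left _ _)
    have q2 : r ≤ r₂ := (min_le_left _ _).trans (min_le_right _ _)
    have q3 : r ≤ r₃ := (min_le_right _ _).trans ((min_le_left _ _).trans (min_le_left _ _))
    have q4 : r ≤ r₄ := (min_le_right _ _).trans ((min_le_left _ _).trans (min_le_right _ _))
    have q5 : r ≤ r₅ := (min_le_right _ _).trans ((min_le_right _ _).trans (min_le_left _ _))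
    have q6 : r ≤ r₆ := (min_le_right _ _).trans ((min_le_right _ _).trans (min_le_right _ _))
    refine ⟨r, hrpos, fun γ I hI hγ hW => ?_⟩
    have hlin : ∀ (X : ℝ × ℝ → ℝ × ℝ) (l m ρ : ℝ), (∀ p, ‖p‖ ≤ ρ → ‖X p - dg l m p‖ ≤ 1 * ‖p‖) →
        ∀ p, ‖p‖ ≤ ρ → ‖X p‖ ≤ (1 + ‖dg l m‖) * ‖p‖ := by
      intro X l m ρ h p hp
      have h1 := h p hp
      have h2 := (dg l m).le_opNorm p
      have h3 := norm_add_le (X p - dg l m p) (dg l m p)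
      rw [sub_add_cancel] at h3
      linarith
    by_cases hzz : ∃ t₀ ∈ I, γ t₀ = 0
    · obtain ⟨t₀, ht₀, hγ0⟩ := hzz
      constructor
      · intro hoc
        have := OC.eq_zero (W := Metric.closedBall 0 r₅) (K := 1 + ‖dg l m‖)
          (fun p hp => hlin X l m r₅ k5 p (by simpa using hp)) hoc
          (fun t ht => by simpa using (hW t ht).2.1.trans q5) ht₀ hγ0
        exact OC.zero h0' hI (fun t ht => by rw [this t ht, hz])
      · intro hoc
        have := OC.eq_zero (W := Metric.closedBall 0 r₆) (K := 1 + ‖dg l' m'‖)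
          (fun p hp => hlin X' l' m' r₆ k6 p (by simpa using hp)) hoc
          (fun t ht => by simpa using (hW t ht).2.2.trans q6) ht₀ (by simp only [hγ0, hz])
        exact OC.zero h0 hI (fun t ht => by
          by_contra hne'; exact hne _ (hW t ht).1 hne' (this t ht))
    push Not at hzz
    have hHγ : ContinuousOn (fun t => H (γ t)) I := cH.comp hγ (fun t ht => (hW t ht).1)
    -- the two cones
    have K1 : ∀ I' ⊆ I, I'.OrdConnected → (∀ t ∈ I', 0 ≤ f (γ t)) →
        (OC X γ I' ↔ OC X' (fun t => H (γ t)) I') := by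
      intro I' hs hI' hfp
      have hc : ∀ t ∈ I', γ t ∈ cone := fun t ht => mem_cone_iff.mpr ⟨(hW t (hs ht)).1, hfp t ht⟩
      rw [o1 γ I' hI' (hγ.mono hs) (fun t ht => ⟨hc t ht, hzz t (hs ht),
        (hW t (hs ht)).2.1.trans q1, by
          rw [← hA _ (hc t ht)]; exact (hW t (hs ht)).2.2.trans q1⟩)]
      exact ⟨fun h => h.congr (fun t ht => hA _ (hc t ht)),
        fun h => h.congr (fun t ht => (hA _ (hc t ht)).symm)⟩
    have K2 : ∀ I' ⊆ I, I'.OrdConnected → (∀ t ∈ I', f (γ t) ≤ 0) →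
        (OC X γ I' ↔ OC X' (fun t => H (γ t)) I') := by
      intro I' hs hI' hfp
      have hc : ∀ t ∈ I', γ t ∈ cone2 := fun t ht => mem_cone2_iff.mpr ⟨(hW t (hs ht)).1, hfp t ht⟩
      have hnI : (-I').OrdConnected := ⟨fun x hx y hy z hz => hI'.out hy hx
        ⟨by simpa using hz.2, by simpa using hz.1⟩⟩
      have hcn : ContinuousOn (fun t => sw (γ (-t))) (-I') :=
        sw.continuous.comp_continuousOn ((hγ.mono hs).comp continuous_neg.continuousOn
          (fun t ht => ht))
      have h1 := o2 (fun t => sw (γ (-t))) (-I') hnI hcn (fun t ht => by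
        have ht' : -t ∈ I' := ht
        refine ⟨hc _ ht', ?_, ?_, ?_⟩
        · intro h
          apply hzz _ (hs ht')
          have := congrArg sw h
          rw [sw_sw] at this
          simpa using this
        · rw [sw_norm]; exact (hW _ (hs ht')).2.1.trans q2
        · rw [← sw_norm, ← hB _ (hc _ ht')]; exact (hW _ (hs ht')).2.2.trans q2)
      rw [← OC.sw_iff, h1, ← OC.sw_iff (X := X')]
      have e : ∀ t ∈ -I', H₂ (sw (γ (-t))) = sw (H (γ (-t))) := fun t ht => by
        rw [hB _ (hc _ ht), sw_sw]
      exact ⟨fun h => h.congr (fun t ht => (e t ht).symm), fun h => h.congr e⟩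
    have key : Split (fun t => f (γ t)) I → (OC X γ I ↔ OC X' (fun t => H (γ t)) I) := by
      rintro (⟨t₀, ht₀, hs⟩ | hs | hs)
      · have hI1 : (I ∩ Iic t₀).OrdConnected := hI.inter ordConnected_Iic
        have hI2 : (I ∩ Ici t₀).OrdConnected := hI.inter ordConnected_Ici
        have k1 := K2 (I ∩ Iic t₀) inter_subset_left hI1 (fun t ht => (hs t ht.1).1 ht.2)
        have k2 := K1 (I ∩ Ici t₀) inter_subset_left hI2 (fun t ht => (hs t ht.1).2 ht.2)
        constructor
        · intro h
          exact OC.glue hI ht₀ (k1.mp (h.mono hI1 inter_subset_left))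
            (k2.mp (h.mono hI2 inter_subset_left))
        · intro h
          exact OC.glue hI ht₀ (k1.mpr (h.mono hI1 inter_subset_left))
            (k2.mpr (h.mono hI2 inter_subset_left))
      · exact K1 I subset_rfl hI hs
      · exact K2 I subset_rfl hI hs
    have sp1 : OC X γ I → Split (fun t => f (γ t)) I := fun h =>
      split_of hI (f.continuous.comp_continuousOn hγ) (fun t₀ ht₀ t ht hlt hp =>
        OC.pos_after (W := {p | ‖p‖ ≤ r₃ ∧ p ≠ 0 ∧ 0 ≤ p.1 + p.2}) (f := f)
          (fun p hp hfp => k3 p hp.1 hp.2.1 hp.2.2 hfp) h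
          (fun t ht => ⟨(hW t ht).2.1.trans q3, hzz t ht, (hW t ht).1⟩) ht₀ ht hlt hp)
    have sp2 : OC X' (fun t => H (γ t)) I → Split (fun t => f (H (γ t))) I := fun h =>
      split_of hI (f.continuous.comp_continuousOn hHγ) (fun t₀ ht₀ t ht hlt hp =>
        OC.pos_after (W := {p | ‖p‖ ≤ r₄ ∧ p ≠ 0 ∧ 0 ≤ p.1 + p.2}) (f := f)
          (fun p hp hfp => k4 p hp.1 hp.2.1 hp.2.2 hfp) h
          (fun t ht => ⟨(hW t ht).2.2.trans q4, hne _ (hW t ht).1 (hzz t ht),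
            bH.mapsTo (hW t ht).1⟩) ht₀ ht hlt hp)
    have f1 : ∀ t ∈ I, 0 ≤ f (H (γ t)) → 0 ≤ f (γ t) := fun t ht h => by
      have h1 : H (γ t) ∈ cone := mem_cone_iff.mpr ⟨bH.mapsTo (hW t ht).1, h⟩
      obtain ⟨q, hq, hqe⟩ := bA.surjOn h1
      have := bH.injOn (mem_cone_iff.mp hq).1 (hW t ht).1 hqe
      rw [← this]; exact (mem_cone_iff.mp hq).2
    have f2 : ∀ t ∈ I, f (H (γ t)) ≤ 0 → f (γ t) ≤ 0 := fun t ht h => by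
      have h1 : H (γ t) ∈ cone2 := mem_cone2_iff.mpr ⟨bH.mapsTo (hW t ht).1, h⟩
      obtain ⟨q, hq, hqe⟩ := bB.surjOn h1
      have := bH.injOn (mem_cone2_iff.mp hq).1 (hW t ht).1 hqe
      rw [← this]; exact (mem_cone2_iff.mp hq).2
    constructor
    · intro h; exact (key (sp1 h)).mp h
    · intro h
      refine (key ?_).mpr h
      rcases sp2 h with ⟨t₀, ht₀, hs⟩ | hs | hs
      · exact Or.inl ⟨t₀, ht₀, fun t ht => ⟨fun h => f2 t ht ((hs t ht).1 h),
          fun h => f1 t ht ((hs t ht).2 h)⟩⟩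
      · exact Or.inr (Or.inl fun t ht => f1 t ht (hs t ht))
      · exact Or.inr (Or.inr fun t ht => f2 t ht (hs t ht))
  · intro u
    rcases lt_trichotomy u 0 with h | h | h
    · have hm : ((u, -u) : ℝ × ℝ) ∈ cone2 := by
        show |u| ≤ -u
        rw [abs_of_neg h]
      rw [hB _ hm, hS_neg h, sw_apply]
      have := e2 (-u) (by linarith)
      rw [neg_neg] at this
      simp only [this, sw_apply, neg_neg]
    · subst h
      have : ((0, -0) : ℝ × ℝ) = 0 := by simp
      rw [this, hz, hS_zero, neg_zero]; rfl
    · have hm : ((u, -u) : ℝ × ℝ) ∈ cone := by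
        show |-u| ≤ u
        rw [abs_neg, abs_of_pos h]
      rw [hA _ hm, hS_pos h, e1 u h]


/-! ### M10: linear coordinates and half-plane equivalences -/

def matL (p q r s : ℝ) : ℝ × ℝ →L[ℝ] ℝ × ℝ :=
  (p • ContinuousLinearMap.fst ℝ ℝ ℝ + q • ContinuousLinearMap.snd ℝ ℝ ℝ).prod
    (r • ContinuousLinearMap.fst ℝ ℝ ℝ + s • ContinuousLinearMap.snd ℝ ℝ ℝ)

theorem matL_apply (p q r s : ℝ) (v : ℝ × ℝ) :
    matL p q r s v = (p * v.1 + q * v.2, r * v.1 + s * v.2) := rfl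

def mat (p q r s : ℝ) (h : p * s - q * r ≠ 0) : (ℝ × ℝ) ≃L[ℝ] (ℝ × ℝ) :=
  ContinuousLinearEquiv.equivOfInverse (matL p q r s)
    (matL (s / (p * s - q * r)) (-q / (p * s - q * r)) (-r / (p * s - q * r)) (p / (p * s - q * r)))
    (fun v => by
      obtain ⟨D, hD⟩ : ∃ D, D = p * s - q * r := ⟨_, rfl⟩
      rw [← hD] at h
      rw [matL_apply, matL_apply, ← hD]
      apply Prod.ext
      · simp only; field_simp; rw [hD]; ring
      · simp only; field_simp; rw [hD]; ring)
    (fun v => by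
      obtain ⟨D, hD⟩ : ∃ D, D = p * s - q * r := ⟨_, rfl⟩
      rw [← hD] at h
      rw [matL_apply, matL_apply, ← hD]
      apply Prod.ext
      · simp only; field_simp; rw [hD]; ring
      · simp only; field_simp; rw [hD]; ring)

theorem mat_apply (p q r s : ℝ) (h : p * s - q * r ≠ 0) (v : ℝ × ℝ) :
    mat p q r s h v = (p * v.1 + q * v.2, r * v.1 + s * v.2) := rfl

theorem fderiv_jac (X : ℝ × ℝ → ℝ × ℝ) (v : ℝ × ℝ) : fderiv ℝ X 0 v =
    (jac11 X * v.1 + jac12 X * v.2, jac21 X * v.1 + jac22 X * v.2) := by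
  have e : v = v.1 • ((1, 0) : ℝ × ℝ) + v.2 • ((0, 1) : ℝ × ℝ) := by
    apply Prod.ext <;> simp
  conv_lhs => rw [e, map_add, map_smul, map_smul]
  apply Prod.ext
  · simp only [jac11, jac12, Prod.fst_add, Prod.smul_fst, smul_eq_mul, Prod.mk_zero_zero]; ring
  · simp only [jac21, jac22, Prod.snd_add, Prod.smul_snd, smul_eq_mul, Prod.mk_zero_zero]; ring

theorem conj_strict {E E' : Type*} [NormedAddCommGroup E] [NormedSpace ℝ E] [NormedAddCommGroup E']
    [NormedSpace ℝ E'] {X : E → E} {L : E →L[ℝ] E} {L' : E' →L[ℝ] E'} (T : E ≃L[ℝ] E')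
    (hX : HasStrictFDerivAt X L 0) (h : ∀ p, T (L p) = L' (T p)) :
    HasStrictFDerivAt (fun q => T (X (T.symm q))) L' 0 := by
  have h1 : HasStrictFDerivAt (fun q => T.symm q) (T.symm : E' →L[ℝ] E) (0 : E') :=
    T.symm.hasStrictFDerivAt
  have hX' : HasStrictFDerivAt X L (T.symm (0 : E')) := by rw [map_zero]; exact hX
  have h2 : HasStrictFDerivAt (fun q => T q) (T : E →L[ℝ] E') (X (T.symm 0)) :=
    T.hasStrictFDerivAt
  have h4 := hX'.comp (0 : E') h1
  have h3 := HasStrictFDerivAt.comp (f := fun x => X (T.symm x)) (g := fun p => T p)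
    (0 : E') h2 h4
  refine h3.congr_fderiv ?_
  ext q
  have := h (T.symm q)
  rw [T.apply_symm_apply] at this
  exact this

/-- `discJ` is the discriminant of the characteristic polynomial. -/
def discJ (X : ℝ × ℝ → ℝ × ℝ) : ℝ := trJ X ^ 2 - 4 * detJ X

/-- standing assumptions on a half field -/
structure Fld (X : ℝ × ℝ → ℝ × ℝ) (sg : ℝ) : Prop where
  strict : HasStrictFDerivAt X (fderiv ℝ X 0) 0
  zero : X 0 = 0
  det : detJ X ≠ 0
  sg_sq : sg * sg = 1
  sg_pos : 0 < sg * jac21 X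

theorem focus_coords {X : ℝ × ℝ → ℝ × ℝ} {sg : ℝ} (hX : Fld X sg) (hd : discJ X < 0) :
    ∃ T : (ℝ × ℝ) ≃L[ℝ] ℂ, HasStrictFDerivAt (fun z => T (X (T.symm z)))
      (rot ⟨trJ X / 2, √(-discJ X) / 2⟩) 0 ∧ (∀ p : ℝ × ℝ, 0 ≤ p.2 ↔ 0 ≤ (T p).im) ∧
      ∀ x : ℝ, T (x, 0) = ((sg * x : ℝ) : ℂ) := by
  set β := √(-discJ X) / 2 with hβ
  have hβ0 : 0 < β := by have := Real.sqrt_pos.mpr (by linarith : 0 < -discJ X); linarith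
  have hβ2 : β ^ 2 = detJ X - trJ X ^ 2 / 4 := by
    have : √(-discJ X) ^ 2 = -discJ X := Real.sq_sqrt (by linarith)
    rw [hβ, div_pow, this, discJ]; ring
  set a := jac21 X with ha
  set d := jac22 X with hd'
  set α := trJ X / 2 with hα
  have hsa := hX.sg_pos
  set k := sg * a with hk
  have hs := hX.sg_sq
  have hk0 : k ≠ 0 := hsa.ne'
  have ha0 : a / k = sg := by
    rw [div_eq_iff hk0, hk, ← mul_assoc, hs, one_mul]
  have hsg : sg ≠ 0 := by rintro h; rw [h] at hs; norm_num at hs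
  have hdet : (a / k) * (β / k) - ((d - α) / k) * 0 ≠ 0 := by
    rw [ha0, mul_zero, sub_zero]
    exact mul_ne_zero hsg (div_ne_zero hβ0.ne' hk0)
  refine ⟨(mat _ _ _ _ hdet).trans Complex.equivRealProdCLM.symm, ?_, ?_, ?_⟩
  · apply conj_strict _ hX.strict
    intro p
    rw [fderiv_jac, rot_apply]
    have hdef : detJ X = jac11 X * d - jac12 X * a := rfl
    have htr : trJ X = jac11 X + d := rfl
    have e1 : jac11 X = 2 * α - d := by rw [hα, htr]; ring
    have e2 : a * jac12 X = 2 * α * d - d ^ 2 - α ^ 2 - β ^ 2 := by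
      rw [hβ2, hdef, hα, htr]; ring
    apply Complex.ext
    · simp [mat_apply, ← ha, ← hd']
      rw [e1]
      field_simp
      linear_combination (p.2) * e2
    · simp [mat_apply, ← ha, ← hd']
      field_simp
      ring
  · intro p
    have : (((mat _ _ _ _ hdet).trans Complex.equivRealProdCLM.symm) p).im = β / k * p.2 := by
      simp [mat_apply]
    rw [this]
    exact (mul_nonneg_iff_of_pos_left (div_pos hβ0 hsa)).symm
  · intro x
    apply Complex.ext
    · simp [mat_apply, ha0]
    · simp [mat_apply]

def lamJ (X : ℝ × ℝ → ℝ × ℝ) : ℝ := (trJ X + √(discJ X)) / 2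
def muJ (X : ℝ × ℝ → ℝ × ℝ) : ℝ := (trJ X - √(discJ X)) / 2

theorem node_coords {X : ℝ × ℝ → ℝ × ℝ} {sg : ℝ} (hX : Fld X sg) (hd : 0 < discJ X) :
    ∃ T : (ℝ × ℝ) ≃L[ℝ] (ℝ × ℝ), HasStrictFDerivAt (fun z => T (X (T.symm z)))
      (dg (lamJ X) (muJ X)) 0 ∧ (∀ p : ℝ × ℝ, 0 ≤ p.2 ↔ T p ∈ HP) ∧
      ∀ x : ℝ, T (x, 0) = (sg * x, -(sg * x)) := by
  set l := lamJ X with hl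
  set m := muJ X with hm
  have hq := Real.sqrt_pos.mpr hd
  have hq2 := Real.sq_sqrt hd.le
  have hlm : 0 < l - m := by
    have : l - m = √(discJ X) := by rw [hl, hm, lamJ, muJ]; ring
    rw [this]; exact hq
  have hsum : l + m = trJ X := by rw [hl, hm, lamJ, muJ]; ring
  have hprod : l * m = detJ X := by
    have : l * m = (trJ X ^ 2 - √(discJ X) ^ 2) / 4 := by rw [hl, hm, lamJ, muJ]; ring
    rw [this, hq2, discJ]; ring
  set a := jac21 X with ha
  set d := jac22 X with hd'
  have hsa := hX.sg_pos
  set k := sg * a with hk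
  have hs := hX.sg_sq
  have hk0 : k ≠ 0 := hsa.ne'
  have ha0 : a / k = sg := by
    rw [div_eq_iff hk0, hk, ← mul_assoc, hs, one_mul]
  have hsg : sg ≠ 0 := by rintro h; rw [h] at hs; norm_num at hs
  have hdet : (a / k) * ((l - d) / k) - ((d - m) / k) * (-(a / k)) ≠ 0 := by
    have : (a / k) * ((l - d) / k) - ((d - m) / k) * (-(a / k)) = sg * ((l - m) / k) := by
      rw [ha0]; field_simp; ring
    rw [this]
    exact mul_ne_zero hsg (div_ne_zero hlm.ne' hk0)
  have hdef : detJ X = jac11 X * d - jac12 X * a := rfl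
  have htr : trJ X = jac11 X + d := rfl
  have e1 : jac11 X = l + m - d := by rw [hsum, htr]; ring
  have e2 : a * jac12 X = (l + m - d) * d - l * m := by rw [hprod, hdef, e1]; ring
  refine ⟨mat _ _ _ _ hdet, ?_, ?_, ?_⟩
  · apply conj_strict _ hX.strict
    intro p
    rw [fderiv_jac, dg_apply]
    simp only [mat_apply, ← ha, ← hd']
    rw [e1]
    apply Prod.ext
    · simp only
      field_simp
      linear_combination (p.2) * e2
    · simp only
      field_simp
      linear_combination (-p.2) * e2
  · intro p
    have : (mat _ _ _ _ hdet p).1 + (mat _ _ _ _ hdet p).2 = (l - m) / k * p.2 := by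
      simp only [mat_apply]; ring
    simp only [HP]
    show _ ↔ 0 ≤ (mat _ _ _ _ hdet p).1 + (mat _ _ _ _ hdet p).2
    rw [this]
    exact (mul_nonneg_iff_of_pos_left (div_pos hlm hsa)).symm
  · intro x
    rw [mat_apply, ha0]
    apply Prod.ext <;> simp

/-- the closed upper half plane -/
def UHP : Set (ℝ × ℝ) := {p | 0 ≤ p.2}

def HalfEq (X X' : ℝ × ℝ → ℝ × ℝ) (sg : ℝ) (gp gm : ℝ ≃o ℝ) : Prop :=
  ∃ H, UE X X' UHP H ∧ ∀ x : ℝ, H (x, 0) = (sg * hS gp gm (sg * x), 0)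

theorem node_half {X X' : ℝ × ℝ → ℝ × ℝ} {sg : ℝ} (hX : Fld X sg) (hX' : Fld X' sg)
    (hd : 0 < discJ X) (hd' : 0 < discJ X') (hl : 0 < lamJ X * lamJ X') (hm : 0 < muJ X * muJ X')
    (gp gm : ℝ ≃o ℝ) {C : ℝ} (hC : 0 < C) (hgp : ∀ ρ, |gp ρ - ρ| ≤ C) (hgm : ∀ ρ, |gm ρ - ρ| ≤ C) :
    HalfEq X X' sg gp gm := by
  obtain ⟨T, h1, h2, h3⟩ := node_coords hX hd
  obtain ⟨T', h1', h2', h3'⟩ := node_coords hX' hd'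
  have hlm : ∀ {X}, 0 < discJ X → muJ X < lamJ X := fun {X} h => by
    have := Real.sqrt_pos.mpr h
    rw [muJ, lamJ]; linarith
  obtain ⟨H, hU, hb⟩ := saddle_UE h1 (by simp [hX.zero]) h1' (by simp [hX'.zero]) (hlm hd) (hlm hd')
    hl hm gp gm hC hgp hgm
  refine ⟨_, UE.conj T T' (X := X) (X' := X') (S := UHP) (fun p => by simp) (fun p => by simp)
    h2 h2' hU, fun x => ?_⟩
  rw [h3, hb, ContinuousLinearEquiv.symm_apply_eq, h3', ← mul_assoc, hX.sg_sq, one_mul]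

theorem growth {E : Type*} [NormedAddCommGroup E] [NormedSpace ℝ E] {X : E → E} {L : E →L[ℝ] E}
    (hX : HasStrictFDerivAt X L 0) (h0 : X 0 = 0) :
    ∃ r > 0, ∀ z, ‖z‖ ≤ r → ‖X z‖ ≤ (‖L‖ + 1) * ‖z‖ := by
  obtain ⟨r, hr, -, h⟩ := remainder_exists hX h0 one_pos
  refine ⟨r, hr, fun z hz => ?_⟩
  have h1 := h z hz
  have h2 := L.le_opNorm z
  have h3 : X z = (X z - L z) + L z := by abel
  have h4 := norm_add_le (X z - L z) (L z)
  rw [← h3] at h4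
  linarith

theorem Chart.mono {E : Type*} [NormedAddCommGroup E] [NormedSpace ℝ E]
    {X : E → E} {D D' : Set E} {a b : E → ℝ} {P : ℝ × ℝ → E} {A G : ℝ → ℝ → ℝ}
    {c₀ C₁ M K : ℝ} (h : Chart X D a b P A G c₀ C₁ M K) (hD : D' ⊆ D) :
    Chart X D' a b P A G c₀ C₁ M K :=
  ⟨h.c_pos, h.A_lo, h.A_hi, h.A_cont, h.good, fun p hp => h.da p (hD hp), fun p hp => h.db p (hD hp),
    fun p hp => h.P_eq p (hD hp), fun p hp => h.dP p (hD hp)⟩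

/-- packaged focus data -/
theorem focus_data {X : ℝ × ℝ → ℝ × ℝ} {sg ε : ℝ} (hX : Fld X sg) (hd : discJ X < 0) (hε : 0 < ε) :
    ∃ T : (ℝ × ℝ) ≃L[ℝ] ℂ, ∃ r > 0, ∃ (A G : ℝ → ℝ → ℝ) (c₀ C₁ M K : ℝ) (F : ℝ → ℝ → ℝ → ℝ) (B : ℝ)
      (P : ℝ ≃o ℝ),
      (∀ p : ℝ × ℝ, 0 ≤ p.2 ↔ 0 ≤ (T p).im) ∧
      (∀ x : ℝ, T (x, 0) = ((sg * x : ℝ) : ℂ)) ∧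
      Chart (fun z => T (X (T.symm z))) (fD r) fa fb fP A G c₀ C₁ M K ∧ IsFlow G F ∧
      (∀ z, ‖z‖ ≤ r → ‖T (X (T.symm z))‖ ≤ B * ‖z‖) ∧
      (∀ s, P s = F (Real.pi / 2) (-(Real.pi / 2)) s) ∧
      (∀ s, P.symm s = F (-(Real.pi / 2)) (Real.pi / 2) s) ∧
      (∀ s, |P s - s - Real.pi * (trJ X / √(-discJ X))| ≤ ε) := by
  obtain ⟨T, h1, h2, h3⟩ := focus_coords hX hd
  have hq := Real.sqrt_pos.mpr (by linarith : 0 < -discJ X)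
  have h0 : T (X (T.symm 0)) = 0 := by simp [hX.zero]
  obtain ⟨r, hr, A, G, c₀, C₁, M, K, hG, hc⟩ := focus_chart h1 h0 (by linarith)
    (div_pos hε Real.pi_pos)
  obtain ⟨r₂, hr₂, hB⟩ := growth h1 h0
  obtain ⟨F, hF⟩ := hc.good.exists_flow
  obtain ⟨P, hP, hPs⟩ := halfMap hF hc.good
  refine ⟨T, min r r₂, lt_min hr hr₂, A, G, c₀, C₁, M, K, F, _, P, h2, h3,
    hc.mono fun z hz => ⟨hz.1, hz.2.1, hz.2.2.trans (min_le_left _ _)⟩, hF,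
    fun z hz => hB z (hz.trans (min_le_right _ _)), hP, hPs, fun s => ?_⟩
  have := halfMap_disp hF hG s
  rw [hP]
  have e : trJ X / 2 / (√(-discJ X) / 2) = trJ X / √(-discJ X) := by field_simp
  rw [e, div_mul_cancel₀ _ Real.pi_pos.ne'] at this
  exact this

theorem focus_half {X X' : ℝ × ℝ → ℝ × ℝ} {sg ε : ℝ} (hX : Fld X sg) (hX' : Fld X' sg)
    (hd : discJ X < 0) (hd' : discJ X' < 0) (hε : 0 < ε) : ∃ P P' : ℝ ≃o ℝ,
      (∀ s, |P s - s - Real.pi * (trJ X / √(-discJ X))| ≤ ε) ∧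
      (∀ s, |P' s - s - Real.pi * (trJ X' / √(-discJ X'))| ≤ ε) ∧
      ∀ g : ℝ ≃o ℝ, HalfEq X X' sg g ((P.symm.trans g).trans P') := by
  obtain ⟨T, r, hr, A, G, c₀, C₁, M, K, F, B, P, h1, h2, h3, h4, h5, h6, h7, h8⟩ :=
    focus_data hX hd hε
  obtain ⟨T', r', hr', A', G', c₀', C₁', M', K', F', B', P', h1', h2', h3', h4', h5', h6', h7', h8'⟩ :=
    focus_data hX' hd' hε
  refine ⟨P, P', h8, h8', fun g => ⟨_, UE.conj T T' (X := X) (X' := X') (S := UHP) (S₁ := UH)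
    (fun p => by simp) (fun p => by simp)
    h1 h1' (focus_UE hr hr' h3 h3' h4 h4' h5 h5' g), fun x => ?_⟩⟩
  rw [h2, FH_bdry h4 h4' P P' g h7 h6', ContinuousLinearEquiv.symm_apply_eq, h2', ← mul_assoc,
    hX.sg_sq, one_mul]


/-! ### M11: gluing -/

def nf (Y : ℝ × ℝ → ℝ × ℝ) (p : ℝ × ℝ) : ℝ × ℝ := - Y (-p)

theorem nf_iff {Y : ℝ × ℝ → ℝ × ℝ} {γ : ℝ → ℝ × ℝ} {I : Set ℝ} :
    OC (nf Y) (fun t => - γ t) I ↔ OC Y γ I :=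
  OC.conj_iff (ContinuousLinearEquiv.neg ℝ) (X := Y) (X' := nf Y) (c := γ) (I := I)
    (fun p => by simp [nf])

theorem mapsOrbits_of {X X' : ℝ × ℝ → ℝ × ℝ} {H : ℝ × ℝ → ℝ × ℝ} {S S' : Set (ℝ × ℝ)}
    (hS : MapsTo H S S') (h : ∀ (γ : ℝ → ℝ × ℝ) (I : Set ℝ), I.OrdConnected → ContinuousOn γ I →
      (∀ t ∈ I, γ t ∈ S) → OC X γ I → OC X' (fun t => H (γ t)) I) : MapsOrbits X X' H S S' := by
  intro γ I hI hγ hγS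
  have hc : ContinuousOn γ I := fun t ht => (hγ t ht).continuousAt.continuousWithinAt
  obtain ⟨δ, J, τ, h1, h2, h3, h4, h5, h6⟩ := h γ I hI hc hγS (OC.of_sol hI hγ)
  refine ⟨δ, J, τ, h1, h2, fun s hs => ?_, h3, h4, h5, h6⟩
  obtain ⟨t, ht, rfl⟩ := h3.surjOn hs
  rw [← h6 t ht]
  exact hS (hγS t ht)

def SE (X X' : ℝ × ℝ → ℝ × ℝ) (S : Set (ℝ × ℝ)) (H : ℝ × ℝ → ℝ × ℝ) (r : ℝ) : Prop :=
  ∀ (γ : ℝ → ℝ × ℝ) (I : Set ℝ), I.OrdConnected → ContinuousOn γ I →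
    (∀ t ∈ I, γ t ∈ S ∧ ‖γ t‖ ≤ r ∧ ‖H (γ t)‖ ≤ r) → (OC X γ I ↔ OC X' (fun t => H (γ t)) I)

theorem SE.maps {X X' : ℝ × ℝ → ℝ × ℝ} {S : Set (ℝ × ℝ)} {e : (ℝ × ℝ) ≃ₜ (ℝ × ℝ)} {r : ℝ}
    (h : SE X X' S e r) (hS : ∀ p, p ∈ S ↔ e p ∈ S) :
    MapsOrbits X X' e ({p | ‖p‖ ≤ r ∧ ‖e p‖ ≤ r} ∩ S) ({p | ‖e.symm p‖ ≤ r ∧ ‖p‖ ≤ r} ∩ S) ∧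
    MapsOrbits X' X e.symm ({p | ‖e.symm p‖ ≤ r ∧ ‖p‖ ≤ r} ∩ S) ({p | ‖p‖ ≤ r ∧ ‖e p‖ ≤ r} ∩ S) := by
  constructor
  · apply mapsOrbits_of
    · rintro p ⟨⟨h1, h2⟩, h3⟩
      refine ⟨⟨?_, h2⟩, (hS p).mp h3⟩
      rwa [e.symm_apply_apply]
    · intro γ I hI hc hγ hO
      exact (h γ I hI hc (fun t ht => ⟨(hγ t ht).2, (hγ t ht).1.1, (hγ t ht).1.2⟩)).mp hO
  · have hS' : ∀ p, p ∈ S → e.symm p ∈ S := fun p hp => by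
      rw [hS, e.apply_symm_apply]; exact hp
    apply mapsOrbits_of
    · rintro p ⟨⟨h1, h2⟩, h3⟩
      refine ⟨⟨h1, ?_⟩, hS' p h3⟩
      rwa [e.apply_symm_apply]
    · intro γ I hI hc hγ hO
      refine (h (fun t => e.symm (γ t)) I hI (e.symm.continuous.comp_continuousOn hc) (fun t ht =>
        ⟨hS' _ (hγ t ht).2, (hγ t ht).1.1, ?_⟩)).mpr ?_
      · rw [e.apply_symm_apply]; exact (hγ t ht).1.2
      · exact hO.congr (fun t _ => e.apply_symm_apply _)

theorem exists_homeo {H : ℝ × ℝ → ℝ × ℝ} (hc : Continuous H) (hb : Function.Bijective H)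
    (hp : ∀ R, ∃ R', ∀ p, ‖H p‖ ≤ R → ‖p‖ ≤ R') : ∃ e : (ℝ × ℝ) ≃ₜ (ℝ × ℝ), ∀ p, e p = H p := by
  have hpr : IsProperMap H := by
    rw [isProperMap_iff_tendsto_cocompact]
    refine ⟨hc, ?_⟩
    rw [← Metric.cobounded_eq_cocompact, ← tendsto_norm_atTop_iff_cobounded, tendsto_atTop]
    intro R
    obtain ⟨R', hR'⟩ := hp R
    have : ∀ᶠ p : ℝ × ℝ in Bornology.cobounded (ℝ × ℝ), R' < ‖p‖ :=
      tendsto_norm_cobounded_atTop.eventually (eventually_gt_atTop R')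
    filter_upwards [this] with p hp
    by_contra hcon
    push Not at hcon
    have := hR' p hcon.le
    linarith
  exact ⟨(Equiv.ofBijective H hb).toHomeomorphOfContinuousClosed hc hpr.isClosedMap, fun p => rfl⟩

theorem HalfEq.int {X X' : ℝ × ℝ → ℝ × ℝ} {sg : ℝ} {gp gm : ℝ ≃o ℝ} (hsg : sg * sg = 1)
    {H : ℝ × ℝ → ℝ × ℝ} (h : UE X X' UHP H) (hb : ∀ x : ℝ, H (x, 0) = (sg * hS gp gm (sg * x), 0))
    {p : ℝ × ℝ} (hp : 0 < p.2) : 0 < (H p).2 := by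
  have h1 : 0 ≤ (H p).2 := h.bij.mapsTo (show 0 ≤ p.2 from hp.le)
  rcases h1.eq_or_lt with h2 | h2
  · exfalso
    have h3 : H (sg * hS gp.symm gm.symm (sg * (H p).1), 0) = H p := by
      rw [hb, ← mul_assoc, hsg, one_mul, hS_inv, ← mul_assoc, hsg, one_mul]
      exact Prod.ext rfl h2
    have := h.bij.injOn (show (0 : ℝ) ≤ 0 from le_rfl) (show 0 ≤ p.2 from hp.le) h3
    rw [← this] at hp
    exact lt_irrefl _ hp
  · exact h2

theorem glue {X Y X' Y' : ℝ × ℝ → ℝ × ℝ} {sg : ℝ} {gp gm : ℝ ≃o ℝ} (hsg : sg * sg = 1)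
    (h1 : HalfEq X X' sg gp gm) (h2 : HalfEq (nf Y) (nf Y') sg gm gp) : LocalSigmaEquiv X Y X' Y' := by
  obtain ⟨H₁, u1, b1⟩ := h1
  obtain ⟨H₂, u2, b2⟩ := h2
  set H : ℝ × ℝ → ℝ × ℝ := fun p => if 0 ≤ p.2 then H₁ p else - H₂ (-p) with hH
  have hA : ∀ p : ℝ × ℝ, 0 ≤ p.2 → H p = H₁ p := fun p hp => if_pos hp
  have hB : ∀ p : ℝ × ℝ, p.2 ≤ 0 → H p = - H₂ (-p) := fun p hp => by
    rcases hp.eq_or_lt with h | h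
    · rw [hA p h.ge]
      obtain ⟨x, y⟩ := p
      simp only at h
      subst h
      have e : (-((x, 0) : ℝ × ℝ)) = (-x, 0) := by simp
      rw [e, b1, b2, mul_neg, hS_swap]
      simp
    · exact if_neg (by linarith)
  have i1 : ∀ p : ℝ × ℝ, 0 < p.2 → 0 < (H p).2 := fun p hp => by
    rw [hA p hp.le]; exact HalfEq.int hsg u1 b1 hp
  have i2 : ∀ p : ℝ × ℝ, p.2 < 0 → (H p).2 < 0 := fun p hp => by
    rw [hB p hp.le]
    have := HalfEq.int hsg u2 b2 (p := -p) (by simpa using hp)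
    simpa using this
  have i0 : ∀ p : ℝ × ℝ, p.2 = 0 → (H p).2 = 0 := fun p hp => by
    rw [hA p hp.ge]
    obtain ⟨x, y⟩ := p
    simp only at hp
    subst hp
    rw [b1]
  have s1 : ∀ p : ℝ × ℝ, 0 ≤ p.2 ↔ 0 ≤ (H p).2 := fun p => by
    rcases lt_trichotomy p.2 0 with h | h | h
    · have := i2 p h; constructor <;> intro <;> linarith
    · have := i0 p h; rw [h, this]
    · have := i1 p h; constructor <;> intro <;> linarith
  have s2 : ∀ p : ℝ × ℝ, p.2 ≤ 0 ↔ (H p).2 ≤ 0 := fun p => by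
    rcases lt_trichotomy p.2 0 with h | h | h
    · have := i2 p h; constructor <;> intro <;> linarith
    · have := i0 p h; rw [h, this]
    · have := i1 p h; constructor <;> intro <;> linarith
  have s0 : ∀ p : ℝ × ℝ, p.2 = 0 ↔ (H p).2 = 0 := fun p => by
    rw [le_antisymm_iff, le_antisymm_iff, ← s1, ← s2]
  have hinj : Function.Injective H := by
    intro p q hpq
    rcases le_total 0 p.2 with h | h
    · have hq : 0 ≤ q.2 := by rw [s1, ← hpq, ← s1]; exact h
      rw [hA p h, hA q hq] at hpq
      exact u1.bij.injOn h hq hpq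
    · have hq : q.2 ≤ 0 := by rw [s2, ← hpq, ← s2]; exact h
      rw [hB p h, hB q hq, neg_inj] at hpq
      exact neg_inj.mp (u2.bij.injOn (show 0 ≤ (-p).2 by simpa using h)
        (show 0 ≤ (-q).2 by simpa using hq) hpq)
  have hsurj : Function.Surjective H := by
    intro q
    rcases le_total 0 q.2 with h | h
    · obtain ⟨p, hp, hpq⟩ := u1.bij.surjOn (show q ∈ UHP from h)
      exact ⟨p, by rw [hA p hp, hpq]⟩
    · obtain ⟨p, hp, hpq⟩ := u2.bij.surjOn (show -q ∈ UHP by simpa [UHP] using h)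
      refine ⟨-p, ?_⟩
      have : 0 ≤ p.2 := hp
      rw [hB (-p) (by simpa using this), neg_neg, hpq, neg_neg]
  have hc1 : IsClosed {p : ℝ × ℝ | 0 ≤ p.2} := isClosed_le continuous_const continuous_snd
  have hc2 : IsClosed {p : ℝ × ℝ | p.2 ≤ 0} := isClosed_le continuous_snd continuous_const
  have hcont : Continuous H := by
    rw [← continuousOn_univ]
    have : (univ : Set (ℝ × ℝ)) = {p | 0 ≤ p.2} ∪ {p | p.2 ≤ 0} := by
      ext p; simpa using le_total 0 p.2
    rw [this]
    refine ContinuousOn.union_of_isClosed (u1.cont.congr fun p hp => hA p hp) ?_ hc1 hc2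
    have h3 : ContinuousOn (fun p : ℝ × ℝ => - H₂ (-p)) {p | p.2 ≤ 0} :=
      (u2.cont.comp continuous_neg.continuousOn (fun p hp => by
        have : p.2 ≤ 0 := hp
        show 0 ≤ (-p).2
        simpa using this)).neg
    exact h3.congr fun p hp => hB p hp
  have hprop : ∀ R, ∃ R', ∀ p, ‖H p‖ ≤ R → ‖p‖ ≤ R' := by
    intro R
    obtain ⟨R₁, k1⟩ := u1.proper R
    obtain ⟨R₂, k2⟩ := u2.proper R
    refine ⟨max R₁ R₂, fun p hp => ?_⟩
    rcases le_total 0 p.2 with h | h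
    · rw [hA p h] at hp
      exact (k1 p h hp).trans (le_max_left _ _)
    · rw [hB p h, norm_neg] at hp
      have := k2 (-p) (show 0 ≤ (-p).2 by simpa using h) hp
      rw [norm_neg] at this
      exact this.trans (le_max_right _ _)
  obtain ⟨e, he⟩ := exists_homeo hcont ⟨hinj, hsurj⟩ hprop
  have hz : e 0 = 0 := by rw [he, hA 0 le_rfl, u1.zero]
  have hzs : e.symm 0 = 0 := by rw [e.symm_apply_eq, hz]
  obtain ⟨r₁, hr₁, o1⟩ := u1.oc
  obtain ⟨r₂, hr₂, o2⟩ := u2.oc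
  set r := min r₁ r₂ with hr
  have hr0 : 0 < r := lt_min hr₁ hr₂
  have SE1 : SE X X' {p | 0 ≤ p.2} e r := by
    intro γ I hI hc hγ
    have h3 : ∀ t ∈ I, e (γ t) = H₁ (γ t) := fun t ht => by rw [he, hA _ (hγ t ht).1]
    have h4 := o1 γ I hI hc (fun t ht => ⟨(hγ t ht).1, (hγ t ht).2.1.trans (min_le_left _ _), by
      rw [← h3 t ht]; exact (hγ t ht).2.2.trans (min_le_left _ _)⟩)
    exact h4.trans ⟨fun h => h.congr h3, fun h => h.congr fun t ht => (h3 t ht).symm⟩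
  have SE2 : SE Y Y' {p | p.2 ≤ 0} e r := by
    intro γ I hI hc hγ
    have h3 : ∀ t ∈ I, e (γ t) = - H₂ (-γ t) := fun t ht => by rw [he, hB _ (hγ t ht).1]
    have h4 := o2 (fun t => - γ t) I hI hc.neg (fun t ht => ⟨?_, ?_, ?_⟩)
    · rw [nf_iff] at h4
      refine h4.trans ?_
      have h5 := nf_iff (Y := Y') (γ := fun t => e (γ t)) (I := I)
      rw [← h5]
      exact ⟨fun h => h.congr fun t ht => by rw [h3 t ht, neg_neg],
        fun h => h.congr fun t ht => by rw [h3 t ht, neg_neg]⟩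
    · have : (γ t).2 ≤ 0 := (hγ t ht).1
      show 0 ≤ (-γ t).2
      simpa using this
    · rw [norm_neg]; exact (hγ t ht).2.1.trans (min_le_right _ _)
    · rw [← norm_neg, ← h3 t ht]; exact (hγ t ht).2.2.trans (min_le_right _ _)
  obtain ⟨m1, m3⟩ := SE1.maps (fun p => by rw [he]; exact s1 p)
  obtain ⟨m2, m4⟩ := SE2.maps (fun p => by rw [he]; exact s2 p)
  refine ⟨{p | ‖p‖ ≤ r ∧ ‖e p‖ ≤ r}, {p | ‖e.symm p‖ ≤ r ∧ ‖p‖ ≤ r}, e, e.symm, ?_, ?_,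
    e.continuous.continuousOn, e.symm.continuous.continuousOn, ?_, fun p _ => e.symm_apply_apply p,
    fun p _ => e.apply_symm_apply p, hz, ?_, m1, m2, m3, m4⟩
  · have k1 : ∀ᶠ p : ℝ × ℝ in nhds 0, ‖p‖ < r :=
      continuous_norm.continuousAt.eventually (gt_mem_nhds (by simpa using hr0))
    have k2 : ∀ᶠ p : ℝ × ℝ in nhds 0, ‖e p‖ < r :=
      (continuous_norm.comp e.continuous).continuousAt.eventually (gt_mem_nhds (by simpa [hz] using hr0))
    exact (k1.and k2).mono fun p hp => ⟨hp.1.le, hp.2.le⟩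
  · have k1 : ∀ᶠ p : ℝ × ℝ in nhds 0, ‖p‖ < r :=
      continuous_norm.continuousAt.eventually (gt_mem_nhds (by simpa using hr0))
    have k2 : ∀ᶠ p : ℝ × ℝ in nhds 0, ‖e.symm p‖ < r :=
      (continuous_norm.comp e.symm.continuous).continuousAt.eventually
        (gt_mem_nhds (by simpa [hzs] using hr0))
    exact (k1.and k2).mono fun p hp => ⟨hp.2.le, hp.1.le⟩
  · refine ⟨fun p hp => ⟨by rw [e.symm_apply_apply]; exact hp.1, hp.2⟩, e.injective.injOn,
      fun q hq => ⟨e.symm q, ⟨hq.1, by rw [e.apply_symm_apply]; exact hq.2⟩, e.apply_symm_apply q⟩⟩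
  · ext q
    constructor
    · rintro ⟨p, ⟨h3, h4⟩, rfl⟩
      refine ⟨⟨by rw [e.symm_apply_apply]; exact h3.1, h3.2⟩, ?_⟩
      show (e p).2 = 0
      rw [he, ← s0]; exact h4
    · rintro ⟨h3, h4⟩
      refine ⟨e.symm q, ⟨⟨h3.1, by rw [e.apply_symm_apply]; exact h3.2⟩, ?_⟩, e.apply_symm_apply q⟩
      show (e.symm q).2 = 0
      rw [s0, ← he, e.apply_symm_apply]; exact h4


/-! ### M12: conjugacy of monotone displacement maps -/

theorem conj_transl (P : ℝ ≃o ℝ) {c : ℝ} (hc : 0 < c) (hP : ∀ s, s + c ≤ P s) :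
    ∃ k : ℝ ≃o ℝ, ∀ x, k (x + 1) = P (k x) := by
  have hP0 : 0 < P 0 := by have := hP 0; linarith
  have hsucc : ∀ (n : ℤ) (x : ℝ), (P ^ (n + 1)) x = P ((P ^ n) x) := fun n x => by
    rw [add_comm, zpow_add, zpow_one]; rfl
  have hsucc' : ∀ (n : ℤ) (x : ℝ), (P ^ (n + 1)) x = (P ^ n) (P x) := fun n x => by
    rw [zpow_add, zpow_one]; rfl
  have hmono : Monotone (fun n : ℤ => (P ^ n) 0 - n * c) := by
    apply monotone_int_of_le_succ
    intro n
    have := hP ((P ^ n) 0)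
    rw [hsucc]; push_cast
    linarith
  have hmono0 : Monotone (fun n : ℤ => (P ^ n) 0) := by
    apply monotone_int_of_le_succ
    intro n
    have := hP ((P ^ n) 0)
    rw [hsucc]
    linarith
  set k : ℝ → ℝ := fun x => (P ^ ⌊x⌋) (Int.fract x * P 0) with hk
  have hstrict : StrictMono k := by
    intro x y hxy
    rcases (Int.floor_mono hxy.le).eq_or_lt with h | h
    · simp only [hk, ← h]
      apply (P ^ ⌊x⌋).strictMono
      have : Int.fract x < Int.fract y := by
        rw [Int.fract, Int.fract, ← h]; linarith
      exact mul_lt_mul_of_pos_right this hP0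
    · have h1 : k x < (P ^ ⌊x⌋) (P 0) := by
        apply (P ^ ⌊x⌋).strictMono
        have := mul_lt_mul_of_pos_right (Int.fract_lt_one x) hP0
        linarith
      rw [← hsucc'] at h1
      have h2 : (P ^ (⌊x⌋ + 1)) 0 ≤ (P ^ ⌊y⌋) 0 := hmono0 (by omega)
      have h3 : (P ^ ⌊y⌋) 0 ≤ k y := by
        apply (P ^ ⌊y⌋).monotone
        exact mul_nonneg (Int.fract_nonneg y) hP0.le
      linarith
  have hsurj : Function.Surjective k := by
    intro s
    obtain ⟨n, hn1, hn2⟩ := Int.exists_greatest_of_bdd (P := fun n : ℤ => (P ^ n) 0 ≤ s) (by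
        refine ⟨max 0 ⌈s / c⌉, fun n hn => ?_⟩
        rcases le_total n 0 with h | h
        · exact h.trans (le_max_left _ _)
        · refine le_trans ?_ (le_max_right _ _)
          have h1 := hmono h
          simp only [zpow_zero] at h1
          have h2 : (1 : ℝ ≃o ℝ) 0 = 0 := rfl
          rw [h2] at h1
          push_cast at h1
          have h3 : (n : ℝ) * c ≤ s := by linarith
          have h4 : (n : ℝ) ≤ s / c := by rw [le_div_iff₀ hc]; exact h3
          exact_mod_cast h4.trans (Int.le_ceil _)) (by
        refine ⟨min 0 ⌊s / c⌋, ?_⟩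
        have h1 := hmono (min_le_left 0 ⌊s / c⌋)
        simp only [zpow_zero] at h1
        have h2 : (1 : ℝ ≃o ℝ) 0 = 0 := rfl
        rw [h2] at h1
        have h3 : ((min 0 ⌊s / c⌋ : ℤ) : ℝ) ≤ s / c :=
          le_trans (by exact_mod_cast min_le_right _ _) (Int.floor_le _)
        rw [le_div_iff₀ hc] at h3
        push_cast at h1 h3
        linarith)
    have hn3 : s < (P ^ (n + 1)) 0 := by
      by_contra hcon
      push Not at hcon
      have := hn2 (n + 1) hcon
      omega
    rw [hsucc'] at hn3
    set y := (P ^ n).symm s with hy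
    have hy0 : 0 ≤ y := by rw [hy, OrderIso.le_symm_apply]; exact hn1
    have hy1 : y < P 0 := by rw [hy, OrderIso.symm_apply_lt]; exact hn3
    have hz0 : 0 ≤ y / P 0 := div_nonneg hy0 hP0.le
    have hz1 : y / P 0 < 1 := by rw [div_lt_one hP0]; exact hy1
    refine ⟨n + y / P 0, ?_⟩
    have e1 : ⌊(n : ℝ) + y / P 0⌋ = n := by
      rw [Int.floor_eq_iff]; constructor <;> linarith
    have e2 : Int.fract ((n : ℝ) + y / P 0) = y / P 0 := by rw [Int.fract, e1]; ring
    simp only [hk]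
    rw [e1, e2, div_mul_cancel₀ _ hP0.ne', hy, OrderIso.apply_symm_apply]
  refine ⟨hstrict.orderIsoOfSurjective k hsurj, fun x => ?_⟩
  show k (x + 1) = P (k x)
  simp only [hk, Int.floor_add_one, Int.fract_add_one]
  exact hsucc _ _

theorem conj_up (P P' : ℝ ≃o ℝ) {c : ℝ} (hc : 0 < c) (hP : ∀ s, s + c ≤ P s)
    (hP' : ∀ s, s + c ≤ P' s) : ∃ g : ℝ ≃o ℝ, ∀ x, g (P x) = P' (g x) := by
  obtain ⟨k, hk⟩ := conj_transl P hc hP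
  obtain ⟨k', hk'⟩ := conj_transl P' hc hP'
  refine ⟨k.symm.trans k', fun x => ?_⟩
  obtain ⟨y, rfl⟩ := k.surjective x
  rw [← hk]
  simp only [OrderIso.trans_apply, OrderIso.symm_apply_apply, hk']

theorem conj_down (P P' : ℝ ≃o ℝ) {c : ℝ} (hc : 0 < c) (hP : ∀ s, P s ≤ s - c)
    (hP' : ∀ s, P' s ≤ s - c) : ∃ g : ℝ ≃o ℝ, ∀ x, g (P x) = P' (g x) := by
  have key : ∀ Q : ℝ ≃o ℝ, (∀ s, Q s ≤ s - c) → ∀ s, s + c ≤ Q.symm s := fun Q hQ s => by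
    have := hQ (Q.symm s)
    rw [OrderIso.apply_symm_apply] at this
    linarith
  obtain ⟨g, hg⟩ := conj_up P.symm P'.symm hc (key P hP) (key P' hP')
  refine ⟨g, fun x => ?_⟩
  have := hg (P x)
  rw [OrderIso.symm_apply_apply] at this
  rw [this, OrderIso.apply_symm_apply]

theorem conj_disp (P P' : ℝ ≃o ℝ) {A A' : ℝ} (hA : 0 < A * A')
    (hP : ∀ s, |P s - s - A| ≤ |A| / 2) (hP' : ∀ s, |P' s - s - A'| ≤ |A'| / 2) :
    ∃ g : ℝ ≃o ℝ, ∀ x, g (P x) = P' (g x) := by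
  rcases pos_and_pos_or_neg_and_neg_of_mul_pos hA with ⟨h1, h2⟩ | ⟨h1, h2⟩
  · refine conj_up P P' (c := min (A / 2) (A' / 2)) (lt_min (by linarith) (by linarith))
      (fun s => ?_) (fun s => ?_)
    · have := abs_le.mp (hP s)
      rw [abs_of_pos h1] at this
      have := min_le_left (A / 2) (A' / 2)
      linarith
    · have := abs_le.mp (hP' s)
      rw [abs_of_pos h2] at this
      have := min_le_right (A / 2) (A' / 2)
      linarith
  · refine conj_down P P' (c := min (-A / 2) (-A' / 2)) (lt_min (by linarith) (by linarith))
      (fun s => ?_) (fun s => ?_)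
    · have := abs_le.mp (hP s)
      rw [abs_of_neg h1] at this
      have := min_le_left (-A / 2) (-A' / 2)
      linarith
    · have := abs_le.mp (hP' s)
      rw [abs_of_neg h2] at this
      have := min_le_right (-A / 2) (-A' / 2)
      linarith


/-! ### M13: generic implies stable -/

def rJ (X : ℝ × ℝ → ℝ × ℝ) : ℝ := trJ X / √(-discJ X)

def SameT (X X' : ℝ × ℝ → ℝ × ℝ) : Prop :=
  (discJ X < 0 ∧ discJ X' < 0) ∨
    (0 < discJ X ∧ 0 < discJ X' ∧ 0 < lamJ X * lamJ X' ∧ 0 < muJ X * muJ X')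

theorem disp_comp {P P' : ℝ ≃o ℝ} {A A' : ℝ} (hP : ∀ s, |P s - s - A| ≤ 1)
    (hP' : ∀ s, |P' s - s - A'| ≤ 1) (s : ℝ) :
    |((P.symm.trans (OrderIso.refl ℝ)).trans P') s - s| ≤ |A' - A| + 2 := by
  have h1 := hP (P.symm s)
  rw [OrderIso.apply_symm_apply] at h1
  have h2 := hP' (P.symm s)
  show |P' (P.symm s) - s| ≤ _
  have h3 := abs_le.mp h1
  have h4 := abs_le.mp h2
  have h5 := le_abs_self (A' - A)
  have h6 := neg_abs_le (A' - A)
  rw [abs_le]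
  constructor <;> linarith

theorem equiv_of_same {X Y X' Y' : ℝ × ℝ → ℝ × ℝ} {sg : ℝ} (hX : Fld X sg) (hY : Fld (nf Y) sg)
    (hX' : Fld X' sg) (hY' : Fld (nf Y') sg) (tX : SameT X X') (tY : SameT (nf Y) (nf Y'))
    (hl : discJ X < 0 → discJ (nf Y) < 0 →
      0 < (rJ X + rJ (nf Y)) * (rJ X' + rJ (nf Y'))) : LocalSigmaEquiv X Y X' Y' := by
  have hid : ∀ {C : ℝ}, 0 < C → ∀ ρ, |(OrderIso.refl ℝ) ρ - ρ| ≤ C := fun h ρ => by simpa using h.le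
  rcases tX with ⟨d, d'⟩ | ⟨d, d', l, m⟩
  · rcases tY with ⟨e, e'⟩ | ⟨e, e', l', m'⟩
    · have hl := hl d e
      set ℓ := rJ X + rJ (nf Y) with hℓ
      set ℓ' := rJ X' + rJ (nf Y') with hℓ'
      have hp := Real.pi_pos
      have h0 : ℓ ≠ 0 := left_ne_zero_of_mul hl.ne'
      have h0' : ℓ' ≠ 0 := right_ne_zero_of_mul hl.ne'
      set ε := min (|Real.pi * ℓ| / 4) (|Real.pi * ℓ'| / 4) with hε
      have hε0 : 0 < ε := lt_min (div_pos (abs_pos.mpr (mul_ne_zero hp.ne' h0)) (by norm_num))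
        (div_pos (abs_pos.mpr (mul_ne_zero hp.ne' h0')) (by norm_num))
      have hε1 : ε ≤ |Real.pi * ℓ| / 4 := min_le_left _ _
      have hε2 : ε ≤ |Real.pi * ℓ'| / 4 := min_le_right _ _
      obtain ⟨P, P', p1, p2, p3⟩ := focus_half hX hX' d d' hε0
      obtain ⟨Q, Q', q1, q2, q3⟩ := focus_half hY hY' e e' hε0
      obtain ⟨g, hg⟩ := conj_disp (P.trans Q) (P'.trans Q') (A := Real.pi * ℓ) (A' := Real.pi * ℓ')
        (by have : Real.pi * ℓ * (Real.pi * ℓ') = Real.pi ^ 2 * (ℓ * ℓ') := by ring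
            rw [this]; positivity)
        (fun s => by
          have h1 := abs_le.mp (p1 s)
          have h2 := abs_le.mp (q1 (P s))
          change -ε ≤ _ - Real.pi * (rJ X) ∧ _ - Real.pi * (rJ X) ≤ ε at h1
          change -ε ≤ _ - Real.pi * (rJ (nf Y)) ∧ _ - Real.pi * (rJ (nf Y)) ≤ ε at h2
          have h3 : Real.pi * ℓ = Real.pi * rJ X + Real.pi * rJ (nf Y) := by rw [hℓ]; ring
          refine (abs_le.mpr ⟨?_, ?_⟩ : |Q (P s) - s - Real.pi * ℓ| ≤ 2 * ε).trans (by linarith)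
          · linarith
          · linarith)
        (fun s => by
          have h1 := abs_le.mp (p2 s)
          have h2 := abs_le.mp (q2 (P' s))
          change -ε ≤ _ - Real.pi * (rJ X') ∧ _ - Real.pi * (rJ X') ≤ ε at h1
          change -ε ≤ _ - Real.pi * (rJ (nf Y')) ∧ _ - Real.pi * (rJ (nf Y')) ≤ ε at h2
          have h3 : Real.pi * ℓ' = Real.pi * rJ X' + Real.pi * rJ (nf Y') := by rw [hℓ']; ring
          refine (abs_le.mpr ⟨?_, ?_⟩ : |Q' (P' s) - s - Real.pi * ℓ'| ≤ 2 * ε).trans (by linarith)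
          · linarith
          · linarith)
      have h3 := q3 ((P.symm.trans g).trans P')
      have h4 : (Q.symm.trans ((P.symm.trans g).trans P')).trans Q' = g := by
        ext s
        have := hg ((P.trans Q).symm s)
        rw [OrderIso.apply_symm_apply] at this
        exact this.symm
      rw [h4] at h3
      exact glue hX.sg_sq (p3 g) h3
    · obtain ⟨P, P', p1, p2, p3⟩ := focus_half hX hX' d d' one_pos
      have hC : 0 < |Real.pi * (trJ X' / √(-discJ X')) - Real.pi * (trJ X / √(-discJ X))| + 2 := by
        positivity
      exact glue hX.sg_sq (p3 (OrderIso.refl ℝ))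
        (node_half hY hY' e e' l' m' _ _ hC (disp_comp p1 p2) (hid hC))
  · rcases tY with ⟨e, e'⟩ | ⟨e, e', l', m'⟩
    · obtain ⟨P, P', p1, p2, p3⟩ := focus_half hY hY' e e' one_pos
      have hC : 0 < |Real.pi * (trJ (nf Y') / √(-discJ (nf Y'))) -
          Real.pi * (trJ (nf Y) / √(-discJ (nf Y)))| + 2 := by
        positivity
      exact glue hX.sg_sq (node_half hX hX' d d' l m _ _ hC (disp_comp p1 p2) (hid hC))
        (p3 (OrderIso.refl ℝ))
    · exact glue hX.sg_sq (node_half hX hX' d d' l m _ _ one_pos (hid one_pos) (hid one_pos))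
        (node_half hY hY' e e' l' m' (OrderIso.refl ℝ) (OrderIso.refl ℝ) one_pos (hid one_pos)
          (hid one_pos))

/-! jacobian data as functions of the linear part -/

abbrev Lin := ℝ × ℝ →L[ℝ] ℝ × ℝ
def L11 (L : Lin) : ℝ := (L (1, 0)).1
def L12 (L : Lin) : ℝ := (L (0, 1)).1
def L21 (L : Lin) : ℝ := (L (1, 0)).2
def L22 (L : Lin) : ℝ := (L (0, 1)).2
def Ltr (L : Lin) : ℝ := L11 L + L22 L
def Ldet (L : Lin) : ℝ := L11 L * L22 L - L12 L * L21 L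
def Ldisc (L : Lin) : ℝ := Ltr L ^ 2 - 4 * Ldet L
def Llam (L : Lin) : ℝ := (Ltr L + √(Ldisc L)) / 2
def Lmu (L : Lin) : ℝ := (Ltr L - √(Ldisc L)) / 2
def Lr (L : Lin) : ℝ := Ltr L / √(-Ldisc L)

theorem detJ_eq (X : ℝ × ℝ → ℝ × ℝ) : detJ X = Ldet (fderiv ℝ X 0) := rfl
theorem trJ_eq (X : ℝ × ℝ → ℝ × ℝ) : trJ X = Ltr (fderiv ℝ X 0) := rfl
theorem discJ_eq (X : ℝ × ℝ → ℝ × ℝ) : discJ X = Ldisc (fderiv ℝ X 0) := rfl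
theorem lamJ_eq (X : ℝ × ℝ → ℝ × ℝ) : lamJ X = Llam (fderiv ℝ X 0) := rfl
theorem muJ_eq (X : ℝ × ℝ → ℝ × ℝ) : muJ X = Lmu (fderiv ℝ X 0) := rfl
theorem rJ_eq (X : ℝ × ℝ → ℝ × ℝ) : rJ X = Lr (fderiv ℝ X 0) := rfl
theorem jac21_eq (X : ℝ × ℝ → ℝ × ℝ) : jac21 X = L21 (fderiv ℝ X 0) := rfl

theorem L11_cont : Continuous L11 := by unfold L11; fun_prop
theorem L12_cont : Continuous L12 := by unfold L12; fun_prop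
theorem L21_cont : Continuous L21 := by unfold L21; fun_prop
theorem L22_cont : Continuous L22 := by unfold L22; fun_prop
theorem Ltr_cont : Continuous Ltr := L11_cont.add L22_cont
theorem Ldet_cont : Continuous Ldet := (L11_cont.mul L22_cont).sub (L12_cont.mul L21_cont)
theorem Ldisc_cont : Continuous Ldisc := (Ltr_cont.pow 2).sub (continuous_const.mul Ldet_cont)
theorem Llam_cont : Continuous Llam := (Ltr_cont.add Ldisc_cont.sqrt).div_const 2
theorem Lmu_cont : Continuous Lmu := (Ltr_cont.sub Ldisc_cont.sqrt).div_const 2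
theorem Lr_cont {L : Lin} (h : Ldisc L < 0) : ContinuousAt Lr L :=
  Ltr_cont.continuousAt.div Ldisc_cont.neg.sqrt.continuousAt
    (Real.sqrt_pos.mpr (by linarith : 0 < -Ldisc L)).ne'

theorem Llam_mul {L : Lin} (h : 0 ≤ Ldisc L) : Llam L * Lmu L = Ldet L := by
  have hq2 := Real.sq_sqrt h
  have : Llam L * Lmu L = (Ltr L ^ 2 - √(Ldisc L) ^ 2) / 4 := by rw [Llam, Lmu]; ring
  rw [this, hq2, Ldisc]; ring

theorem eventually_same {L : Lin} (hd : Ldet L ≠ 0) (h : Ldisc L ≠ 0) : ∀ᶠ L' in nhds L,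
    (Ldisc L' < 0 ∧ Ldisc L < 0) ∨ (0 < Ldisc L' ∧ 0 < Ldisc L ∧ 0 < Llam L' * Llam L ∧
      0 < Lmu L' * Lmu L) := by
  rcases lt_or_gt_of_ne h with h | h
  · filter_upwards [Ldisc_cont.continuousAt.eventually (gt_mem_nhds h)] with L' h'
    exact Or.inl ⟨h', h⟩
  · have hm := Llam_mul h.le
    have h1 : Llam L ≠ 0 := fun h => hd (by rw [← hm, h, zero_mul])
    have h2 : Lmu L ≠ 0 := fun h => hd (by rw [← hm, h, mul_zero])
    filter_upwards [Ldisc_cont.continuousAt.eventually (lt_mem_nhds h),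
      (Llam_cont.mul continuous_const).continuousAt.eventually
        (lt_mem_nhds (mul_self_pos.mpr h1 : 0 < Llam L * Llam L)),
      (Lmu_cont.mul continuous_const).continuousAt.eventually
        (lt_mem_nhds (mul_self_pos.mpr h2 : 0 < Lmu L * Lmu L))] with L' h3 h4 h5
    exact Or.inr ⟨h3, h, h4, h5⟩

theorem nf_strict {Y : ℝ × ℝ → ℝ × ℝ} {L : Lin} (h : HasStrictFDerivAt Y L 0) :
    HasStrictFDerivAt (nf Y) L 0 := by
  have := conj_strict (ContinuousLinearEquiv.neg ℝ) h (L' := L) (fun p => by simp)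
  refine this.congr_of_eventuallyEq (Eventually.of_forall fun p => ?_)
  simp [nf]

theorem nf_fderiv {Y : ℝ × ℝ → ℝ × ℝ} {sg : ℝ} (h : Fld Y sg) :
    fderiv ℝ (nf Y) 0 = fderiv ℝ Y 0 := (nf_strict h.strict).hasFDerivAt.fderiv

theorem Fld.nf {Y : ℝ × ℝ → ℝ × ℝ} {sg : ℝ} (h : Fld Y sg) : Fld (nf Y) sg where
  strict := by rw [nf_fderiv h]; exact nf_strict h.strict
  zero := by simp [_root_.nf, h.zero]
  det := by rw [detJ_eq, nf_fderiv h]; exact h.det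
  sg_sq := h.sg_sq
  sg_pos := by rw [jac21_eq, nf_fderiv h]; exact h.sg_pos

theorem strict_of {U : Set (ℝ × ℝ)} {X : ℝ × ℝ → ℝ × ℝ} (hU : IsOpen U) (h0 : (0, 0) ∈ U)
    (h : ContDiffOn ℝ 1 X U) : HasStrictFDerivAt X (fderiv ℝ X 0) 0 :=
  (h.contDiffAt (hU.mem_nhds h0)).hasStrictFDerivAt (by norm_num)

theorem flds_of {U : Set (ℝ × ℝ)} {X Y : ℝ × ℝ → ℝ × ℝ} (h : InOmega0 U X Y) {sg : ℝ}
    (hs : sg * sg = 1) (hX : 0 < sg * jac21 X) : Fld X sg ∧ Fld Y sg := by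
  obtain ⟨hU, h0, cX, cY, zX, zY, hd, hj⟩ := h
  refine ⟨⟨strict_of hU h0 cX, zX, left_ne_zero_of_mul hd, hs, hX⟩,
    ⟨strict_of hU h0 cY, zY, right_ne_zero_of_mul hd, hs, ?_⟩⟩
  by_contra hcon
  push Not at hcon
  have h1 : sg * jac21 X * (sg * jac21 Y) = jac21 X * jac21 Y := by linear_combination jac21 X * jac21 Y * hs
  have := mul_nonpos_of_nonneg_of_nonpos hX.le hcon
  linarith

theorem exists_sg {a : ℝ} (ha : a ≠ 0) : ∃ sg : ℝ, sg * sg = 1 ∧ 0 < sg * a := by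
  rcases lt_or_gt_of_ne ha with h | h
  · exact ⟨-1, by norm_num, by linarith⟩
  · exact ⟨1, by norm_num, by linarith⟩

theorem eig_ne_iff (X : ℝ × ℝ → ℝ × ℝ) : eig1 X ≠ eig2 X ↔ discJ X ≠ 0 := by
  rw [not_iff_not]
  change _ ↔ trJ X ^ 2 - 4 * detJ X = 0
  simp only [eig1, eig2]
  split_ifs with h
  · rw [Complex.ofReal_inj]
    constructor
    · intro he
      have : √(trJ X ^ 2 - 4 * detJ X) = 0 := by linarith
      rwa [Real.sqrt_eq_zero h] at this
    · intro he; rw [he]; simp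
  · push Not at h
    have hq := Real.sqrt_pos.mpr (by linarith : 0 < 4 * detJ X - trJ X ^ 2)
    constructor
    · intro he
      have := congrArg Complex.im he
      simp at this
      linarith
    · intro he; linarith

theorem eig_im (X : ℝ × ℝ → ℝ × ℝ) : (eig1 X).im = 0 ↔ 0 ≤ discJ X := by
  change _ ↔ 0 ≤ trJ X ^ 2 - 4 * detJ X
  simp only [eig1]
  split_ifs with h
  · simp only [Complex.ofReal_im, h]
  · push Not at h
    have hq := Real.sqrt_pos.mpr (by linarith : 0 < 4 * detJ X - trJ X ^ 2)
    constructor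
    · intro he
      simp at he
      linarith
    · intro he; linarith

theorem eig_r {X : ℝ × ℝ → ℝ × ℝ} (h : discJ X < 0) : (eig1 X).re / |(eig1 X).im| = rJ X := by
  have h' : ¬ 0 ≤ trJ X ^ 2 - 4 * detJ X := not_le.mpr h
  have hq := Real.sqrt_pos.mpr (by linarith : 0 < -discJ X)
  have e : 4 * detJ X - trJ X ^ 2 = -discJ X := by rw [discJ]; ring
  have h1 : (eig1 X).re = trJ X / 2 := by
    simp only [eig1, if_neg h']; simp
  have h2 : (eig1 X).im = √(-discJ X) / 2 := by
    simp only [eig1, if_neg h', e]; simp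
  rw [h1, h2, abs_of_pos (by linarith), rJ]
  field_simp

theorem ellVal_focus {X Y : ℝ × ℝ → ℝ × ℝ} (h : discJ X < 0) (h' : discJ Y < 0) :
    ellVal X Y = rJ X + rJ Y := by
  rw [ellVal, if_pos, eig_r h, eig_r h']
  exact mul_ne_zero (fun he => by rw [eig_im] at he; linarith) (fun he => by rw [eig_im] at he; linarith)

theorem generic_stable {U : Set (ℝ × ℝ)} {X Y : ℝ × ℝ → ℝ × ℝ} (hZ : InOmega0 U X Y)
    (h1 : eig1 X ≠ eig2 X) (h2 : eig1 Y ≠ eig2 Y) (h3 : ellVal X Y ≠ 0) :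
    ∃ ε > (0 : ℝ), ∀ X' Y' : ℝ × ℝ → ℝ × ℝ, InOmega0 U X' Y' →
      ‖fderiv ℝ X 0 - fderiv ℝ X' 0‖ < ε → ‖fderiv ℝ Y 0 - fderiv ℝ Y' 0‖ < ε →
      LocalSigmaEquiv X' Y' X Y := by
  rw [eig_ne_iff] at h1 h2
  have ha : jac21 X ≠ 0 := left_ne_zero_of_mul hZ.2.2.2.2.2.2.2.ne'
  obtain ⟨sg, hs, hsX⟩ := exists_sg ha
  obtain ⟨fX, fY⟩ := flds_of hZ hs hsX
  set L := fderiv ℝ X 0 with hL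
  set M := fderiv ℝ Y 0 with hM
  have ev1 := eventually_same (L := L) fX.det h1
  have ev2 := eventually_same (L := M) fY.det h2
  have ev3 : ∀ᶠ L' in nhds L, 0 < sg * L21 L' :=
    (continuous_const.mul L21_cont).continuousAt.eventually (lt_mem_nhds hsX)
  have ev4 : ∀ᶠ q : Lin × Lin in nhds (L, M), discJ X < 0 → discJ Y < 0 →
      0 < (Lr q.1 + Lr q.2) * (Lr L + Lr M) := by
    by_cases hc : discJ X < 0 ∧ discJ Y < 0
    · obtain ⟨c1, c2⟩ := hc
      rw [ellVal_focus c1 c2] at h3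
      have c : ContinuousAt (fun q : Lin × Lin => (Lr q.1 + Lr q.2) * (Lr L + Lr M)) (L, M) := by
        have k1 : ContinuousAt (fun q : Lin × Lin => Lr q.1) (L, M) :=
          ContinuousAt.comp (g := Lr) (f := Prod.fst) (x := (L, M)) (Lr_cont c1) continuousAt_fst
        have k2 : ContinuousAt (fun q : Lin × Lin => Lr q.2) (L, M) :=
          ContinuousAt.comp (g := Lr) (f := Prod.snd) (x := (L, M)) (Lr_cont c2) continuousAt_snd
        exact (k1.add k2).mul continuousAt_const
      have := c.eventually (lt_mem_nhds (mul_self_pos.mpr h3 : 0 < (Lr L + Lr M) * (Lr L + Lr M)))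
      exact this.mono fun q hq _ _ => hq
    · exact Eventually.of_forall fun q c1 c2 => absurd ⟨c1, c2⟩ hc
  obtain ⟨ε₁, hε₁, k1⟩ := Metric.eventually_nhds_iff.mp (ev1.and ev3)
  obtain ⟨ε₂, hε₂, k2⟩ := Metric.eventually_nhds_iff.mp ev2
  obtain ⟨ε₄, hε₄, k4⟩ := Metric.eventually_nhds_iff.mp ev4
  refine ⟨min ε₁ (min ε₂ ε₄), lt_min hε₁ (lt_min hε₂ hε₄), fun X' Y' hZ' dX dY => ?_⟩
  have dX' : dist (fderiv ℝ X' 0) L < min ε₁ (min ε₂ ε₄) := by rwa [dist_comm, dist_eq_norm]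
  have dY' : dist (fderiv ℝ Y' 0) M < min ε₁ (min ε₂ ε₄) := by rwa [dist_comm, dist_eq_norm]
  obtain ⟨tX, sX⟩ := k1 (dX'.trans_le (min_le_left _ _))
  have tY := k2 (dY'.trans_le ((min_le_right _ _).trans (min_le_left _ _)))
  have hr := k4 (y := (fderiv ℝ X' 0, fderiv ℝ Y' 0)) (by
    rw [Prod.dist_eq]
    exact max_lt (dX'.trans_le ((min_le_right _ _).trans (min_le_right _ _)))
      (dY'.trans_le ((min_le_right _ _).trans (min_le_right _ _))))
  obtain ⟨fX', fY'⟩ := flds_of hZ' hs sX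
  refine equiv_of_same fX' fY'.nf fX fY.nf tX ?_ ?_
  · simp only [SameT, discJ_eq, lamJ_eq, muJ_eq, nf_fderiv fY, nf_fderiv fY']
    exact tY
  · intro d e
    rw [discJ_eq, nf_fderiv fY'] at e
    simp only [rJ_eq, nf_fderiv fY, nf_fderiv fY']
    refine hr ?_ ?_
    · rcases tX with h | h
      · exact h.2
      · have := h.1
        rw [discJ_eq] at d
        linarith
    · rcases tY with h | h
      · exact h.2
      · have := h.1
        linarith


/-! ### M14: arcs -/

def Arc (X : ℝ × ℝ → ℝ × ℝ) (S : Set (ℝ × ℝ)) (p q : ℝ × ℝ) : Prop :=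
  ∃ (γ : ℝ → ℝ × ℝ) (t₀ t₁ : ℝ), t₀ < t₁ ∧ IsSolutionOn X γ (Icc t₀ t₁) ∧
    (∀ t ∈ Icc t₀ t₁, γ t ∈ S) ∧ γ t₀ = p ∧ γ t₁ = q

def LHP : Set (ℝ × ℝ) := {p | p.2 ≤ 0}

theorem Arc.mem_left {X : ℝ × ℝ → ℝ × ℝ} {S : Set (ℝ × ℝ)} {p q : ℝ × ℝ} (h : Arc X S p q) :
    p ∈ S := by
  obtain ⟨γ, t₀, t₁, h1, h2, h3, rfl, rfl⟩ := h
  exact h3 _ ⟨le_refl t₀, h1.le⟩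

theorem Arc.mem_right {X : ℝ × ℝ → ℝ × ℝ} {S : Set (ℝ × ℝ)} {p q : ℝ × ℝ} (h : Arc X S p q) :
    q ∈ S := by
  obtain ⟨γ, t₀, t₁, h1, h2, h3, rfl, rfl⟩ := h
  exact h3 _ ⟨h1.le, le_refl t₁⟩

theorem Arc.mono {X : ℝ × ℝ → ℝ × ℝ} {S S' : Set (ℝ × ℝ)} {p q : ℝ × ℝ} (h : Arc X S p q)
    (hS : S ⊆ S') : Arc X S' p q := by
  obtain ⟨γ, t₀, t₁, h1, h2, h3, h4, h5⟩ := h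
  exact ⟨γ, t₀, t₁, h1, h2, fun t ht => hS (h3 t ht), h4, h5⟩

theorem Arc.of_aux {X : ℝ × ℝ → ℝ × ℝ} {S : Set (ℝ × ℝ)} {c : ℝ → ℝ × ℝ} {t₀ t₁ : ℝ} (h : t₀ < t₁)
    (hc : ∀ t ∈ Icc t₀ t₁, c t ∈ S) (ho : OC X c (Icc t₀ t₁)) : Arc X S (c t₀) (c t₁) := by
  obtain ⟨δ, J, τ, h1, h2, h3, h4, h5, h6⟩ := ho
  have m0 : t₀ ∈ Icc t₀ t₁ := ⟨le_refl t₀, h.le⟩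
  have m1 : t₁ ∈ Icc t₀ t₁ := ⟨h.le, le_refl t₁⟩
  have hsub : Icc (τ t₀) (τ t₁) ⊆ J := h1.out (h3.mapsTo m0) (h3.mapsTo m1)
  refine ⟨δ, τ t₀, τ t₁, h4 m0 m1 h, fun t ht => h2 t (hsub ht), fun s hs => ?_,
    (h6 _ m0).symm, (h6 _ m1).symm⟩
  obtain ⟨t, ht, rfl⟩ := h3.surjOn (hsub hs)
  rw [← h6 t ht]
  exact hc t ht

theorem Arc.map {X X' : ℝ × ℝ → ℝ × ℝ} {H : ℝ × ℝ → ℝ × ℝ} {S S' S₁ S₂ : Set (ℝ × ℝ)}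
    (h : MapsOrbits X X' H S S') {p q : ℝ × ℝ} (ha : Arc X S₁ p q) (hS : S₁ ⊆ S)
    (hm : ∀ p ∈ S₁, H p ∈ S₂) : Arc X' S₂ (H p) (H q) := by
  obtain ⟨γ, t₀, t₁, h1, h2, h3, rfl, rfl⟩ := ha
  obtain ⟨δ, J, τ, k1, k2, k3, k4, k5, k6, k7⟩ := h γ (Icc t₀ t₁) ordConnected_Icc h2
    (fun t ht => hS (h3 t ht))
  exact Arc.of_aux (c := fun t => H (γ t)) h1 (fun t ht => hm _ (h3 t ht))
    ⟨δ, J, τ, k1, k2, k4, k5, k6, k7⟩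

theorem Arc.nf_iff {Y : ℝ × ℝ → ℝ × ℝ} {W : Set (ℝ × ℝ)} {p q : ℝ × ℝ} (h : Arc Y (W ∩ LHP) p q) :
    Arc (nf Y) ((-W) ∩ UHP) (-p) (-q) := by
  obtain ⟨γ, t₀, t₁, h1, h2, h3, rfl, rfl⟩ := h
  refine ⟨fun t => - γ t, t₀, t₁, h1, fun t ht => ?_, fun t ht => ⟨?_, ?_⟩, rfl, rfl⟩
  · have h : HasDerivAt (fun t => -γ t) _ t := (h2 t ht).neg
    refine h.congr_deriv ?_
    simp only [nf, neg_neg]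
  · simpa using (h3 t ht).1
  · have : (γ t).2 ≤ 0 := (h3 t ht).2
    show 0 ≤ (-γ t).2
    simpa using this

theorem Arc.nf_iff_rev {Y : ℝ × ℝ → ℝ × ℝ} {W : Set (ℝ × ℝ)} {p q : ℝ × ℝ}
    (h : Arc (nf Y) (W ∩ UHP) p q) : Arc Y ((-W) ∩ LHP) (-p) (-q) := by
  obtain ⟨γ, t₀, t₁, h1, h2, h3, rfl, rfl⟩ := h
  refine ⟨fun t => - γ t, t₀, t₁, h1, fun t ht => ?_, fun t ht => ⟨?_, ?_⟩, rfl, rfl⟩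
  · have h : HasDerivAt (fun t => -γ t) _ t := (h2 t ht).neg
    refine h.congr_deriv ?_
    simp only [nf, neg_neg]
  · simpa using (h3 t ht).1
  · have : 0 ≤ (γ t).2 := (h3 t ht).2
    show (-γ t).2 ≤ 0
    simpa using this

/-! existence and uniqueness of focus arcs -/

theorem focus_arcs {X : ℝ × ℝ → ℝ × ℝ} {sg ε : ℝ} (hX : Fld X sg) (hd : discJ X < 0) (hε : 0 < ε) :
    ∃ P : ℝ ≃o ℝ, (∀ s, |P s - s - Real.pi * rJ X| ≤ ε) ∧
      (∀ W ∈ nhds (0 : ℝ × ℝ), ∃ s₁, ∀ s ≤ s₁,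
        Arc X (W ∩ UHP) (sg * Real.exp s, 0) (-(sg * Real.exp (P s)), 0)) ∧
      ∃ W ∈ nhds (0 : ℝ × ℝ), ∀ x₀ x₁ : ℝ, x₀ ≠ 0 → Arc X (W ∩ UHP) (x₀, 0) (x₁, 0) →
        ∃ s, x₀ = sg * Real.exp s ∧ x₁ = -(sg * Real.exp (P s)) := by
  obtain ⟨T, r, hr, A, G, c₀, C₁, M, K, F, B, P, h1, h2, h3, h4, h5, h6, h7, h8⟩ :=
    focus_data hX hd hε
  have hp := Real.pi_pos
  have hg := h3.good
  have hTz : ∀ p, T (X (T.symm (T p))) = T (X p) := fun p => by simp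
  have hs := hX.sg_sq
  refine ⟨P, h8, fun W hW => ?_, ?_⟩
  · have hW' : (T.symm : ℂ → ℝ × ℝ) ⁻¹' W ∈ nhds (0 : ℂ) :=
      T.symm.continuous.continuousAt.preimage_mem_nhds (by rwa [map_zero])
    obtain ⟨ρ, hρ, hρW⟩ := Metric.nhds_basis_closedBall.mem_iff.mp hW'
    set ρ' := min ρ r with hρ'
    have hρ0 : 0 < ρ' := lt_min hρ hr
    refine ⟨Real.log ρ' - M * Real.pi, fun s hs1 => ?_⟩
    have hM := hg.M_nonneg
    set c : ℝ → ℂ := fun θ => fP (θ, F θ (-(Real.pi / 2)) s) with hc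
    set I := Icc (-(Real.pi / 2)) (Real.pi / 2) with hI
    have hcn : ∀ θ ∈ I, ‖c θ‖ ≤ ρ' := fun θ hθ => by
      simp only [hc, fP_norm]
      rw [← Real.le_log_iff_exp_le hρ0]
      have k1 := h4.speed hg θ (-(Real.pi / 2)) (-(Real.pi / 2)) s
      rw [h4.init] at k1
      have k2 : |θ - -(Real.pi / 2)| ≤ Real.pi := by
        rw [abs_le]; constructor <;> linarith [hθ.1, hθ.2]
      have k3 := mul_le_mul_of_nonneg_left k2 hM
      have k4 := le_abs_self (F θ (-(Real.pi / 2)) s - s)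
      show F θ (-(Real.pi / 2)) s ≤ Real.log ρ'
      linarith
    have hfa : ∀ θ ∈ I, fa (c θ) = θ := fun θ hθ =>
      fa_fP _ (show -Real.pi < θ by linarith [hθ.1]) (show θ ≤ Real.pi by linarith [hθ.2])
    have hfb : ∀ θ, fb (c θ) = F θ (-(Real.pi / 2)) s := fun θ => fb_fP _
    have him : ∀ θ ∈ I, 0 ≤ (c θ).im := fun θ hθ => by
      simp only [hc, fP_im]
      exact mul_nonneg (Real.exp_pos _).le (Real.cos_nonneg_of_mem_Icc hθ)
    have hcc : Continuous c := by
      have := h4.cont_t (-(Real.pi / 2)) s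
      simp only [hc, fP]
      fun_prop
    have hoc : OC (fun z => T (X (T.symm z))) c I := by
      refine (h3.iff h4 (-(Real.pi / 2)) (c := c) ordConnected_Icc hcc.continuousOn
        (fun θ hθ => ⟨fP_ne _, him θ hθ, (hcn θ hθ).trans (min_le_right _ _)⟩)).mpr ⟨?_, ?_⟩
      · have hh : ∀ t ∈ I, F (-(Real.pi / 2)) (fa (c t)) (fb (c t)) = s := fun t ht => by
          rw [hfa t ht, hfb]; exact h4.inv hg _ _ _
        intro t ht t' ht'
        rw [hh t ht, hh t' ht']
      · intro t ht t' ht' htt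
        show fa (c t) < fa (c t')
        rw [hfa t ht, hfa t' ht']; exact htt
    have hoc2 : OC X (fun t => T.symm (c t)) I := by
      refine (OC.conj_iff T (X' := fun z => T (X (T.symm z))) hTz).mp ?_
      simpa using hoc
    have hsym : ∀ y : ℝ, T.symm (y : ℂ) = (sg * y, 0) := fun y => by
      rw [T.symm_apply_eq, h2, ← mul_assoc, hs, one_mul]
    have e0 : T.symm (c (-(Real.pi / 2))) = (sg * Real.exp s, 0) := by
      rw [← hsym]
      congr 1
      apply Complex.ext
      · simp only [hc, fP_re, h4.init]; simp; rfl
      · simp only [hc, fP_im, h4.init]; simp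
    have e1 : T.symm (c (Real.pi / 2)) = (-(sg * Real.exp (P s)), 0) := by
      rw [show -(sg * Real.exp (P s)) = sg * (-Real.exp (P s)) by ring, ← hsym]
      congr 1
      apply Complex.ext
      · simp only [hc, fP_re, ← h6]; simp; rfl
      · simp only [hc, fP_im, ← h6]; simp
    rw [← e0, ← e1]
    refine Arc.of_aux (c := fun t => T.symm (c t)) (by linarith) (fun t ht => ⟨?_, ?_⟩) hoc2
    · apply hρW
      rw [mem_closedBall_zero_iff]
      exact (hcn t ht).trans (min_le_left _ _)
    · show 0 ≤ (T.symm (c t)).2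
      rw [h1]; simpa using him t ht
  · refine ⟨(T : ℝ × ℝ → ℂ) ⁻¹' Metric.closedBall 0 r,
      T.continuous.continuousAt.preimage_mem_nhds
        (by rw [map_zero]; exact Metric.closedBall_mem_nhds _ hr), ?_⟩
    rintro x₀ x₁ hx₀ ⟨γ, t₀, t₁, ht, hsol, hmem, e0, e1⟩
    have m0 : t₀ ∈ Icc t₀ t₁ := ⟨le_refl t₀, ht.le⟩
    have m1 : t₁ ∈ Icc t₀ t₁ := ⟨ht.le, le_refl t₁⟩
    have hoc : OC (fun z => T (X (T.symm z))) (fun t => T (γ t)) (Icc t₀ t₁) :=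
      (OC.conj_iff T (X' := fun z => T (X (T.symm z))) hTz).mpr (OC.of_sol ordConnected_Icc hsol)
    have hn : ∀ t ∈ Icc t₀ t₁, ‖T (γ t)‖ ≤ r := fun t ht => by
      have := (hmem t ht).1
      rwa [mem_preimage, mem_closedBall_zero_iff] at this
    have hne : ∀ t ∈ Icc t₀ t₁, T (γ t) ≠ 0 := fun t ht h0 => by
      have := hoc.eq_zero (W := {z | ‖z‖ ≤ r}) (K := B) h5 hn ht h0 t₀ m0
      simp only [EmbeddingLike.map_eq_zero_iff, e0, Prod.mk_eq_zero] at this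
      exact hx₀ this.1
    have hcont : ContinuousOn (fun t => T (γ t)) (Icc t₀ t₁) := fun t ht =>
      (T.continuous.continuousAt.comp (hsol t ht).continuousAt).continuousWithinAt
    obtain ⟨hF1, hmono⟩ := (h3.iff h4 (Real.pi / 2) (c := fun t => T (γ t)) ordConnected_Icc hcont
      (fun t ht => ⟨hne t ht, (h1 _).mp (hmem t ht).2, hn t ht⟩)).mp hoc
    have q0 : T (γ t₀) = ((sg * x₀ : ℝ) : ℂ) := by rw [e0, h2]
    have q1 : T (γ t₁) = ((sg * x₁ : ℝ) : ℂ) := by rw [e1, h2]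
    have n0 : sg * x₀ ≠ 0 := fun h => hne t₀ m0 (by rw [q0, h]; simp)
    have n1 : sg * x₁ ≠ 0 := fun h => hne t₁ m1 (by rw [q1, h]; simp)
    have hlt : fa (T (γ t₀)) < fa (T (γ t₁)) := hmono m0 m1 ht
    have hF2 : F (Real.pi / 2) (fa (T (γ t₀))) (fb (T (γ t₀)))
      = F (Real.pi / 2) (fa (T (γ t₁))) (fb (T (γ t₁))) := hF1 t₀ m0 t₁ m1
    rw [q0, q1] at hlt hF2
    have p0 : 0 < sg * x₀ := by
      rcases lt_or_gt_of_ne n0 with h | h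
      · rw [fa_neg h] at hlt
        rcases lt_or_gt_of_ne n1 with h' | h'
        · rw [fa_neg h'] at hlt; exact absurd hlt (lt_irrefl _)
        · rw [fa_pos h'] at hlt; linarith
      · exact h
    rw [fa_pos p0] at hlt hF2
    have p1 : sg * x₁ < 0 := by
      rcases lt_or_gt_of_ne n1 with h' | h'
      · exact h'
      · rw [fa_pos h'] at hlt; exact absurd hlt (lt_irrefl _)
    rw [fa_neg p1, h4.init, fb_eq, fb_eq, ← h6, Complex.norm_real, Complex.norm_real,
      Real.norm_eq_abs, Real.norm_eq_abs, abs_of_pos p0, abs_of_neg p1] at hF2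
    refine ⟨Real.log (sg * x₀), ?_, ?_⟩
    · rw [Real.exp_log p0, ← mul_assoc, hs, one_mul]
    · rw [hF2, Real.exp_log (by linarith)]
      have : sg * (sg * x₁) = x₁ := by rw [← mul_assoc, hs, one_mul]
      linarith


/-! ### M15: nodes have no half-turn arcs -/

theorem deriv_pos_right {φ : ℝ → ℝ} {c s : ℝ} (h : HasDerivAt φ c s) (hc : c < 0) (h0 : φ s = 0)
    {b : ℝ} (hb : s < b) : ∃ x, s < x ∧ x < b ∧ φ x < 0 := by
  have h1 : HasDerivAt (fun u => φ (-u)) (-c) (-s) := by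
    have h' : HasDerivAt φ c (-(-s)) := by rwa [neg_neg]
    exact (h'.scomp (-s) (hasDerivAt_neg (-s))).congr_deriv (by simp)
  obtain ⟨x, hx1, hx2, hx3⟩ := deriv_pos_left h1 (by linarith) (by simpa using h0) (neg_lt_neg hb)
  exact ⟨-x, by linarith, by linarith, hx3⟩

theorem node_no_arc {X : ℝ × ℝ → ℝ × ℝ} {l m : ℝ} (hX : HasStrictFDerivAt X (dg l m) 0)
    (h0 : X 0 = 0) (hlm : m < l) : ∃ r > 0, ∀ (γ : ℝ → ℝ × ℝ) (t₀ t₁ : ℝ), t₀ < t₁ →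
      IsSolutionOn X γ (Icc t₀ t₁) → (∀ t ∈ Icc t₀ t₁, γ t ∈ HP ∧ ‖γ t‖ ≤ r) →
      (γ t₀).1 + (γ t₀).2 = 0 → (γ t₁).1 + (γ t₁).2 = 0 → γ t₀ = 0 := by
  obtain ⟨r₁, hr₁, -, hrem⟩ := remainder_exists hX h0 (η := (l - m) / 4) (by linarith)
  obtain ⟨r₂, hr₂, hcr⟩ := cross_radius hX h0 hlm
  obtain ⟨r₃, hr₃, hgr⟩ := growth hX h0
  refine ⟨min r₁ (min r₂ r₃), lt_min hr₁ (lt_min hr₂ hr₃), ?_⟩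
  intro γ t₀ t₁ ht hsol hmem e0 e1
  by_contra hne0
  have m0 : t₀ ∈ Icc t₀ t₁ := ⟨le_refl t₀, ht.le⟩
  have m1 : t₁ ∈ Icc t₀ t₁ := ⟨ht.le, le_refl t₁⟩
  have hn : ∀ t ∈ Icc t₀ t₁, ‖γ t‖ ≤ r₁ ∧ ‖γ t‖ ≤ r₂ ∧ ‖γ t‖ ≤ r₃ := fun t h =>
    ⟨(hmem t h).2.trans (min_le_left _ _),
      (hmem t h).2.trans ((min_le_right _ _).trans (min_le_left _ _)),
      (hmem t h).2.trans ((min_le_right _ _).trans (min_le_right _ _))⟩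
  have hoc := OC.of_sol ordConnected_Icc hsol
  have hne : ∀ t ∈ Icc t₀ t₁, γ t ≠ 0 := fun t h hz =>
    hne0 (hoc.eq_zero (W := {z | ‖z‖ ≤ r₃}) hgr (fun t h => (hn t h).2.2) h hz t₀ m0)
  -- sign of the derivative of the sum
  have hder : ∀ t ∈ Icc t₀ t₁, HasDerivAt (fun t => (γ t).1 + (γ t).2)
      ((X (γ t)).1 + (X (γ t)).2) t := fun t h => by
    have k := hsol t h
    have k1 := (ContinuousLinearMap.fst ℝ ℝ ℝ).hasFDerivAt.comp_hasDerivAt t k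
    have k2 := (ContinuousLinearMap.snd ℝ ℝ ℝ).hasFDerivAt.comp_hasDerivAt t k
    exact k1.add k2
  have hest : ∀ t ∈ Icc t₀ t₁, (γ t).1 + (γ t).2 = 0 →
      |(X (γ t)).1 + (X (γ t)).2 - (l - m) * (γ t).1| ≤ (l - m) / 2 * |(γ t).1| := fun t h hz => by
    have k := hrem (γ t) (hn t h).1
    have e2 : (γ t).2 = -(γ t).1 := by linarith
    have kn : ‖γ t‖ = |(γ t).1| := by
      rw [Prod.norm_def, e2]; simp
    rw [kn, dg_apply] at k
    have k1 := (norm_fst_le _).trans k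
    have k2 := (norm_snd_le _).trans k
    simp only [Prod.fst_sub, Prod.snd_sub, Real.norm_eq_abs] at k1 k2
    rw [e2] at k2
    have k3 := abs_add_le ((X (γ t)).1 - l * (γ t).1) ((X (γ t)).2 - m * -(γ t).1)
    have e3 : (X (γ t)).1 - l * (γ t).1 + ((X (γ t)).2 - m * -(γ t).1)
      = (X (γ t)).1 + (X (γ t)).2 - (l - m) * (γ t).1 := by ring
    rw [e3] at k3
    linarith
  have hnz : ∀ t ∈ Icc t₀ t₁, (γ t).1 + (γ t).2 = 0 → (γ t).1 ≠ 0 := fun t h hz h1 => by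
    apply hne t h
    apply Prod.ext
    · exact h1
    · show (γ t).2 = 0
      linarith
  have p0 : 0 < (γ t₀).1 := by
    by_contra hle
    have hlt : (γ t₀).1 < 0 := lt_of_le_of_ne (not_lt.mp hle) (hnz t₀ m0 e0)
    have k := (abs_le.mp (hest t₀ m0 e0)).2
    rw [abs_of_neg hlt] at k
    obtain ⟨x, hx1, hx2, hx3⟩ := deriv_pos_right (hder t₀ m0) (by nlinarith) e0 ht
    have : 0 ≤ (γ x).1 + (γ x).2 := (hmem x ⟨hx1.le, hx2.le⟩).1
    linarith
  have p1 : (γ t₁).1 < 0 := by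
    by_contra hle
    have hlt : 0 < (γ t₁).1 := lt_of_le_of_ne (not_lt.mp hle) (hnz t₁ m1 e1).symm
    have k := (abs_le.mp (hest t₁ m1 e1)).1
    rw [abs_of_pos hlt] at k
    obtain ⟨x, hx1, hx2, hx3⟩ := deriv_pos_left (hder t₁ m1) (by nlinarith) e1 ht
    have : 0 ≤ (γ x).1 + (γ x).2 := (hmem x ⟨hx1.le, hx2.le⟩).1
    linarith
  have := hoc.pos_after (W := {p | ‖p‖ ≤ r₂ ∧ p ≠ 0 ∧ 0 ≤ p.1 + p.2})
    (f := ContinuousLinearMap.fst ℝ ℝ ℝ - ContinuousLinearMap.snd ℝ ℝ ℝ)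
    (fun p hp h => hcr p hp.1 hp.2.1 hp.2.2 h)
    (fun t h => ⟨(hn t h).2.1, hne t h, (hmem t h).1⟩) m0 m1 ht
    (show 0 ≤ (γ t₀).1 - (γ t₀).2 by linarith)
  have h' : 0 < (γ t₁).1 - (γ t₁).2 := this
  linarith

theorem node_arcs {X : ℝ × ℝ → ℝ × ℝ} {sg : ℝ} (hX : Fld X sg) (hd : 0 < discJ X) :
    ∃ W ∈ nhds (0 : ℝ × ℝ), ∀ x₀ x₁ : ℝ, x₀ ≠ 0 → ¬ Arc X (W ∩ UHP) (x₀, 0) (x₁, 0) := by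
  obtain ⟨T, h1, h2, h3⟩ := node_coords hX hd
  have hlm : muJ X < lamJ X := by
    have := Real.sqrt_pos.mpr hd
    simp only [lamJ, muJ]; linarith
  obtain ⟨r, hr, hno⟩ := node_no_arc h1 (by simp [hX.zero]) hlm
  refine ⟨(T : ℝ × ℝ → ℝ × ℝ) ⁻¹' Metric.closedBall 0 r,
      T.continuous.continuousAt.preimage_mem_nhds
        (by rw [map_zero]; exact Metric.closedBall_mem_nhds _ hr), ?_⟩
  rintro x₀ x₁ hx₀ ⟨γ, t₀, t₁, ht, hsol, hmem, e0, e1⟩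
  have := hno (fun t => T (γ t)) t₀ t₁ ht (fun t h => ?_) (fun t h => ⟨(h2 _).mp (hmem t h).2, ?_⟩)
    (by show (T (γ t₀)).1 + (T (γ t₀)).2 = 0
        rw [e0, h3]; ring)
    (by show (T (γ t₁)).1 + (T (γ t₁)).2 = 0
        rw [e1, h3]; ring)
  · have h4 : T (γ t₀) = 0 := this
    simp only [EmbeddingLike.map_eq_zero_iff, e0, Prod.mk_eq_zero] at h4
    exact hx₀ h4.1
  · have := (T : (ℝ × ℝ) →L[ℝ] (ℝ × ℝ)).hasFDerivAt.comp_hasDerivAt t (hsol t h)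
    refine HasDerivAt.congr_deriv this ?_
    simp
  · have := (hmem t h).1
    rwa [mem_preimage, mem_closedBall_zero_iff] at this


/-! ### M16: topological invariants -/

def PropA (X : ℝ × ℝ → ℝ × ℝ) (S : Set (ℝ × ℝ)) : Prop :=
  ∀ W ∈ nhds (0 : ℝ × ℝ), ∃ x₀ x₁ : ℝ, x₀ ≠ 0 ∧ Arc X (W ∩ S) (x₀, 0) (x₁, 0)

def PropB (X Y : ℝ × ℝ → ℝ × ℝ) : Prop :=
  ∀ W ∈ nhds (0 : ℝ × ℝ), ∃ x₀ x₁ x₂ : ℝ, ((0 < x₂ ∧ x₂ < x₀) ∨ (x₀ < x₂ ∧ x₂ < 0)) ∧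
    Arc X (W ∩ UHP) (x₀, 0) (x₁, 0) ∧ Arc Y (W ∩ LHP) (x₁, 0) (x₂, 0)

theorem MapsOrbits.maps {X X' : ℝ × ℝ → ℝ × ℝ} {H : ℝ × ℝ → ℝ × ℝ} {S S' : Set (ℝ × ℝ)}
    (h : MapsOrbits X X' H S S') {p : ℝ × ℝ} (hp : p ∈ S) : H p ∈ S' := by
  have hd : HasDerivAt (fun t : ℝ => p + t • X p) (X p) 0 := by
    have := ((hasDerivAt_id (0 : ℝ)).smul_const (X p)).const_add p
    simpa using this
  obtain ⟨δ, J, τ, -, -, h3, h4, -, -, h7⟩ := h (fun t => p + t • X p) {0} ordConnected_singleton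
    (fun t ht => by
      rw [mem_singleton_iff] at ht
      subst ht
      simpa using hd)
    (fun t ht => by
      rw [mem_singleton_iff] at ht
      subst ht
      simpa using hp)
  have := h7 0 rfl
  simp only [zero_smul, add_zero] at this
  rw [this]
  exact h3 _ (h4.mapsTo rfl)

theorem LocalSigmaEquiv.symm {X Y X' Y' : ℝ × ℝ → ℝ × ℝ} (h : LocalSigmaEquiv X Y X' Y') :
    LocalSigmaEquiv X' Y' X Y := by
  obtain ⟨U₀, V₀, H, Hi, h1, h2, h3, h4, h5, h6, h7, h8, h9, h10, h11, h12, h13⟩ := h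
  have hm : MapsTo Hi V₀ U₀ := fun q hq => by
    obtain ⟨p, hp, rfl⟩ := h5.surjOn hq
    rw [h6 p hp]; exact hp
  refine ⟨V₀, U₀, Hi, H, h2, h1, h4, h3, ⟨hm, ?_, ?_⟩, h7, h6, ?_, ?_, h12, h13, h10, h11⟩
  · intro q hq q' hq' he
    rw [← h7 q hq, ← h7 q' hq', he]
  · intro p hp
    exact ⟨H p, h5.mapsTo hp, h6 p hp⟩
  · rw [← h8]
    exact (congrArg Hi h8).symm ▸ (by rw [h8]; exact (by
      have := h6 _ (mem_of_mem_nhds h1); rwa [h8] at this))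
  · rw [← h9, image_image]
    ext p
    constructor
    · rintro ⟨q, hq, rfl⟩
      show Hi (H q) ∈ _
      rw [h6 q hq.1]; exact hq
    · intro hp
      exact ⟨p, hp, h6 p hp.1⟩

theorem LocalSigmaEquiv.core {X Y X' Y' : ℝ × ℝ → ℝ × ℝ} (h : LocalSigmaEquiv X Y X' Y') :
    ∃ (U₀ V₀ : Set (ℝ × ℝ)) (H : ℝ × ℝ → ℝ × ℝ), U₀ ∈ nhds (0 : ℝ × ℝ) ∧ ContinuousOn H U₀ ∧
      H 0 = 0 ∧ InjOn H U₀ ∧ (∀ x : ℝ, (x, (0 : ℝ)) ∈ U₀ → H (x, 0) = ((H (x, 0)).1, 0)) ∧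
      MapsOrbits X X' H (U₀ ∩ UHP) (V₀ ∩ UHP) ∧ MapsOrbits Y Y' H (U₀ ∩ LHP) (V₀ ∩ LHP) := by
  obtain ⟨U₀, V₀, H, Hi, h1, h2, h3, h4, h5, h6, h7, h8, h9, h10, h11, h12, h13⟩ := h
  refine ⟨U₀, V₀, H, h1, h3, h8, h5.injOn, fun x hx => ?_, h10, h11⟩
  have : H (x, 0) ∈ V₀ ∩ {p : ℝ × ℝ | p.2 = 0} := by
    rw [← h9]; exact ⟨(x, 0), ⟨hx, rfl⟩, rfl⟩
  exact Prod.ext rfl this.2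

theorem propA_transfer {X X' H : ℝ × ℝ → ℝ × ℝ} {U₀ V₀ S : Set (ℝ × ℝ)} (h1 : U₀ ∈ nhds (0 : ℝ × ℝ))
    (h2 : ContinuousOn H U₀) (h3 : H 0 = 0) (h4 : InjOn H U₀)
    (h5 : ∀ x : ℝ, (x, (0 : ℝ)) ∈ U₀ → H (x, 0) = ((H (x, 0)).1, 0))
    (h6 : MapsOrbits X X' H (U₀ ∩ S) (V₀ ∩ S)) (hA : PropA X S) : PropA X' S := by
  intro W hW
  have hc : ContinuousAt H 0 := h2.continuousAt h1
  have hW' : U₀ ∩ H ⁻¹' W ∈ nhds (0 : ℝ × ℝ) :=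
    inter_mem h1 (hc.preimage_mem_nhds (by rwa [h3]))
  obtain ⟨x₀, x₁, hx, ha⟩ := hA _ hW'
  have hb : Arc X' (W ∩ S) (H (x₀, 0)) (H (x₁, 0)) :=
    Arc.map h6 ha (fun p hp => ⟨hp.1.1, hp.2⟩)
      (fun p hp => ⟨hp.1.2, (h6.maps ⟨hp.1.1, hp.2⟩).2⟩)
  have m0 := ha.mem_left.1.1
  have m1 := ha.mem_right.1.1
  refine ⟨(H (x₀, 0)).1, (H (x₁, 0)).1, fun h => hx ?_, ?_⟩
  · have k : H (x₀, 0) = H 0 := by rw [h5 _ m0, h, h3]; rfl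
    have := h4 m0 (mem_of_mem_nhds h1) k
    exact congrArg Prod.fst this
  · rw [← h5 _ m0, ← h5 _ m1]; exact hb

theorem propA_up {X Y X' Y' : ℝ × ℝ → ℝ × ℝ} (h : LocalSigmaEquiv X Y X' Y') (hA : PropA X UHP) :
    PropA X' UHP := by
  obtain ⟨U₀, V₀, H, h1, h2, h3, h4, h5, h6, h7⟩ := h.core
  exact propA_transfer h1 h2 h3 h4 h5 h6 hA

theorem propA_down {X Y X' Y' : ℝ × ℝ → ℝ × ℝ} (h : LocalSigmaEquiv X Y X' Y') (hA : PropA Y LHP) :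
    PropA Y' LHP := by
  obtain ⟨U₀, V₀, H, h1, h2, h3, h4, h5, h6, h7⟩ := h.core
  exact propA_transfer h1 h2 h3 h4 h5 h7 hA

theorem propB_transfer {X Y X' Y' : ℝ × ℝ → ℝ × ℝ} (h : LocalSigmaEquiv X Y X' Y')
    (hB : PropB X Y) : PropB X' Y' := by
  obtain ⟨U₀, V₀, H, h1, h2, h3, h4, h5, h6, h7⟩ := h.core
  intro W hW
  have hc : ContinuousAt H 0 := h2.continuousAt h1
  obtain ⟨ρ, hρ, hρU⟩ := Metric.nhds_basis_closedBall.mem_iff.mp h1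
  have hW' : (U₀ ∩ H ⁻¹' W) ∩ Metric.closedBall 0 ρ ∈ nhds (0 : ℝ × ℝ) :=
    inter_mem (inter_mem h1 (hc.preimage_mem_nhds (by rwa [h3]))) (Metric.closedBall_mem_nhds _ hρ)
  obtain ⟨x₀, x₁, x₂, hx, ha, hb⟩ := hB _ hW'
  have hIU : ∀ x ∈ Icc (-ρ) ρ, ((x, 0) : ℝ × ℝ) ∈ U₀ := fun x hx => by
    apply hρU
    rw [mem_closedBall_zero_iff, Prod.norm_def]
    simpa [abs_le, hρ.le] using hx
  have hIb : ∀ x : ℝ, ((x, 0) : ℝ × ℝ) ∈ Metric.closedBall 0 ρ → x ∈ Icc (-ρ) ρ := fun x hx => by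
    rw [mem_closedBall_zero_iff] at hx
    have := (norm_fst_le _).trans hx
    rwa [Real.norm_eq_abs, abs_le] at this
  set g : ℝ → ℝ := fun x => (H (x, 0)).1 with hg
  have hgc : ContinuousOn g (Icc (-ρ) ρ) := by
    have : ContinuousOn (fun x : ℝ => H (x, 0)) (Icc (-ρ) ρ) :=
      h2.comp (by fun_prop) hIU
    exact continuous_fst.comp_continuousOn this
  have hgi : InjOn g (Icc (-ρ) ρ) := by
    intro x hx y hy hxy
    have k : H (x, 0) = H (y, 0) := by
      rw [h5 _ (hIU x hx), h5 _ (hIU y hy)]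
      exact Prod.ext hxy rfl
    exact congrArg Prod.fst (h4 (hIU x hx) (hIU y hy) k)
  have m0 := hIb _ ha.mem_left.1.2
  have m1 := hIb _ ha.mem_right.1.2
  have m2 := hIb _ hb.mem_right.1.2
  have mz : (0 : ℝ) ∈ Icc (-ρ) ρ := ⟨by linarith, hρ.le⟩
  have hgz : g 0 = 0 := by
    show (H (0, 0)).1 = 0
    have : H (0, 0) = 0 := h3
    rw [this]; rfl
  have ha' : Arc X' (W ∩ UHP) (H (x₀, 0)) (H (x₁, 0)) :=
    Arc.map h6 ha (fun p hp => ⟨hp.1.1.1, hp.2⟩)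
      (fun p hp => ⟨hp.1.1.2, (h6.maps ⟨hp.1.1.1, hp.2⟩).2⟩)
  have hb' : Arc Y' (W ∩ LHP) (H (x₁, 0)) (H (x₂, 0)) :=
    Arc.map h7 hb (fun p hp => ⟨hp.1.1.1, hp.2⟩)
      (fun p hp => ⟨hp.1.1.2, (h7.maps ⟨hp.1.1.1, hp.2⟩).2⟩)
  rw [h5 _ (hIU _ m0), h5 _ (hIU _ m1)] at ha'
  rw [h5 _ (hIU _ m1), h5 _ (hIU _ m2)] at hb'
  refine ⟨g x₀, g x₁, g x₂, ?_, ha', hb'⟩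
  rcases ContinuousOn.strictMonoOn_of_injOn_Icc' (by linarith : -ρ ≤ ρ) hgc hgi with hm | hm
  · rcases hx with ⟨p, q⟩ | ⟨p, q⟩
    · exact Or.inl ⟨hgz ▸ hm mz m2 p, hm m2 m0 q⟩
    · exact Or.inr ⟨hm m0 m2 p, hgz ▸ hm m2 mz q⟩
  · rcases hx with ⟨p, q⟩ | ⟨p, q⟩
    · exact Or.inr ⟨hm m2 m0 q, hgz ▸ hm mz m2 p⟩
    · exact Or.inl ⟨hgz ▸ hm m2 mz q, hm m0 m2 p⟩

theorem neg_nhds_zero {W : Set (ℝ × ℝ)} (hW : W ∈ nhds (0 : ℝ × ℝ)) : -W ∈ nhds (0 : ℝ × ℝ) := by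
  have : ContinuousAt (fun p : ℝ × ℝ => -p) 0 := continuous_neg.continuousAt
  exact this.preimage_mem_nhds (by simpa using hW)

theorem propA_nf {Y : ℝ × ℝ → ℝ × ℝ} : PropA Y LHP ↔ PropA (nf Y) UHP := by
  constructor
  · intro h W hW
    obtain ⟨x₀, x₁, hx, ha⟩ := h _ (neg_nhds_zero hW)
    have := ha.nf_iff
    rw [neg_neg] at this
    exact ⟨-x₀, -x₁, neg_ne_zero.mpr hx, by simpa using this⟩
  · intro h W hW
    obtain ⟨x₀, x₁, hx, ha⟩ := h _ (neg_nhds_zero hW)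
    have := ha.nf_iff_rev
    rw [neg_neg] at this
    exact ⟨-x₀, -x₁, neg_ne_zero.mpr hx, by simpa using this⟩

theorem sg_ne {X : ℝ × ℝ → ℝ × ℝ} {sg : ℝ} (hX : Fld X sg) : sg ≠ 0 := fun h => by
  have := hX.sg_sq; rw [h] at this; norm_num at this

theorem propA_focus {X : ℝ × ℝ → ℝ × ℝ} {sg : ℝ} (hX : Fld X sg) (hd : discJ X < 0) :
    PropA X UHP := by
  obtain ⟨P, -, h, -⟩ := focus_arcs hX hd one_pos
  intro W hW
  obtain ⟨s, hs⟩ := h W hW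
  exact ⟨_, _, mul_ne_zero (sg_ne hX) (Real.exp_ne_zero _), hs s le_rfl⟩

theorem propA_node {X : ℝ × ℝ → ℝ × ℝ} {sg : ℝ} (hX : Fld X sg) (hd : 0 < discJ X) :
    ¬ PropA X UHP := by
  obtain ⟨W, hW, h⟩ := node_arcs hX hd
  intro hA
  obtain ⟨x₀, x₁, hx, ha⟩ := hA W hW
  exact h x₀ x₁ hx ha

theorem nf_disc {Y : ℝ × ℝ → ℝ × ℝ} {sg : ℝ} (h : Fld Y sg) : discJ (nf Y) = discJ Y := by
  show Ldisc (fderiv ℝ (nf Y) 0) = Ldisc (fderiv ℝ Y 0)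
  rw [nf_fderiv h]

theorem nf_rJ {Y : ℝ × ℝ → ℝ × ℝ} {sg : ℝ} (h : Fld Y sg) : rJ (nf Y) = rJ Y := by
  show Lr (fderiv ℝ (nf Y) 0) = Lr (fderiv ℝ Y 0)
  rw [nf_fderiv h]

theorem sg_cases {X : ℝ × ℝ → ℝ × ℝ} {sg : ℝ} (hX : Fld X sg) : sg = 1 ∨ sg = -1 :=
  mul_self_eq_one_iff.mp hX.sg_sq

theorem propB_true {X Y : ℝ × ℝ → ℝ × ℝ} {sg : ℝ} (hX : Fld X sg) (hY : Fld Y sg)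
    (hdX : discJ X < 0) (hdY : discJ Y < 0) (hr : rJ X + rJ Y < 0) : PropB X Y := by
  have hp := Real.pi_pos
  have hpr : Real.pi * (rJ X + rJ Y) < 0 := mul_neg_of_pos_of_neg hp hr
  obtain ⟨P, hP1, hP2, -⟩ := focus_arcs hX hdX (ε := -(Real.pi * (rJ X + rJ Y)) / 4) (by linarith)
  obtain ⟨Q, hQ1, hQ2, -⟩ := focus_arcs hY.nf (by rwa [nf_disc hY])
    (ε := -(Real.pi * (rJ X + rJ Y)) / 4) (by linarith)
  rw [nf_rJ hY] at hQ1
  intro W hW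
  obtain ⟨s₁, h1⟩ := hP2 W hW
  obtain ⟨s₂, h2⟩ := hQ2 _ (neg_nhds_zero hW)
  set s := min s₁ (s₂ - Real.pi * rJ X - -(Real.pi * (rJ X + rJ Y)) / 4) with hs
  have k1 := (abs_le.mp (hP1 s)).2
  have k2 := (abs_le.mp (hQ1 (P s))).2
  have k3 : s ≤ s₂ - Real.pi * rJ X - -(Real.pi * (rJ X + rJ Y)) / 4 := min_le_right _ _
  have a1 := h1 s (min_le_left _ _)
  have a2 := (h2 (P s) (by linarith)).nf_iff_rev
  rw [neg_neg] at a2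
  simp only [Prod.neg_mk, neg_zero, neg_neg] at a2
  refine ⟨_, _, _, ?_, a1, a2⟩
  have hlt : Real.exp (Q (P s)) < Real.exp s := Real.exp_lt_exp.mpr (by nlinarith)
  have hpos := Real.exp_pos (Q (P s))
  rcases sg_cases hX with rfl | rfl
  · left; constructor <;> linarith
  · right; constructor <;> linarith

theorem propB_false {X Y : ℝ × ℝ → ℝ × ℝ} {sg : ℝ} (hX : Fld X sg) (hY : Fld Y sg)
    (hdX : discJ X < 0) (hdY : discJ Y < 0) (hr : 0 < rJ X + rJ Y) : ¬ PropB X Y := by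
  have hp := Real.pi_pos
  have hpr : 0 < Real.pi * (rJ X + rJ Y) := mul_pos hp hr
  obtain ⟨P, hP1, -, W₁, hW₁, hP2⟩ := focus_arcs hX hdX (ε := (Real.pi * (rJ X + rJ Y)) / 4)
    (by linarith)
  obtain ⟨Q, hQ1, -, W₂, hW₂, hQ2⟩ := focus_arcs hY.nf (by rwa [nf_disc hY])
    (ε := (Real.pi * (rJ X + rJ Y)) / 4) (by linarith)
  rw [nf_rJ hY] at hQ1
  intro hB
  obtain ⟨x₀, x₁, x₂, hx, ha, hb⟩ := hB (W₁ ∩ -W₂) (inter_mem hW₁ (neg_nhds_zero hW₂))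
  have hx0 : x₀ ≠ 0 := by
    rcases hx with ⟨p, q⟩ | ⟨p, q⟩ <;> intro h <;> linarith
  obtain ⟨s, e0, e1⟩ := hP2 x₀ x₁ hx0 (ha.mono fun p hp => ⟨hp.1.1, hp.2⟩)
  have hb' := (hb.mono (S' := (-W₂) ∩ LHP) fun p hp => ⟨hp.1.2, hp.2⟩).nf_iff
  rw [neg_neg] at hb'
  simp only [Prod.neg_mk, neg_zero] at hb'
  have hsg := sg_ne hX
  have hx1 : -x₁ ≠ 0 := by
    rw [e1, neg_neg]; exact mul_ne_zero hsg (Real.exp_ne_zero _)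
  obtain ⟨u, f0, f1⟩ := hQ2 (-x₁) (-x₂) hx1 hb'
  have hu : u = P s := by
    rw [e1, neg_neg] at f0
    exact (Real.exp_injective (mul_left_cancel₀ hsg f0)).symm
  subst hu
  have k1 := (abs_le.mp (hP1 s)).1
  have k2 := (abs_le.mp (hQ1 (P s))).1
  have hlt : Real.exp s < Real.exp (Q (P s)) := Real.exp_lt_exp.mpr (by nlinarith)
  have hpos := Real.exp_pos s
  rcases sg_cases hX with rfl | rfl
  · rcases hx with ⟨p, q⟩ | ⟨p, q⟩ <;> linarith
  · rcases hx with ⟨p, q⟩ | ⟨p, q⟩ <;> linarith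


/-! ### M17: linear perturbations and the main theorem -/

def pert (X : ℝ × ℝ → ℝ × ℝ) (L : Lin) (t : ℝ) : ℝ × ℝ → ℝ × ℝ := fun p => X p + t • L p

theorem pert_fderiv {X : ℝ × ℝ → ℝ × ℝ} {p : ℝ × ℝ} (h : DifferentiableAt ℝ X p) (L : Lin) (t : ℝ) :
    fderiv ℝ (pert X L t) p = fderiv ℝ X p + t • L :=
  (h.hasFDerivAt.add (L.hasFDerivAt.const_smul t)).fderiv

theorem pert_jac {X : ℝ × ℝ → ℝ × ℝ} (h : DifferentiableAt ℝ X (0, 0)) (L : Lin) (t : ℝ) :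
    jac11 (pert X L t) = jac11 X + t * L11 L ∧ jac12 (pert X L t) = jac12 X + t * L12 L ∧
    jac21 (pert X L t) = jac21 X + t * L21 L ∧ jac22 (pert X L t) = jac22 X + t * L22 L := by
  simp only [jac11, jac12, jac21, jac22, pert_fderiv h, L11, L12, L21, L22]
  simp

theorem InOmega0.swap {U : Set (ℝ × ℝ)} {X Y : ℝ × ℝ → ℝ × ℝ} (h : InOmega0 U X Y) :
    InOmega0 U Y X := by
  obtain ⟨h1, h2, h3, h4, h5, h6, h7, h8⟩ := h
  exact ⟨h1, h2, h4, h3, h6, h5, by rwa [mul_comm], by rwa [mul_comm]⟩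

theorem InOmega0.diff {U : Set (ℝ × ℝ)} {X Y : ℝ × ℝ → ℝ × ℝ} (h : InOmega0 U X Y) {p : ℝ × ℝ}
    (hp : p ∈ U) : DifferentiableAt ℝ X p :=
  (h.2.2.1.differentiableOn one_ne_zero).differentiableAt (h.1.mem_nhds hp)

theorem pert_mem {U : Set (ℝ × ℝ)} {X Y : ℝ × ℝ → ℝ × ℝ} (h : InOmega0 U X Y) {L : Lin}
    (hL : L21 L = 0) : ∀ᶠ t in nhds (0 : ℝ), InOmega0 U (pert X L t) Y := by
  have hd := h.diff h.2.1
  obtain ⟨h1, h2, h3, h4, h5, h6, h7, h8⟩ := h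
  have hc : Continuous (fun t => detJ (pert X L t)) := by
    have : (fun t => detJ (pert X L t)) = fun t => (jac11 X + t * L11 L) * (jac22 X + t * L22 L)
        - (jac12 X + t * L12 L) * (jac21 X + t * L21 L) := by
      funext t
      obtain ⟨e1, e2, e3, e4⟩ := pert_jac hd L t
      rw [detJ, e1, e2, e3, e4]
    rw [this]; fun_prop
  have h0 : detJ (pert X L 0) ≠ 0 := by
    obtain ⟨e1, e2, e3, e4⟩ := pert_jac hd L 0
    rw [detJ, e1, e2, e3, e4]
    simpa [detJ] using left_ne_zero_of_mul h7
  filter_upwards [hc.continuousAt.eventually_ne h0] with t ht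
  refine ⟨h1, h2, ?_, h4, ?_, h6, mul_ne_zero ht (right_ne_zero_of_mul h7), ?_⟩
  · have hl : ContDiff ℝ 1 (fun p => t • L p) := (t • L).contDiff
    exact h3.add hl.contDiffOn
  · have : L (0, 0) = 0 := map_zero L
    simp only [pert, h5, this]
    simp
  · rw [(pert_jac hd L t).2.2.1, hL]
    simpa using h8

theorem pert_close {U : Set (ℝ × ℝ)} {X Y : ℝ × ℝ → ℝ × ℝ} (h : InOmega0 U X Y) (L : Lin)
    {r ε : ℝ} (hr : 0 < r) (hrU : Metric.closedBall ((0, 0) : ℝ × ℝ) r ⊆ U) (hε : 0 < ε) :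
    ∀ᶠ t in nhds (0 : ℝ), ∀ p ∈ Metric.closedBall ((0, 0) : ℝ × ℝ) r,
      ‖X p - pert X L t p‖ + ‖fderiv ℝ X p - fderiv ℝ (pert X L t) p‖ < ε := by
  have hc : Continuous (fun t : ℝ => |t| * (‖L‖ * (r + 1))) := by fun_prop
  have h0 : (fun t : ℝ => |t| * (‖L‖ * (r + 1))) 0 < ε := by simpa using hε
  filter_upwards [hc.continuousAt.eventually_lt continuousAt_const h0] with t ht p hp
  have hpn : ‖p‖ ≤ r := by
    have : p ∈ Metric.closedBall (0 : ℝ × ℝ) r := hp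
    rwa [mem_closedBall_zero_iff] at this
  rw [pert_fderiv (h.diff (hrU hp))]
  have e1 : X p - pert X L t p = -(t • L p) := by simp [pert]
  have e2 : fderiv ℝ X p - (fderiv ℝ X p + t • L) = -(t • L) := by simp
  rw [e1, e2, norm_neg, norm_neg, norm_smul, norm_smul, Real.norm_eq_abs]
  have k1 : ‖L p‖ ≤ ‖L‖ * r := (L.le_opNorm p).trans (mul_le_mul_of_nonneg_left hpn (norm_nonneg _))
  have k2 := mul_le_mul_of_nonneg_left k1 (abs_nonneg t)
  nlinarith

theorem eventually_pm {p : ℝ → Prop} (h : ∀ᶠ t in nhds (0 : ℝ), p t) :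
    ∃ δ > 0, p δ ∧ p (-δ) := by
  obtain ⟨δ, hδ, hb⟩ := Metric.eventually_nhds_iff.mp h
  refine ⟨δ / 2, by linarith, hb ?_, hb ?_⟩
  · rw [Real.dist_eq, sub_zero, abs_of_pos] <;> linarith
  · rw [Real.dist_eq, sub_zero, abs_neg, abs_of_pos] <;> linarith

def shear : Lin := (ContinuousLinearMap.snd ℝ ℝ ℝ).prod 0

theorem shear_disc {X : ℝ × ℝ → ℝ × ℝ} (h : DifferentiableAt ℝ X (0, 0)) (t : ℝ) :
    discJ (pert X shear t) = discJ X + 4 * t * jac21 X := by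
  obtain ⟨e1, e2, e3, e4⟩ := pert_jac h shear t
  simp only [discJ, trJ, detJ, e1, e2, e3, e4]
  simp [L11, L12, L21, L22, shear]
  ring

theorem id_disc {X : ℝ × ℝ → ℝ × ℝ} (h : DifferentiableAt ℝ X (0, 0)) (t : ℝ) :
    discJ (pert X (ContinuousLinearMap.id ℝ (ℝ × ℝ)) t) = discJ X := by
  obtain ⟨e1, e2, e3, e4⟩ := pert_jac h (ContinuousLinearMap.id ℝ (ℝ × ℝ)) t
  simp only [discJ, trJ, detJ, e1, e2, e3, e4]
  simp [L11, L12, L21, L22]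
  ring

theorem id_tr {X : ℝ × ℝ → ℝ × ℝ} (h : DifferentiableAt ℝ X (0, 0)) (t : ℝ) :
    trJ (pert X (ContinuousLinearMap.id ℝ (ℝ × ℝ)) t) = trJ X + 2 * t := by
  obtain ⟨e1, e2, e3, e4⟩ := pert_jac h (ContinuousLinearMap.id ℝ (ℝ × ℝ)) t
  simp only [trJ, e1, e4]
  simp [L11, L22]
  ring

/-- a degenerate discriminant can be made positive or negative by small perturbations -/
theorem shear_pair {X : ℝ × ℝ → ℝ × ℝ} (h : DifferentiableAt ℝ X (0, 0)) (hd : discJ X = 0)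
    (hj : jac21 X ≠ 0) {p : ℝ → Prop} (hp : ∀ᶠ t in nhds (0 : ℝ), p t) :
    ∃ t₁ t₂, p t₁ ∧ p t₂ ∧ discJ (pert X shear t₁) < 0 ∧ 0 < discJ (pert X shear t₂) := by
  obtain ⟨δ, hδ, h1, h2⟩ := eventually_pm hp
  simp only [shear_disc h, hd]
  rcases lt_or_gt_of_ne hj with hn | hn
  · exact ⟨δ, -δ, h1, h2, by nlinarith, by nlinarith⟩
  · exact ⟨-δ, δ, h2, h1, by nlinarith, by nlinarith⟩

theorem shear_L21 : L21 shear = 0 := by simp [L21, shear]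

theorem id_L21 : L21 (ContinuousLinearMap.id ℝ (ℝ × ℝ)) = 0 := by simp [L21]

theorem flds_ex {U : Set (ℝ × ℝ)} {X Y : ℝ × ℝ → ℝ × ℝ} (h : InOmega0 U X Y) :
    ∃ sg, Fld X sg ∧ Fld Y sg := by
  have ha : jac21 X ≠ 0 := left_ne_zero_of_mul h.2.2.2.2.2.2.2.ne'
  obtain ⟨sg, hs, hsX⟩ := exists_sg ha
  exact ⟨sg, flds_of h hs hsX⟩

theorem unstable_X {U : Set (ℝ × ℝ)} {X Y : ℝ × ℝ → ℝ × ℝ} (hZ : InOmega0 U X Y)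
    (h : ∀ L : Lin, L21 L = 0 → ∀ᶠ t in nhds (0 : ℝ), LocalSigmaEquiv (pert X L t) Y X Y) :
    discJ X ≠ 0 := by
  intro hd
  have hdiff := hZ.diff hZ.2.1
  have ha : jac21 X ≠ 0 := left_ne_zero_of_mul hZ.2.2.2.2.2.2.2.ne'
  obtain ⟨t₁, t₂, ⟨e1, m1⟩, ⟨e2, m2⟩, d1, d2⟩ := shear_pair hdiff hd ha
    ((h shear shear_L21).and (pert_mem hZ shear_L21))
  obtain ⟨s1, f1, -⟩ := flds_ex m1
  obtain ⟨s2, f2, -⟩ := flds_ex m2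
  exact propA_node f2 d2 (propA_up e2.symm (propA_up e1 (propA_focus f1 d1)))

theorem unstable_Y {U : Set (ℝ × ℝ)} {X Y : ℝ × ℝ → ℝ × ℝ} (hZ : InOmega0 U X Y)
    (h : ∀ L : Lin, L21 L = 0 → ∀ᶠ t in nhds (0 : ℝ), LocalSigmaEquiv X (pert Y L t) X Y) :
    discJ Y ≠ 0 := by
  intro hd
  have hdiff := hZ.swap.diff hZ.2.1
  have ha : jac21 Y ≠ 0 := right_ne_zero_of_mul hZ.2.2.2.2.2.2.2.ne'
  obtain ⟨t₁, t₂, ⟨e1, m1⟩, ⟨e2, m2⟩, d1, d2⟩ := shear_pair hdiff hd ha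
    ((h shear shear_L21).and (pert_mem hZ.swap shear_L21))
  obtain ⟨s1, f1, -⟩ := flds_ex m1
  obtain ⟨s2, f2, -⟩ := flds_ex m2
  have a1 : PropA (pert Y shear t₁) LHP :=
    propA_nf.mpr (propA_focus f1.nf (by rw [nf_disc f1]; exact d1))
  exact propA_node f2.nf (by rw [nf_disc f2]; exact d2)
    (propA_nf.mp (propA_down e2.symm (propA_down e1 a1)))

theorem unstable_ell {U : Set (ℝ × ℝ)} {X Y : ℝ × ℝ → ℝ × ℝ} (hZ : InOmega0 U X Y)
    (h : ∀ L : Lin, L21 L = 0 → ∀ᶠ t in nhds (0 : ℝ), LocalSigmaEquiv (pert X L t) Y X Y) :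
    ellVal X Y ≠ 0 := by
  intro hl
  have hdiff := hZ.diff hZ.2.1
  by_cases hf : discJ X < 0 ∧ discJ Y < 0
  · obtain ⟨dX, dY⟩ := hf
    rw [ellVal_focus dX dY] at hl
    obtain ⟨δ, hδ, ⟨e1, m1⟩, ⟨e2, m2⟩⟩ := eventually_pm
      ((h _ id_L21).and (pert_mem hZ id_L21))
    obtain ⟨s1, f1, g1⟩ := flds_ex m1
    obtain ⟨s2, f2, g2⟩ := flds_ex m2
    have hq := Real.sqrt_pos.mpr (by linarith : 0 < -discJ X)
    have hr : ∀ t, rJ (pert X (ContinuousLinearMap.id ℝ (ℝ × ℝ)) t) = rJ X + 2 * t / √(-discJ X) :=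
      fun t => by rw [rJ, id_disc hdiff, id_tr hdiff, rJ, add_div]
    have hpos : 0 < 2 * δ / √(-discJ X) := by positivity
    have b2 := propB_true f2 g2 (by rwa [id_disc hdiff]) dY (by
      rw [hr, show 2 * -δ / √(-discJ X) = -(2 * δ / √(-discJ X)) by ring]; linarith)
    exact propB_false f1 g1 (by rwa [id_disc hdiff]) dY (by rw [hr]; linarith)
      (propB_transfer e1.symm (propB_transfer e2 b2))
  · rw [ellVal, if_neg] at hl
    · exact one_ne_zero hl
    · intro hne
      apply hf
      constructor
      · by_contra hc
        exact left_ne_zero_of_mul hne ((eig_im X).mpr (not_lt.mp hc))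
      · by_contra hc
        exact right_ne_zero_of_mul hne ((eig_im Y).mpr (not_lt.mp hc))

theorem stmt11 (U : Set (ℝ × ℝ)) (X Y : ℝ × ℝ → ℝ × ℝ) (hZ : InOmega0 U X Y) :
    (∃ r > (0 : ℝ), Metric.closedBall ((0, 0) : ℝ × ℝ) r ⊆ U ∧
      ∃ ε > (0 : ℝ), ∀ X' Y' : ℝ × ℝ → ℝ × ℝ, InOmega0 U X' Y' →
        (∀ p ∈ Metric.closedBall ((0, 0) : ℝ × ℝ) r,
          ‖X p - X' p‖ + ‖fderiv ℝ X p - fderiv ℝ X' p‖ < ε) →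
        (∀ p ∈ Metric.closedBall ((0, 0) : ℝ × ℝ) r,
          ‖Y p - Y' p‖ + ‖fderiv ℝ Y p - fderiv ℝ Y' p‖ < ε) →
        LocalSigmaEquiv X' Y' X Y) ↔
    (eig1 X ≠ eig2 X ∧ eig1 Y ≠ eig2 Y ∧ ellVal X Y ≠ 0) := by
  constructor
  · rintro ⟨r, hr, hrU, ε, hε, hst⟩
    have hX : ∀ L : Lin, L21 L = 0 → ∀ᶠ t in nhds (0 : ℝ), LocalSigmaEquiv (pert X L t) Y X Y := by
      intro L hL
      filter_upwards [pert_mem hZ hL, pert_close hZ L hr hrU hε] with t h1 h2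
      exact hst _ _ h1 h2 (fun p _ => by simpa using hε)
    have hY : ∀ L : Lin, L21 L = 0 → ∀ᶠ t in nhds (0 : ℝ), LocalSigmaEquiv X (pert Y L t) X Y := by
      intro L hL
      filter_upwards [pert_mem hZ.swap hL, pert_close hZ.swap L hr hrU hε] with t h1 h2
      exact hst _ _ h1.swap (fun p _ => by simpa using hε) h2
    exact ⟨(eig_ne_iff X).mpr (unstable_X hZ hX), (eig_ne_iff Y).mpr (unstable_Y hZ hY),
      unstable_ell hZ hX⟩
  · rintro ⟨h1, h2, h3⟩
    obtain ⟨ε, hε, hs⟩ := generic_stable hZ h1 h2 h3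
    obtain ⟨r, hr, hrU⟩ := Metric.nhds_basis_closedBall.mem_iff.mp (hZ.1.mem_nhds hZ.2.1)
    refine ⟨r, hr, hrU, ε, hε, fun X' Y' hZ' hX hY => hs X' Y' hZ' ?_ ?_⟩
    · have := hX (0, 0) (Metric.mem_closedBall_self hr.le)
      exact lt_of_le_of_lt (le_add_of_nonneg_left (norm_nonneg _)) this
    · have := hY (0, 0) (Metric.mem_closedBall_self hr.le)
      exact lt_of_le_of_lt (le_add_of_nonneg_left (norm_nonneg _)) this
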